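/- Let d > 1 be a cube-free integer none of whose prime divisors is ≡ 1 (mod 3), and which has at least one prime divisor ≡ −1 (mod 3); let k = ℚ(∛d, ζ₃). Then rank(C_{k,3}^{(σ)}) = 1 if and only if d can be written in one of the following forms, where q₁, q₂, q₃ are pairwise distinct primes ≡ −1 (mod 3) and e, f₁, f₂, f₃ ∈ {1, 2}: (i) d = 3^{e} q₁^{f₁} with q₁ ≡ −1 (mod 9); (ii) d = q₁^{f₁} q₂^{f₂} with q₁ ≡ q₂ ≡ −1 (mod 9); (iii) d = q₁^{f₁} q₂^{f₂} ≢ ±1 (mod 9) with q_i ≢ −1 (mod 9) for some i ∈ {1,2}; (iv) d = 3^{e} q₁^{f₁} q₂^{f₂} with q_i ≢ −1 (mod 9) for some i ∈ {1,2}; (v) d = q₁^{f₁} q₂^{f₂} q₃^{f₃} ≡ ±1 (mod 9) with q₁, q₂ ≡ 2 or 5 (mod 9) and q₃ ≡ −1 (mod 9); (vi) d = q₁^{f₁} q₂^{f₂} q₃^{f₃} ≡ ±1 (mod 9) with q₁, q₂, q₃ ≡ 2 or 5 (mod 9). Moreover, in each of these cases the ambiguous 3-class group C_{k,3}^{(σ)}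 is cyclic of order 3. -/

import Mathlib

open IntermediateField NumberField
open scoped nonZeroDivisors

set_option synthInstance.maxHeartbeats 1000000
set_option maxHeartbeats 2000000

noncomputable section

instance : Fact (Nat.Prime 3) := ⟨by norm_num⟩

/-- A positive integer is cube-free if no prime cube divides it. -/
def IsCubeFree (d : ℕ) : Prop := ∀ p : ℕ, p.Prime → ¬ (p ^ 3 ∣ d)

/-- The primitive cube root of unity `ζ₃ = e^{2πi/3}`. -/
def zeta3 : ℂ := Complex.exp (2 * Real.pi * Complex.I / 3)

lemma zeta3_isPrimitiveRoot : IsPrimitiveRoot zeta3 3 := by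
  simpa [zeta3] using Complex.isPrimitiveRoot_exp 3 (by norm_num)

lemma isIntegral_zeta3 : IsIntegral ℚ zeta3 :=
  (zeta3_isPrimitiveRoot.isIntegral (by norm_num)).tower_top

/-- The real cube root of `d`, as a complex number. -/
def cbrt (d : ℕ) : ℂ := ((d : ℝ) ^ ((3 : ℝ)⁻¹) : ℝ)

lemma cbrt_pow_three (d : ℕ) : (cbrt d) ^ 3 = (d : ℂ) := by
  have h : ((d : ℝ) ^ ((3 : ℝ)⁻¹)) ^ (3 : ℕ) = (d : ℝ) := by
    rw [← Real.rpow_natCast ((d : ℝ) ^ ((3 : ℝ)⁻¹)) 3, ← Real.rpow_mul (by positivity)]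
    norm_num
  calc (cbrt d) ^ 3 = (((((d : ℝ) ^ ((3 : ℝ)⁻¹)) ^ (3:ℕ) : ℝ)) : ℂ) := by
        push_cast [cbrt]; ring
    _ = ((d : ℝ) : ℂ) := by rw [h]
    _ = (d : ℂ) := by norm_num

lemma isIntegral_cbrt (d : ℕ) : IsIntegral ℚ (cbrt d) := by
  have h : IsIntegral ℤ (cbrt d) := by
    refine ⟨Polynomial.X ^ 3 - Polynomial.C (d : ℤ), ?_, ?_⟩
    · exact Polynomial.monic_X_pow_sub_C _ (by norm_num)
    · simp [Polynomial.eval₂, cbrt_pow_three d]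
  exact h.tower_top

/-- `k = ℚ(∛d, ζ₃)`, the normal closure of the pure cubic field `ℚ(∛d)`,
realized as a subfield of `ℂ`. -/
def Kc (d : ℕ) : IntermediateField ℚ ℂ := ℚ⟮cbrt d, zeta3⟯

instance (d : ℕ) : NumberField (Kc d) where
  to_finiteDimensional := by
    apply IntermediateField.finiteDimensional_adjoin
    rintro x (rfl | rfl)
    · exact isIntegral_cbrt d
    · exact isIntegral_zeta3

lemma zeta3_mem (d : ℕ) : zeta3 ∈ Kc d :=
  IntermediateField.subset_adjoin _ _ (by simp)

lemma cbrt_mem (d : ℕ) : cbrt d ∈ Kc d :=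
  IntermediateField.subset_adjoin _ _ (by simp)

/-- `ζ₃` as an element of `k`. -/
def zetaK (d : ℕ) : Kc d := ⟨zeta3, zeta3_mem d⟩

/-- `∛d` as an element of `k`. -/
def cbrtK (d : ℕ) : Kc d := ⟨cbrt d, cbrt_mem d⟩

/-- `k₀ = ℚ(ζ₃)` realized as a subfield of `k`. -/
def k0S (d : ℕ) : IntermediateField ℚ (Kc d) := ℚ⟮zetaK d⟯

/-- `L = ℚ(∛d)` realized as a subfield of `k`. -/
def LS (d : ℕ) : IntermediateField ℚ (Kc d) := ℚ⟮cbrtK d⟯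

instance (d : ℕ) : NumberField ↥(k0S d) where
instance (d : ℕ) : NumberField ↥(LS d) where

/-- `ζ₃` as an element of `k₀ ⊆ k`. -/
def zetaK0 (d : ℕ) : ↥(k0S d) := ⟨zetaK d, IntermediateField.mem_adjoin_simple_self ℚ (zetaK d)⟩

/-- `∛d` as an element of `L ⊆ k`. -/
def cbrtL (d : ℕ) : ↥(LS d) := ⟨cbrtK d, IntermediateField.mem_adjoin_simple_self ℚ (cbrtK d)⟩

/-- The set of ideal classes of `k` fixed by the action of `σ` (ambiguous classes):
a class `c` is ambiguous if, whenever a nonzero ideal `I` represents `c`, the ideal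
`σ(I)` also represents `c`. -/
def ambiguousSet (d : ℕ) (σ : ↥(Kc d) ≃ₐ[ℚ] ↥(Kc d)) : Set (ClassGroup (𝓞 ↥(Kc d))) :=
  {c | ∀ I : (Ideal (𝓞 ↥(Kc d)))⁰, ClassGroup.mk0 I = c →
    ∀ J : (Ideal (𝓞 ↥(Kc d)))⁰,
      (J : Ideal (𝓞 ↥(Kc d))) = Ideal.map (RingOfIntegers.mapRingHom σ) (I : Ideal (𝓞 ↥(Kc d))) →
      ClassGroup.mk0 J = c}

/-- `C_{k,3}^{(σ)}`: the 3-group of ambiguous ideal classes of `k/k₀`, i.e. the subgroup of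
the 3-Sylow subgroup of the ideal class group of `k` consisting of the classes fixed by `σ`. -/
def ambiguousClassGroup (d : ℕ) (σ : ↥(Kc d) ≃ₐ[ℚ] ↥(Kc d)) :
    Subgroup (ClassGroup (𝓞 ↥(Kc d))) :=
  CommGroup.primaryComponent (ClassGroup (𝓞 ↥(Kc d))) 3 ⊓ Subgroup.closure (ambiguousSet d σ)

set_option linter.unusedSectionVars false

section GaloisAction

open scoped Pointwise

variable {F K : Type} [Field F] [NumberField F] [Field K] [NumberField K] [Algebra F K]
  [IsGalois F K]

lemma coe_smul_ringOfIntegers (σ : Gal(K/F)) (x : 𝓞 K) : ((σ • x : 𝓞 K) : K) = σ (x : K) := rfl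

lemma zpowers_eq_top_of_finrank_eq_three (h3 : Module.finrank F K = 3) {σ : Gal(K/F)}
    (hσ : σ ≠ 1) (τ : Gal(K/F)) : τ ∈ Subgroup.zpowers σ := by
  have : Fact (Nat.Prime 3) := ⟨Nat.prime_three⟩
  exact mem_zpowers_of_prime_card (p := 3) (by rw [IsGalois.card_aut_eq_finrank, h3]) hσ

lemma pow_three_eq_one_of_finrank_eq_three (h3 : Module.finrank F K = 3) (σ : Gal(K/F)) :
    σ ^ 3 = 1 := by
  rw [← h3, ← IsGalois.card_aut_eq_finrank, pow_card_eq_one']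

lemma smul_smul_smul_eq {X : Type*} [MulAction Gal(K/F) X] (h3 : Module.finrank F K = 3)
    (σ : Gal(K/F)) (x : X) : σ • σ • σ • x = x := by
  have := pow_three_eq_one_of_finrank_eq_three h3 σ
  rw [smul_smul, smul_smul, ← pow_three', this, one_smul]

lemma eq_one_or_eq_or_eq_sq (h3 : Module.finrank F K = 3) {σ : Gal(K/F)} (hσ : σ ≠ 1)
    (τ : Gal(K/F)) : τ = 1 ∨ τ = σ ∨ τ = σ * σ := by
  obtain ⟨n, hn, rfl⟩ := (isOfFinOrder_of_finite σ).mem_powers_iff_mem_zpowers.2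
    (zpowers_eq_top_of_finrank_eq_three h3 hσ τ)
  have h : σ ^ n = σ ^ (n % 3) := pow_eq_pow_mod n (pow_three_eq_one_of_finrank_eq_three h3 σ)
  have h' : n % 3 < 3 := Nat.mod_lt _ (by norm_num)
  change σ ^ n = _ ∨ σ ^ n = _ ∨ σ ^ n = _
  rw [h]
  interval_cases n % 3 <;> simp [pow_two]

lemma algebraMap_norm_eq (h3 : Module.finrank F K = 3) {σ : Gal(K/F)} (hσ : σ ≠ 1) (x : K) :
    algebraMap F K (Algebra.norm F x) = x * σ x * σ (σ x) := by
  classical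
  have h1 : σ * σ ≠ 1 := by
    intro h
    have := pow_three_eq_one_of_finrank_eq_three h3 σ
    rw [pow_succ, pow_two, h, one_mul] at this
    exact hσ this
  have h2 : σ * σ ≠ σ := by simpa using hσ
  rw [Algebra.norm_eq_prod_automorphisms]
  have : (Finset.univ : Finset Gal(K/F)) = {1, σ, σ * σ} := by
    ext τ
    simpa using eq_one_or_eq_or_eq_sq h3 hσ τ
  rw [this, Finset.prod_insert (by simp [hσ.symm, h1.symm]), Finset.prod_insert (by simp [h2.symm]),
    Finset.prod_singleton]
  simp [mul_assoc]

/-- The relative norm to the base field, as an element of the top ring of integers. -/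
def cubicNorm (σ : Gal(K/F)) (x : 𝓞 K) : 𝓞 K := x * σ • x * σ • σ • x

lemma cubicNorm_mul (σ : Gal(K/F)) (x y : 𝓞 K) :
    cubicNorm σ (x * y) = cubicNorm σ x * cubicNorm σ y := by
  simp only [cubicNorm, smul_mul']; ring

lemma cubicNorm_one (σ : Gal(K/F)) : cubicNorm σ (1 : 𝓞 K) = 1 := by
  simp [cubicNorm]

lemma cubicNorm_smul (h3 : Module.finrank F K = 3) (σ : Gal(K/F)) (x : 𝓞 K) :
    cubicNorm σ (σ • x) = cubicNorm σ x := by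
  simp only [cubicNorm, smul_smul_smul_eq h3]; ring

lemma smul_cubicNorm (h3 : Module.finrank F K = 3) (σ : Gal(K/F)) (x : 𝓞 K) :
    σ • cubicNorm σ x = cubicNorm σ x := by
  simp only [cubicNorm, smul_mul', smul_smul_smul_eq h3]; ring

lemma cubicNorm_ne_zero (σ : Gal(K/F)) {x : 𝓞 K} (hx : x ≠ 0) : cubicNorm σ x ≠ 0 := by
  simp [cubicNorm, hx, smul_eq_zero_iff_eq]

lemma smul_algebraMap_ringOfIntegers (σ : Gal(K/F)) (a : 𝓞 F) :
    σ • (algebraMap (𝓞 F) (𝓞 K) a) = algebraMap (𝓞 F) (𝓞 K) a := by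
  apply RingOfIntegers.ext
  rw [coe_smul_ringOfIntegers]
  exact σ.commutes (a : F)

lemma exists_algebraMap_eq_of_smul_eq (h3 : Module.finrank F K = 3) {σ : Gal(K/F)} (hσ : σ ≠ 1)
    {x : 𝓞 K} (hx : σ • x = x) : ∃ a : 𝓞 F, algebraMap (𝓞 F) (𝓞 K) a = x := by
  have hfix : ∀ τ : Gal(K/F), τ (x : K) = x := by
    intro τ
    have h1 : σ (x : K) = x := congrArg (algebraMap (𝓞 K) K) hx
    rcases eq_one_or_eq_or_eq_sq h3 hσ τ with rfl | rfl | rfl <;> simp [h1]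
  obtain ⟨y, hy⟩ := (IsGalois.mem_range_algebraMap_iff_fixed (x : K)).2 hfix
  have hIntegral : IsIntegral ℤ y := by
    have h : IsIntegral ℤ (algebraMap F K y) := hy ▸ RingOfIntegers.isIntegral_coe x
    exact (isIntegral_algebraMap_iff (algebraMap F K).injective).1 h
  exact ⟨⟨y, hIntegral⟩, RingOfIntegers.ext hy⟩

/-- Hilbert 90 for fractions of integers. -/
lemma exists_mul_smul_eq_mul_of_cubicNorm_eq (h3 : Module.finrank F K = 3) {σ : Gal(K/F)}
    (hσ : σ ≠ 1) {a b : 𝓞 K} (ha : a ≠ 0) (hb : b ≠ 0) (hab : cubicNorm σ a = cubicNorm σ b) :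
    ∃ e : 𝓞 K, e ≠ 0 ∧ b * σ • e = a * e := by
  have : IsCyclic Gal(K/F) := ⟨σ, zpowers_eq_top_of_finrank_eq_three h3 hσ⟩
  have ha' : (a : K) ≠ 0 := by simpa using ha
  have hb' : (b : K) ≠ 0 := by simpa using hb
  have hab' : (a : K) * σ a * σ (σ a) = b * σ b * σ (σ b) := congrArg (algebraMap (𝓞 K) K) hab
  have hn : Algebra.norm F ((b : K) / a) = 1 := by
    apply (algebraMap F K).injective
    rw [algebraMap_norm_eq h3 hσ, map_one, map_div₀, map_div₀, div_mul_div_comm, div_mul_div_comm,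
      hab', div_self]
    simp [hb']
  obtain ⟨y, hy⟩ := groupCohomology.exists_div_of_norm_eq_one
    (zpowers_eq_top_of_finrank_eq_three h3 hσ) hn
  have hy0 : (y : K) ≠ 0 := y.ne_zero
  have hσy : σ (y : K) ≠ 0 := by simp
  have hby : (b : K) * σ y = a * y := by
    have h : (y : K) / σ y = b / a := hy
    rw [div_eq_div_iff hσy ha'] at h
    rw [← h, mul_comm]
  obtain ⟨n, hn0, hIntegral⟩ := IsAlgebraic.exists_integral_multiple (R := ℤ) (z := (y : K))
    ((IsFractionRing.isAlgebraic_iff ℤ ℚ K).2 (Algebra.IsAlgebraic.isAlgebraic _))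
  refine ⟨⟨n • (y : K), hIntegral⟩, ?_, ?_⟩
  · intro h
    have h' : n • (y : K) = 0 := congrArg (algebraMap (𝓞 K) K) h
    simp [hn0] at h'
  · apply RingOfIntegers.ext
    change (b : K) * σ (n • (y : K)) = a * (n • (y : K))
    rw [map_zsmul, mul_smul_comm, mul_smul_comm, hby]

end GaloisAction

lemma Subgroup.relIndex_goursatFst_eq {X Y : Type*} [CommGroup X] [CommGroup Y]
    (R : Subgroup (X × Y)) :
    R.goursatFst.relIndex (R.map (MonoidHom.fst X Y)) =
      R.goursatSnd.relIndex (R.map (MonoidHom.snd X Y)) := by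
  have h1 : R.map (MonoidHom.fst X Y) = ((MonoidHom.fst X Y).comp R.subtype).range := by
    rw [MonoidHom.range_comp, Subgroup.range_subtype]
  have h2 : R.map (MonoidHom.snd X Y) = ((MonoidHom.snd X Y).comp R.subtype).range := by
    rw [MonoidHom.range_comp, Subgroup.range_subtype]
  rw [h1, h2, ← Subgroup.index_comap, ← Subgroup.index_comap, Subgroup.goursatFst,
    Subgroup.goursatSnd, Subgroup.comap_map_eq, Subgroup.comap_map_eq, sup_comm]

section AmbiguousIdeals

open scoped Pointwise

variable {F K : Type} [Field F] [NumberField F] [Field K] [NumberField K] [Algebra F K]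
  [IsGalois F K]

lemma smul_span_singleton (σ : Gal(K/F)) (a : 𝓞 K) :
    σ • Ideal.span {a} = Ideal.span {σ • a} := by
  rw [Ideal.smul_closure, Set.smul_set_singleton]

lemma smul_ideal_ne_zero (σ : Gal(K/F)) (I : (Ideal (𝓞 K))⁰) : σ • (I : Ideal (𝓞 K)) ≠ 0 := by
  rw [Ne, smul_eq_zero_iff_eq]
  exact nonZeroDivisors.ne_zero I.2

lemma mem_nonZeroDivisors_smul (σ : Gal(K/F)) (I : (Ideal (𝓞 K))⁰) :
    σ • (I : Ideal (𝓞 K)) ∈ (Ideal (𝓞 K))⁰ :=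
  mem_nonZeroDivisors_of_ne_zero (smul_ideal_ne_zero σ I)

lemma span_singleton_ne_zero {a : 𝓞 K} (ha : a ≠ 0) : Ideal.span {a} ≠ (0 : Ideal (𝓞 K)) := by
  simpa using ha

/-- The action of an automorphism on the unit group of the ring of integers. -/
def unitsAct (σ : Gal(K/F)) : (𝓞 K)ˣ →* (𝓞 K)ˣ :=
  Units.map (MulSemiringAction.toRingHom Gal(K/F) (𝓞 K) σ : 𝓞 K →* 𝓞 K)

@[simp] lemma coe_unitsAct (σ : Gal(K/F)) (u : (𝓞 K)ˣ) :
    (unitsAct σ u : 𝓞 K) = σ • (u : 𝓞 K) := rfl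

/-- The relative norm on units, with values in the top unit group. -/
def unitsNorm (σ : Gal(K/F)) : (𝓞 K)ˣ →* (𝓞 K)ˣ :=
  MonoidHom.id _ * unitsAct σ * (unitsAct σ).comp (unitsAct σ)

@[simp] lemma coe_unitsNorm (σ : Gal(K/F)) (u : (𝓞 K)ˣ) :
    (unitsNorm σ u : 𝓞 K) = cubicNorm σ u := by
  simp [unitsNorm, cubicNorm]

/-- The map `u ↦ σ u / u` on units. -/
def unitsDiff (σ : Gal(K/F)) : (𝓞 K)ˣ →* (𝓞 K)ˣ := unitsAct σ / MonoidHom.id _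

lemma unitsDiff_apply (σ : Gal(K/F)) (u : (𝓞 K)ˣ) : unitsDiff σ u = unitsAct σ u / u := rfl

lemma mem_ker_unitsDiff (σ : Gal(K/F)) (u : (𝓞 K)ˣ) :
    u ∈ (unitsDiff σ).ker ↔ σ • (u : 𝓞 K) = u := by
  rw [MonoidHom.mem_ker, unitsDiff_apply, div_eq_one, Units.ext_iff, coe_unitsAct]

/-- The relation between units that are norms and ambiguous classes. -/
def ambiguousRel (h3 : Module.finrank F K = 3) (σ : Gal(K/F)) :
    Subgroup ((𝓞 K)ˣ × ClassGroup (𝓞 K)) where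
  carrier := {p | σ • (p.1 : 𝓞 K) = p.1 ∧ ∃ I : (Ideal (𝓞 K))⁰, ClassGroup.mk0 I = p.2 ∧
    ∃ a b : 𝓞 K, a ≠ 0 ∧ b ≠ 0 ∧
      Ideal.span {a} * σ • (I : Ideal (𝓞 K)) = Ideal.span {b} * I ∧
      cubicNorm σ b = p.1 * cubicNorm σ a}
  one_mem' := by
    refine ⟨by simp, 1, by simp, 1, 1, one_ne_zero, one_ne_zero, ?_, ?_⟩
    · rw [OneMemClass.coe_one, smul_one]
    · simp [cubicNorm_one]
  mul_mem' := by
    rintro ⟨u, c⟩ ⟨u', c'⟩ ⟨hu, I, hI, a, b, ha, hb, hab, hn⟩ ⟨hu', I', hI', a', b', ha', hb', hab', hn'⟩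
    refine ⟨?_, I * I', ?_, a * a', b * b', mul_ne_zero ha ha', mul_ne_zero hb hb', ?_, ?_⟩
    · simp only [Prod.fst_mul, Units.val_mul, smul_mul'] at *
      rw [hu, hu']
    · simp [hI, hI']
    · rw [Submonoid.coe_mul, smul_mul', ← Ideal.span_singleton_mul_span_singleton,
        ← Ideal.span_singleton_mul_span_singleton, mul_mul_mul_comm, hab, hab', mul_mul_mul_comm]
    · simp only [Prod.fst_mul, Units.val_mul] at *
      rw [cubicNorm_mul, cubicNorm_mul, hn, hn']; ring
  inv_mem' := by
    rintro ⟨u, c⟩ ⟨hu, I, hI, a, b, ha, hb, hab, hn⟩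
    obtain ⟨I', hI'⟩ := ClassGroup.mk0_surjective c⁻¹
    have h : ClassGroup.mk0 I' = (ClassGroup.mk0 I)⁻¹ := by rw [hI', hI]
    rw [ClassGroup.mk0_eq_mk0_inv_iff] at h
    obtain ⟨e, he, hee⟩ := h
    have hσe : σ • e ≠ 0 := by rwa [Ne, smul_eq_zero_iff_eq]
    refine ⟨?_, I', hI', b * e, a * σ • e, mul_ne_zero hb he, mul_ne_zero ha hσe, ?_, ?_⟩
    · have h1 : unitsAct σ u = u := Units.ext hu
      change σ • ((u⁻¹ : (𝓞 K)ˣ) : 𝓞 K) = (u⁻¹ : (𝓞 K)ˣ)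
      rw [← coe_unitsAct, map_inv, h1]
    · have hI0 : (I : Ideal (𝓞 K)) ≠ 0 := nonZeroDivisors.ne_zero I.2
      apply mul_left_cancel₀ hI0
      rw [← Ideal.span_singleton_mul_span_singleton, ← Ideal.span_singleton_mul_span_singleton,
        ← smul_span_singleton, ← hee, smul_mul']
      calc _ = (Ideal.span {b} * I) * I' * I * σ • (I' : Ideal (𝓞 K)) := by ring
        _ = _ := by rw [← hab]; ring
    · change _ = ((u⁻¹ : (𝓞 K)ˣ) : 𝓞 K) * _
      change _ = (u : 𝓞 K) * _ at hn
      rw [cubicNorm_mul, cubicNorm_mul, hn, cubicNorm_smul h3, ← mul_assoc, ← mul_assoc,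
        Units.inv_mul, one_mul]

variable (h3 : Module.finrank F K = 3) {σ : Gal(K/F)}

lemma associated_of_span_mul_eq {I : Ideal (𝓞 K)} (hI : I ≠ 0) {a b : 𝓞 K}
    (h : Ideal.span {a} * I = Ideal.span {b} * I) : Associated a b := by
  rw [← Ideal.span_singleton_eq_span_singleton]
  exact mul_right_cancel₀ hI h

include h3 in
lemma span_cubicNorm_mul_ideal (I : Ideal (𝓞 K)) {a b : 𝓞 K}
    (h : Ideal.span {a} * σ • I = Ideal.span {b} * I) :
    Ideal.span {cubicNorm σ a} * (I * σ • I * σ • σ • I) =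
      Ideal.span {cubicNorm σ b} * (I * σ • I * σ • σ • I) := by
  have h1 := congrArg (σ • ·) h
  have h2 := congrArg (σ • ·) h1
  simp only [smul_mul', smul_span_singleton, smul_smul_smul_eq h3] at h1 h2
  simp only [cubicNorm, ← Ideal.span_singleton_mul_span_singleton]
  calc _ = (Ideal.span {a} * σ • I) * (Ideal.span {σ • a} * σ • σ • I) *
        (Ideal.span {σ • σ • a} * I) := by ring
    _ = _ := by rw [h, h1, h2]; ring

/-- The group of ambiguous ideal classes. -/
def ambClasses (h3 : Module.finrank F K = 3) (σ : Gal(K/F)) : Subgroup (ClassGroup (𝓞 K)) :=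
  (ambiguousRel h3 σ).map (MonoidHom.snd _ _)

/-- The group of fixed units that are norms of field elements. -/
def normUnits (h3 : Module.finrank F K = 3) (σ : Gal(K/F)) : Subgroup (𝓞 K)ˣ :=
  (ambiguousRel h3 σ).map (MonoidHom.fst _ _)

/-- The group of classes of invariant ideals. -/
def strongAmbClasses (h3 : Module.finrank F K = 3) (σ : Gal(K/F)) : Subgroup (ClassGroup (𝓞 K)) :=
  (ambiguousRel h3 σ).goursatSnd

lemma mem_ambClasses_iff_exists (c : ClassGroup (𝓞 K)) :
    c ∈ ambClasses h3 σ ↔ ∃ I : (Ideal (𝓞 K))⁰, ClassGroup.mk0 I = c ∧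
      ∃ a b : 𝓞 K, a ≠ 0 ∧ b ≠ 0 ∧
        Ideal.span {a} * σ • (I : Ideal (𝓞 K)) = Ideal.span {b} * I := by
  constructor
  · rintro ⟨⟨u, c⟩, ⟨-, I, hI, a, b, ha, hb, hab, -⟩, rfl⟩
    exact ⟨I, hI, a, b, ha, hb, hab⟩
  · rintro ⟨I, hI, a, b, ha, hb, hab⟩
    have h0 : (I : Ideal (𝓞 K)) * σ • (I : Ideal (𝓞 K)) * σ • σ • (I : Ideal (𝓞 K)) ≠ 0 := by
      simp only [ne_eq, mul_eq_zero, smul_eq_zero_iff_eq, or_self]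
      exact nonZeroDivisors.ne_zero I.2
    obtain ⟨u, hu⟩ := associated_of_span_mul_eq h0 (span_cubicNorm_mul_ideal h3 _ hab)
    refine ⟨(u, c), ⟨?_, I, hI, a, b, ha, hb, hab, ?_⟩, rfl⟩
    · have h1 := congrArg (σ • ·) hu
      simp only [smul_mul', smul_cubicNorm h3] at h1
      rw [← hu] at h1
      exact mul_left_cancel₀ (cubicNorm_ne_zero σ ha) h1
    · rw [← hu, mul_comm]

lemma mem_ambClasses_iff (I : (Ideal (𝓞 K))⁰) :
    ClassGroup.mk0 I ∈ ambClasses h3 σ ↔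
      ClassGroup.mk0 ⟨σ • (I : Ideal (𝓞 K)), mem_nonZeroDivisors_smul σ I⟩ = ClassGroup.mk0 I := by
  rw [mem_ambClasses_iff_exists]
  constructor
  · rintro ⟨J, hJ, a, b, ha, hb, hab⟩
    rw [ClassGroup.mk0_eq_mk0_iff] at hJ
    obtain ⟨x, y, hx, hy, hxy⟩ := hJ
    have h1 := congrArg (σ • ·) hxy
    simp only [smul_mul', smul_span_singleton] at h1
    have hσ : ∀ {z : 𝓞 K}, z ≠ 0 → σ • z ≠ 0 := fun h => by rwa [Ne, smul_eq_zero_iff_eq]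
    rw [ClassGroup.mk0_eq_mk0_iff]
    refine ⟨a * σ • y * x, b * σ • x * y, mul_ne_zero (mul_ne_zero ha (hσ hy)) hx,
      mul_ne_zero (mul_ne_zero hb (hσ hx)) hy, ?_⟩
    simp only [← Ideal.span_singleton_mul_span_singleton]
    calc _ = Ideal.span {a} * Ideal.span {x} * (Ideal.span {σ • y} * σ • (I : Ideal (𝓞 K))) := by
          ring
      _ = Ideal.span {x} * Ideal.span {σ • x} * (Ideal.span {a} * σ • (J : Ideal (𝓞 K))) := by
          rw [← h1]; ring
      _ = Ideal.span {b} * Ideal.span {σ • x} * (Ideal.span {x} * (J : Ideal (𝓞 K))) := by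
          rw [hab]; ring
      _ = _ := by rw [hxy]; ring
  · intro h
    rw [ClassGroup.mk0_eq_mk0_iff] at h
    obtain ⟨a, b, ha, hb, hab⟩ := h
    exact ⟨I, rfl, a, b, ha, hb, hab⟩

lemma mem_normUnits_iff (u : (𝓞 K)ˣ) :
    u ∈ normUnits h3 σ ↔ σ • (u : 𝓞 K) = u ∧ ∃ a b : 𝓞 K, a ≠ 0 ∧ b ≠ 0 ∧
      cubicNorm σ b = u * cubicNorm σ a := by
  constructor
  · rintro ⟨⟨u, c⟩, ⟨hu, I, hI, a, b, ha, hb, -, hab⟩, rfl⟩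
    exact ⟨hu, a, b, ha, hb, hab⟩
  · rintro ⟨hu, a, b, ha, hb, hab⟩
    have hσ : ∀ {z : 𝓞 K}, z ≠ 0 → σ • z ≠ 0 := fun h => by rwa [Ne, smul_eq_zero_iff_eq]
    have hI0 : Ideal.span {b * σ • b} ⊔ Ideal.span {a * σ • b} ⊔ Ideal.span {a * σ • a} ∈
        (Ideal (𝓞 K))⁰ := by
      apply mem_nonZeroDivisors_of_ne_zero
      intro h
      have h1 : Ideal.span {b * σ • b} = (⊥ : Ideal (𝓞 K)) :=
        eq_bot_iff.2 ((le_sup_left.trans le_sup_left).trans h.le)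
      exact span_singleton_ne_zero (mul_ne_zero hb (hσ hb)) h1
    refine ⟨(u, ClassGroup.mk0 ⟨_, hI0⟩), ⟨hu, ⟨_, hI0⟩, rfl, a, σ • σ • b, ha, hσ (hσ hb), ?_, ?_⟩,
      rfl⟩
    · change Ideal.span {a} * σ • (Ideal.span {b * σ • b} ⊔ Ideal.span {a * σ • b} ⊔
        Ideal.span {a * σ • a}) = Ideal.span {σ • σ • b} * (Ideal.span {b * σ • b} ⊔
        Ideal.span {a * σ • b} ⊔ Ideal.span {a * σ • a})
      rw [Ideal.smul_sup, Ideal.smul_sup]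
      simp only [smul_span_singleton, Ideal.mul_sup, Ideal.span_singleton_mul_span_singleton,
        smul_mul']
      have h1 : Ideal.span {a * (σ • a * σ • σ • a)} =
          Ideal.span {σ • σ • b * (b * σ • b)} := by
        rw [Ideal.span_singleton_eq_span_singleton]
        refine ⟨u, ?_⟩
        have := hab
        simp only [cubicNorm] at this
        linear_combination -this
      rw [h1, sup_comm, sup_assoc]
      congr 2 <;> ring_nf
    · rw [cubicNorm_smul h3, cubicNorm_smul h3]; exact hab

lemma goursatFst_ambiguousRel :
    (ambiguousRel h3 σ).goursatFst = (unitsNorm σ).range := by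
  ext u
  rw [Subgroup.mem_goursatFst]
  constructor
  · rintro ⟨hu, I, hI, a, b, ha, hb, hab, hn⟩
    obtain ⟨e, he⟩ := (ClassGroup.mk0_eq_one_iff I.2).1 hI
    have he' : (I : Ideal (𝓞 K)) = Ideal.span {e} := he
    have he0 : e ≠ 0 := by
      rintro rfl
      exact nonZeroDivisors.ne_zero I.2 (by simpa using he')
    have he1 : σ • e ≠ 0 := by rwa [Ne, smul_eq_zero_iff_eq]
    rw [he', smul_span_singleton, Ideal.span_singleton_mul_span_singleton,
      Ideal.span_singleton_mul_span_singleton, Ideal.span_singleton_eq_span_singleton] at hab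
    obtain ⟨v, hv⟩ := hab
    refine ⟨v, Units.ext ?_⟩
    rw [coe_unitsNorm]
    have h1 := congrArg (cubicNorm σ) hv
    change _ = (u : 𝓞 K) * _ at hn
    simp only [cubicNorm_mul, cubicNorm_smul h3, hn] at h1
    apply mul_left_cancel₀ (mul_ne_zero (cubicNorm_ne_zero σ ha) (cubicNorm_ne_zero σ he0))
    rw [h1]; ring
  · rintro ⟨v, rfl⟩
    refine ⟨?_, 1, by simp, 1, v, one_ne_zero, v.ne_zero, ?_, ?_⟩
    · rw [coe_unitsNorm, smul_cubicNorm h3]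
    · rw [OneMemClass.coe_one, smul_one, mul_one, mul_one,
        Ideal.span_singleton_eq_span_singleton]
      exact ⟨v, one_mul _⟩
    · rw [coe_unitsNorm, cubicNorm_one, mul_one]

lemma mem_strongAmbClasses_iff (hσ : σ ≠ 1) (c : ClassGroup (𝓞 K)) :
    c ∈ strongAmbClasses h3 σ ↔ ∃ I : (Ideal (𝓞 K))⁰, ClassGroup.mk0 I = c ∧
      σ • (I : Ideal (𝓞 K)) = I := by
  rw [strongAmbClasses, Subgroup.mem_goursatSnd]
  constructor
  · rintro ⟨-, I, hI, a, b, ha, hb, hab, hn⟩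
    simp only [Units.val_one, one_mul] at hn
    obtain ⟨e, he, hee⟩ := exists_mul_smul_eq_mul_of_cubicNorm_eq h3 hσ ha hb hn.symm
    have he0 : Ideal.span {e} ∈ (Ideal (𝓞 K))⁰ :=
      mem_nonZeroDivisors_of_ne_zero (span_singleton_ne_zero he)
    refine ⟨⟨Ideal.span {e}, he0⟩ * I, ?_, ?_⟩
    · rw [map_mul, hI, (ClassGroup.mk0_eq_one_iff he0).2 ⟨e, rfl⟩, one_mul]
    · rw [Submonoid.coe_mul, smul_mul', smul_span_singleton]
      apply mul_left_cancel₀ (span_singleton_ne_zero (mul_ne_zero ha hb))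
      change Ideal.span {a * b} * (Ideal.span {σ • e} * _) =
        Ideal.span {a * b} * (Ideal.span {e} * (I : Ideal (𝓞 K)))
      calc _ = (Ideal.span {b} * Ideal.span {σ • e}) * (Ideal.span {a} * σ • (I : Ideal (𝓞 K))) := by
            rw [← Ideal.span_singleton_mul_span_singleton]; ring
        _ = _ := by
            rw [hab, Ideal.span_singleton_mul_span_singleton, hee,
              ← Ideal.span_singleton_mul_span_singleton, ← Ideal.span_singleton_mul_span_singleton]
            ring
  · rintro ⟨I, hI, hσI⟩
    exact ⟨by simp, I, hI, 1, 1, one_ne_zero, one_ne_zero, by rw [hσI], by simp⟩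

lemma relIndex_strongAmbClasses :
    (unitsNorm σ).range.relIndex (normUnits h3 σ) =
      (strongAmbClasses h3 σ).relIndex (ambClasses h3 σ) := by
  rw [← goursatFst_ambiguousRel h3]
  exact Subgroup.relIndex_goursatFst_eq _

end AmbiguousIdeals

section InvariantIdeals

open scoped Pointwise
open UniqueFactorizationMonoid

/-- The exponent of a prime in the factorization of an ideal. -/
def idealVal {R : Type*} [CommRing R] [IsDedekindDomain R] (P I : Ideal R) : ℕ :=
  open Classical in (normalizedFactors I).count P

section idealVal
variable {R : Type*} [CommRing R] [IsDedekindDomain R]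

lemma idealVal_mul (P : Ideal R) {I J : Ideal R} (hI : I ≠ 0) (hJ : J ≠ 0) :
    idealVal P (I * J) = idealVal P I + idealVal P J := by
  rw [idealVal, normalizedFactors_mul hI hJ, Multiset.count_add]; rfl

lemma idealVal_one (P : Ideal R) : idealVal P 1 = 0 := by
  rw [idealVal, normalizedFactors_one]; simp

lemma idealVal_pow (P I : Ideal R) (n : ℕ) :
    idealVal P (I ^ n) = n * idealVal P I := by
  rw [idealVal, normalizedFactors_pow, Multiset.count_nsmul]; rfl

lemma idealVal_ne_zero_iff {P I : Ideal R} (hP : P.IsPrime) (hP0 : P ≠ ⊥) (hI : I ≠ 0) :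
    idealVal P I ≠ 0 ↔ P ∣ I := by
  rw [idealVal, Multiset.count_ne_zero]
  constructor
  · exact dvd_of_mem_normalizedFactors
  · intro h
    obtain ⟨q, hq, h⟩ := exists_mem_normalizedFactors_of_dvd hI
      (Ideal.prime_of_isPrime hP0 hP).irreducible h
    rwa [associated_iff_eq.mp h]

lemma dvd_of_forall_idealVal_le {I J : Ideal R} (hI : I ≠ 0) (hJ : J ≠ 0)
    (h : ∀ P : Ideal R, P.IsPrime → P ≠ ⊥ → idealVal P I ≤ idealVal P J) : I ∣ J := by
  classical
  rw [dvd_iff_normalizedFactors_le_normalizedFactors hI hJ, Multiset.le_iff_count]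
  intro P
  by_cases hP : P ∈ normalizedFactors I
  · have hp := prime_of_normalized_factor P hP
    have := h P (Ideal.isPrime_of_prime hp) hp.ne_zero
    unfold idealVal at this
    convert this
  · rw [Multiset.count_eq_zero_of_notMem hP]; exact Nat.zero_le _

lemma idealVal_self {P : Ideal R} (hP : P.IsPrime) (hP0 : P ≠ ⊥) : idealVal P P = 1 := by
  rw [idealVal, normalizedFactors_irreducible (Ideal.prime_of_isPrime hP0 hP).irreducible]
  simp

lemma idealVal_eq_zero_of_ne {P Q : Ideal R} (hP : P.IsPrime) (hP0 : P ≠ ⊥) (hPQ : Q ≠ P) :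
    idealVal Q P = 0 := by
  rw [idealVal, normalizedFactors_irreducible (Ideal.prime_of_isPrime hP0 hP).irreducible]
  simp [hPQ]

lemma emultiplicity_eq_idealVal {P I : Ideal R} (hP : P.IsPrime) (hP0 : P ≠ ⊥) (hI : I ≠ 0) :
    emultiplicity P I = idealVal P I := by
  classical
  rw [emultiplicity_eq_count_normalizedFactors (Ideal.prime_of_isPrime hP0 hP).irreducible hI,
    normalize_eq, idealVal]

end idealVal

variable {F K : Type} [Field F] [NumberField F] [Field K] [NumberField K] [Algebra F K]
  [IsGalois F K]

lemma dvd_smul_ideal_iff (σ : Gal(K/F)) (I J : Ideal (𝓞 K)) : σ • I ∣ σ • J ↔ I ∣ J := by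
  rw [Ideal.dvd_iff_le, Ideal.dvd_iff_le, Ideal.pointwise_smul_le_pointwise_smul_iff]

lemma isPrime_smul_ideal (σ : Gal(K/F)) {P : Ideal (𝓞 K)} (hP : P.IsPrime) : (σ • P).IsPrime :=
  inferInstance

lemma idealVal_smul (σ : Gal(K/F)) {P : Ideal (𝓞 K)} (hP : P.IsPrime) (hP0 : P ≠ ⊥)
    {I : Ideal (𝓞 K)} (hI : I ≠ 0) : idealVal (σ • P) (σ • I) = idealVal P I := by
  have h0 : σ • P ≠ ⊥ := by
    rw [← Ideal.zero_eq_bot, Ne, smul_eq_zero_iff_eq]; exact hP0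
  have h1 : σ • I ≠ 0 := by rwa [Ne, smul_eq_zero_iff_eq]
  have : emultiplicity (σ • P) (σ • I) = emultiplicity P I := by
    apply emultiplicity_eq_emultiplicity_iff.2
    intro n
    rw [← smul_pow', dvd_smul_ideal_iff]
  rw [emultiplicity_eq_idealVal (isPrime_smul_ideal σ hP) h0 h1,
    emultiplicity_eq_idealVal hP hP0 hI] at this
  exact_mod_cast this

/-- An ideal is (totally) ramified if the generator acts trivially modulo it. -/
def IsTotRam (σ : Gal(K/F)) (P : Ideal (𝓞 K)) : Prop := ∀ x : 𝓞 K, σ • x - x ∈ P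

lemma card_inertia_eq (h3 : Module.finrank F K = 3) {σ : Gal(K/F)} (hσ : σ ≠ 1)
    (P : Ideal (𝓞 K)) :
    (IsTotRam σ P ∧ Nat.card (P.inertia Gal(K/F)) = 3) ∨
    (¬ IsTotRam σ P ∧ Nat.card (P.inertia Gal(K/F)) = 1) := by
  have hc : Nat.card Gal(K/F) = 3 := by rw [IsGalois.card_aut_eq_finrank, h3]
  have h : IsTotRam σ P ↔ σ ∈ P.inertia Gal(K/F) := Iff.rfl
  by_cases hP : IsTotRam σ P
  · left
    refine ⟨hP, ?_⟩
    rw [h] at hP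
    have : P.inertia Gal(K/F) = ⊤ := by
      rw [eq_top_iff]
      intro τ _
      exact (Subgroup.zpowers_le.2 hP) (zpowers_eq_top_of_finrank_eq_three h3 hσ τ)
    rw [this, Subgroup.card_top, hc]
  · right
    refine ⟨hP, ?_⟩
    have hd := Subgroup.card_subgroup_dvd_card (P.inertia Gal(K/F))
    rw [hc, Nat.dvd_prime Nat.prime_three] at hd
    rcases hd with hd | hd
    · exact hd
    · exfalso
      rw [← hc] at hd
      have := Subgroup.eq_top_of_card_eq _ hd
      rw [h, this] at hP
      exact hP trivial

lemma under_ne_bot {P : Ideal (𝓞 K)} (hP0 : P ≠ ⊥) : P.under (𝓞 F) ≠ ⊥ :=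
  Ideal.under_ne_bot _ hP0

lemma map_ne_zero_of_ne_zero {p : Ideal (𝓞 F)} (hp : p ≠ ⊥) :
    p.map (algebraMap (𝓞 F) (𝓞 K)) ≠ ⊥ := Ideal.map_ne_bot_of_ne_bot hp

lemma idealVal_map_under (P : Ideal (𝓞 K)) (hP : P.IsPrime) (hP0 : P ≠ ⊥) :
    idealVal P ((P.under (𝓞 F)).map (algebraMap (𝓞 F) (𝓞 K))) =
      Nat.card (P.inertia Gal(K/F)) := by
  have hp : (P.under (𝓞 F)) ≠ ⊥ := under_ne_bot hP0
  have : (P.under (𝓞 F)).IsMaximal := (inferInstance : (P.under (𝓞 F)).IsPrime).isMaximal hp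
  have : CharZero (𝓞 F) := inferInstance
  have : Finite (𝓞 F ⧸ P.under (𝓞 F)) := Ring.HasFiniteQuotients.finiteQuotient hp
  have : Finite (P.under (𝓞 F)).ResidueField := by
    exact Finite.of_surjective _ (Ideal.bijective_algebraMap_quotient_residueField (P.under (𝓞 F))).2
  rw [Ideal.card_inertia_eq_ramificationIdxIn (R := 𝓞 F) (P.under (𝓞 F)) P,
    Ideal.ramificationIdxIn_eq_ramificationIdx (P.under (𝓞 F)) P Gal(K/F),
    Ideal.IsDedekindDomain.ramificationIdx_eq_normalizedFactors_count (P.under (𝓞 F)) P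
      (map_ne_zero_of_ne_zero hp), idealVal]

lemma isTotRam_iff_idealVal (h3 : Module.finrank F K = 3) {σ : Gal(K/F)} (hσ : σ ≠ 1)
    {P : Ideal (𝓞 K)} (hP : P.IsPrime) (hP0 : P ≠ ⊥) :
    (IsTotRam σ P ∧ idealVal P ((P.under (𝓞 F)).map (algebraMap (𝓞 F) (𝓞 K))) = 3) ∨
    (¬ IsTotRam σ P ∧ idealVal P ((P.under (𝓞 F)).map (algebraMap (𝓞 F) (𝓞 K))) = 1) := by
  rw [idealVal_map_under P hP hP0]
  exact card_inertia_eq h3 hσ P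

lemma IsTotRam.smul_eq (h3 : Module.finrank F K = 3) {σ : Gal(K/F)} (hσ : σ ≠ 1)
    {P : Ideal (𝓞 K)} (h : IsTotRam σ P) (τ : Gal(K/F)) : τ • P = P := by
  have h1 : σ • P = P := by
    apply le_antisymm
    · intro x hx
      rw [Ideal.pointwise_smul_def, Ideal.mem_map_iff_of_surjective _
        (MulAction.surjective σ)] at hx
      obtain ⟨y, hy, rfl⟩ := hx
      have := P.add_mem (h y) hy
      rwa [sub_add_cancel] at this
    · intro x hx
      rw [Ideal.mem_pointwise_smul_iff_inv_smul_mem]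
      have := P.sub_mem hx (h (σ⁻¹ • x))
      rwa [smul_inv_smul, sub_sub_cancel] at this
  rcases eq_one_or_eq_or_eq_sq h3 hσ τ with rfl | rfl | rfl
  · simp
  · exact h1
  · rw [mul_smul, h1, h1]

lemma smul_map_algebraMap (σ : Gal(K/F)) (p : Ideal (𝓞 F)) :
    σ • p.map (algebraMap (𝓞 F) (𝓞 K)) = p.map (algebraMap (𝓞 F) (𝓞 K)) := by
  rw [Ideal.pointwise_smul_def, Ideal.map_map]
  congr 1
  ext x : 1
  exact smul_algebraMap_ringOfIntegers σ x

lemma exists_smul_eq_of_dvd_map {P Q : Ideal (𝓞 K)} (hP : P.IsPrime) (hP0 : P ≠ ⊥)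
    (hQ : Q.IsPrime) (h : Q ∣ (P.under (𝓞 F)).map (algebraMap (𝓞 F) (𝓞 K))) :
    ∃ τ : Gal(K/F), τ • P = Q := by
  have hp : (P.under (𝓞 F)) ≠ ⊥ := under_ne_bot hP0
  have : (P.under (𝓞 F)).IsMaximal := (inferInstance : (P.under (𝓞 F)).IsPrime).isMaximal hp
  have h1 : P.under (𝓞 F) ≤ Q.under (𝓞 F) := Ideal.map_le_iff_le_comap.1 (Ideal.le_of_dvd h)
  have h2 := this.eq_of_le (Ideal.IsPrime.ne_top (inferInstance : (Q.under (𝓞 F)).IsPrime)) h1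
  have : Q.LiesOver (P.under (𝓞 F)) := ⟨h2⟩
  exact Ideal.exists_smul_eq_of_isGaloisGroup (P.under (𝓞 F)) P Q Gal(K/F)

/-- An invariant ideal whose valuation is divisible by `3` at the ramified primes is divisible by
the extension of the prime below any of its prime divisors. -/
lemma map_under_dvd (h3 : Module.finrank F K = 3) {σ : Gal(K/F)} (hσ : σ ≠ 1)
    {I : Ideal (𝓞 K)} (hI : I ≠ 0) (hσI : σ • I = I) {P : Ideal (𝓞 K)} (hP : P.IsPrime)
    (hP0 : P ≠ ⊥) (hPI : P ∣ I) (h : IsTotRam σ P → 3 ∣ idealVal P I) :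
    (P.under (𝓞 F)).map (algebraMap (𝓞 F) (𝓞 K)) ∣ I := by
  have hp : (P.under (𝓞 F)) ≠ ⊥ := under_ne_bot hP0
  have hm : (P.under (𝓞 F)).map (algebraMap (𝓞 F) (𝓞 K)) ≠ 0 := map_ne_zero_of_ne_zero hp
  have hI' : ∀ τ : Gal(K/F), τ • I = I := by
    intro τ
    rcases eq_one_or_eq_or_eq_sq h3 hσ τ with rfl | rfl | rfl
    · simp
    · exact hσI
    · rw [mul_smul, hσI, hσI]
  apply dvd_of_forall_idealVal_le hm hI
  intro Q hQ hQ0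
  by_cases hQm : idealVal Q ((P.under (𝓞 F)).map (algebraMap (𝓞 F) (𝓞 K))) = 0
  · rw [hQm]; exact Nat.zero_le _
  · obtain ⟨τ, rfl⟩ := exists_smul_eq_of_dvd_map hP hP0 hQ
      ((idealVal_ne_zero_iff hQ hQ0 hm).1 hQm)
    have h1 := idealVal_smul τ hP hP0 hI
    have h2 := idealVal_smul τ hP hP0 hm
    have h4 : idealVal P I ≠ 0 := (idealVal_ne_zero_iff hP hP0 hI).2 hPI
    rw [hI'] at h1
    rw [smul_map_algebraMap] at h2
    rw [h1, h2]
    rcases isTotRam_iff_idealVal h3 hσ hP hP0 with ⟨h5, h6⟩ | ⟨h5, h6⟩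
    · have := h h5
      omega
    · omega

lemma idealVal_map_eq {P : Ideal (𝓞 K)} (hP : P.IsPrime) (hP0 : P ≠ ⊥) (p : Ideal (𝓞 F)) (hp : p ≠ ⊥) :
    idealVal P (p.map (algebraMap (𝓞 F) (𝓞 K))) =
      idealVal P ((P.under (𝓞 F)).map (algebraMap (𝓞 F) (𝓞 K))) *
        idealVal (P.under (𝓞 F)) p := by
  have hu : (P.under (𝓞 F)) ≠ ⊥ := under_ne_bot hP0
  have hu' : (P.under (𝓞 F)).IsPrime := inferInstance
  have h := Ideal.IsDedekindDomain.emultiplicity_map_eq_ramificationIdx'_mul (v := P.under (𝓞 F))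
    (w := P) hp (Ideal.prime_of_isPrime hu hu').irreducible
    (Ideal.prime_of_isPrime hP0 hP).irreducible hP0
  rw [emultiplicity_eq_idealVal hP hP0 (map_ne_zero_of_ne_zero hp),
    emultiplicity_eq_idealVal hu' hu hp, Ideal.IsDedekindDomain.ramificationIdx'_eq_normalizedFactors_count
      (map_ne_zero_of_ne_zero hu) hP hP0] at h
  unfold idealVal at *
  exact_mod_cast h

/-- An invariant ideal whose valuation is divisible by `3` at the ramified primes comes from the
base. -/
lemma exists_eq_span_algebraMap [IsPrincipalIdealRing (𝓞 F)] (h3 : Module.finrank F K = 3)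
    {σ : Gal(K/F)} (hσ : σ ≠ 1) (I : Ideal (𝓞 K)) (hI : I ≠ 0) (hσI : σ • I = I)
    (h : ∀ P : Ideal (𝓞 K), P.IsPrime → P ≠ ⊥ → IsTotRam σ P → 3 ∣ idealVal P I) :
    ∃ a : 𝓞 F, a ≠ 0 ∧ I = Ideal.span {algebraMap (𝓞 F) (𝓞 K) a} := by
  induction I using (wellFounded_dvdNotUnit (α := Ideal (𝓞 K))).induction with
  | _ I ih =>
  by_cases hu : IsUnit I
  · refine ⟨1, one_ne_zero, ?_⟩
    rw [Ideal.isUnit_iff.1 hu, map_one, Ideal.span_singleton_one]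
  · obtain ⟨P, hPp, hPI⟩ := WfDvdMonoid.exists_irreducible_factor hu hI
    have hP : P.IsPrime := Ideal.isPrime_of_prime hPp.prime
    have hP0 : P ≠ ⊥ := hPp.ne_zero
    obtain ⟨J, hJ⟩ := map_under_dvd h3 hσ hI hσI hP hP0 hPI (h P hP hP0)
    obtain ⟨b, hb⟩ := (IsPrincipalIdealRing.principal (P.under (𝓞 F))).principal
    have hu0 : P.under (𝓞 F) ≠ ⊥ := under_ne_bot hP0
    set m := (P.under (𝓞 F)).map (algebraMap (𝓞 F) (𝓞 K)) with hm
    have hm0 : m ≠ 0 := map_ne_zero_of_ne_zero hu0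
    have hJ0 : J ≠ 0 := by
      rintro rfl
      exact hI (by rw [hJ, mul_zero])
    have hmu : ¬ IsUnit m := by
      intro hmu
      rw [Ideal.isUnit_iff] at hmu
      have : m ≤ P := Ideal.map_comap_le
      rw [hmu, top_le_iff] at this
      exact hP.ne_top this
    obtain ⟨a, ha, haJ⟩ := ih J ⟨hJ0, m, hmu, by rw [hJ, mul_comm]⟩ hJ0 (by
      apply mul_left_cancel₀ hm0
      rw [← hJ, ← hσI, hJ, smul_mul', smul_map_algebraMap]) (by
      intro Q hQ hQ0 hQr
      have h1 := h Q hQ hQ0 hQr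
      rw [hJ, idealVal_mul Q hm0 hJ0, idealVal_map_eq hQ hQ0 _ hu0] at h1
      rcases isTotRam_iff_idealVal h3 hσ hQ hQ0 with ⟨h5, h6⟩ | ⟨h5, h6⟩
      · rw [h6] at h1
        omega
      · exact absurd hQr h5)
    have hb' : P.under (𝓞 F) = Ideal.span {b} := hb
    have hb0 : b ≠ 0 := by
      rintro rfl
      exact hu0 (by rw [hb']; simp)
    refine ⟨b * a, mul_ne_zero hb0 ha, ?_⟩
    rw [hJ, haJ, hm, hb', Ideal.map_span, Set.image_singleton,
      Ideal.span_singleton_mul_span_singleton, map_mul]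

lemma three_dvd_idealVal_span_algebraMap (h3 : Module.finrank F K = 3)
    {σ : Gal(K/F)} (hσ : σ ≠ 1) {a : 𝓞 F} (ha : a ≠ 0) {P : Ideal (𝓞 K)} (hP : P.IsPrime)
    (hP0 : P ≠ ⊥) (hr : IsTotRam σ P) :
    3 ∣ idealVal P (Ideal.span {algebraMap (𝓞 F) (𝓞 K) a}) := by
  have h1 : Ideal.span {algebraMap (𝓞 F) (𝓞 K) a} =
      (Ideal.span {a}).map (algebraMap (𝓞 F) (𝓞 K)) := by
    rw [Ideal.map_span, Set.image_singleton]
  rw [h1, idealVal_map_eq hP hP0 _ (by simpa using ha)]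
  rcases isTotRam_iff_idealVal h3 hσ hP hP0 with ⟨h5, h6⟩ | ⟨h5, h6⟩
  · rw [h6]; exact dvd_mul_right _ _
  · exact absurd hr h5

end InvariantIdeals

section StrongAmbiguousClasses

open scoped Pointwise

variable {F K : Type} [Field F] [NumberField F] [Field K] [NumberField K] [Algebra F K]
  [IsGalois F K]

/-- The set of ramified primes. -/
def totRamPrimes (σ : Gal(K/F)) : Set (Ideal (𝓞 K)) := {P | P.IsPrime ∧ P ≠ ⊥ ∧ IsTotRam σ P}

lemma idealVal_cast_mul (P : Ideal (𝓞 K)) (I J : (Ideal (𝓞 K))⁰) :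
    (idealVal P ((I * J : (Ideal (𝓞 K))⁰) : Ideal (𝓞 K)) : ZMod 3) =
      idealVal P (I : Ideal (𝓞 K)) + idealVal P (J : Ideal (𝓞 K)) := by
  rw [Submonoid.coe_mul, idealVal_mul P (nonZeroDivisors.ne_zero I.2) (nonZeroDivisors.ne_zero J.2)]
  push_cast; rfl

lemma three_dvd_of_cast_eq_zero {n : ℕ} (h : (n : ZMod 3) = 0) : 3 ∣ n :=
  (ZMod.natCast_eq_zero_iff _ _).1 h

variable (h3 : Module.finrank F K = 3) {σ : Gal(K/F)} (hσ : σ ≠ 1)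

include h3 hσ in
lemma mk0_eq_one_of_three_dvd [IsPrincipalIdealRing (𝓞 F)] (I : (Ideal (𝓞 K))⁰)
    (hσI : σ • (I : Ideal (𝓞 K)) = I) (h : ∀ P ∈ totRamPrimes σ, 3 ∣ idealVal P (I : Ideal (𝓞 K))) :
    ClassGroup.mk0 I = 1 := by
  obtain ⟨a, ha, haI⟩ := exists_eq_span_algebraMap h3 hσ (I : Ideal (𝓞 K))
    (nonZeroDivisors.ne_zero I.2) hσI (fun P h1 h2 h3 => h P ⟨h1, h2, h3⟩)
  exact (ClassGroup.mk0_eq_one_iff I.2).2 ⟨_, haI⟩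

/-- The relation between valuation vectors modulo `3` and classes of invariant ideals. -/
def invariantIdealRel [IsPrincipalIdealRing (𝓞 F)] (h3 : Module.finrank F K = 3) {σ : Gal(K/F)}
    (hσ : σ ≠ 1) :
    Subgroup (Multiplicative (totRamPrimes σ → ZMod 3) × ClassGroup (𝓞 K)) where
  carrier := {p | ∃ I : (Ideal (𝓞 K))⁰, ClassGroup.mk0 I = p.2 ∧ σ • (I : Ideal (𝓞 K)) = I ∧
    ∀ P : totRamPrimes σ, (idealVal P.1 (I : Ideal (𝓞 K)) : ZMod 3) = p.1.toAdd P}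
  one_mem' := by
    refine ⟨1, by simp, by rw [OneMemClass.coe_one, smul_one], fun P => ?_⟩
    rw [OneMemClass.coe_one, idealVal_one]; simp
  mul_mem' := by
    rintro ⟨r, c⟩ ⟨r', c'⟩ ⟨I, hI, hσI, hr⟩ ⟨J, hJ, hσJ, hr'⟩
    refine ⟨I * J, ?_, ?_, fun P => ?_⟩
    · rw [map_mul, hI, hJ]; rfl
    · rw [Submonoid.coe_mul, smul_mul', hσI, hσJ]
    · rw [idealVal_cast_mul, hr, hr']; rfl
  inv_mem' := by
    rintro ⟨r, c⟩ ⟨I, hI, hσI, hr⟩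
    have h4 : ∀ P : totRamPrimes σ, (idealVal P.1 ((I * I : (Ideal (𝓞 K))⁰) : Ideal (𝓞 K)) : ZMod 3) =
        - r.toAdd P := fun P => by
      rw [idealVal_cast_mul, hr]
      have : (3 : ZMod 3) = 0 := rfl
      linear_combination r.toAdd P * this
    have hσ2 : σ • ((I * I : (Ideal (𝓞 K))⁰) : Ideal (𝓞 K)) = (I * I : (Ideal (𝓞 K))⁰) := by
      rw [Submonoid.coe_mul, smul_mul', hσI]
    refine ⟨I * I, ?_, hσ2, fun P => by rw [h4]; rfl⟩
    have : ClassGroup.mk0 (I * (I * I)) = 1 := by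
      apply mk0_eq_one_of_three_dvd h3 hσ
      · rw [Submonoid.coe_mul, smul_mul', hσ2, hσI]
      · intro P hP
        apply three_dvd_of_cast_eq_zero
        rw [idealVal_cast_mul, h4 ⟨P, hP⟩, hr ⟨P, hP⟩, add_neg_cancel]
    rw [map_mul, hI] at this
    exact (inv_eq_of_mul_eq_one_right this).symm

/-- The relation between valuation vectors modulo `3` and units `σ e / e`. -/
def invariantPrincipalRel (h3 : Module.finrank F K = 3) {σ : Gal(K/F)} :
    Subgroup (Multiplicative (totRamPrimes σ → ZMod 3) × (𝓞 K)ˣ) where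
  carrier := {p | ∃ e : 𝓞 K, e ≠ 0 ∧ σ • e = p.2 * e ∧
    ∀ P : totRamPrimes σ, (idealVal P.1 (Ideal.span {e}) : ZMod 3) = p.1.toAdd P}
  one_mem' := by
    refine ⟨1, one_ne_zero, by simp, fun P => ?_⟩
    rw [Ideal.span_singleton_one, ← Ideal.one_eq_top, idealVal_one]; simp
  mul_mem' := by
    rintro ⟨r, u⟩ ⟨r', u'⟩ ⟨e, he, hσe, hr⟩ ⟨e', he', hσe', hr'⟩
    refine ⟨e * e', mul_ne_zero he he', ?_, fun P => ?_⟩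
    · rw [smul_mul', hσe, hσe']
      simp only [Prod.snd_mul, Units.val_mul]; ring
    · rw [← Ideal.span_singleton_mul_span_singleton, idealVal_mul _ (span_singleton_ne_zero he)
        (span_singleton_ne_zero he')]
      push_cast
      rw [hr, hr']; rfl
  inv_mem' := by
    rintro ⟨r, u⟩ ⟨e, he, hσe, hr⟩
    have hσ : ∀ {z : 𝓞 K}, z ≠ 0 → σ • z ≠ 0 := fun h => by rwa [Ne, smul_eq_zero_iff_eq]
    refine ⟨σ • e * σ • σ • e, mul_ne_zero (hσ he) (hσ (hσ he)), ?_, fun P => ?_⟩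
    · rw [smul_mul', smul_smul_smul_eq h3]
      change _ = ((u⁻¹ : (𝓞 K)ˣ) : 𝓞 K) * _
      rw [hσe]
      linear_combination (-(e * σ • ((u : 𝓞 K) * e))) * u.inv_mul
    · have h1 : Ideal.span {σ • e} = Ideal.span {e} := by
        rw [Ideal.span_singleton_eq_span_singleton]
        exact ⟨u⁻¹, by rw [hσe, mul_comm (u : 𝓞 K), mul_assoc, Units.mul_inv, mul_one]⟩
      rw [← Ideal.span_singleton_mul_span_singleton, ← smul_span_singleton σ (σ • e), h1,
        smul_span_singleton, h1, idealVal_mul _ (span_singleton_ne_zero he)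
        (span_singleton_ne_zero he)]
      push_cast
      rw [hr]
      have : (3 : ZMod 3) = 0 := rfl
      change r.toAdd P + r.toAdd P = - r.toAdd P
      linear_combination r.toAdd P * this

include h3 hσ in
lemma map_fst_invariantIdealRel [IsPrincipalIdealRing (𝓞 F)] [Finite (totRamPrimes σ)] :
    (invariantIdealRel h3 hσ).map (MonoidHom.fst _ _) = ⊤ := by
  rw [eq_top_iff]
  intro r _
  have := Fintype.ofFinite (totRamPrimes σ)
  have hne : ∀ (Q : totRamPrimes σ) (n : ℕ), Q.1 ^ n ≠ 0 := fun Q n => pow_ne_zero _ Q.2.2.1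
  have h0 : ∏ Q : totRamPrimes σ, Q.1 ^ (r.toAdd Q).val ∈ (Ideal (𝓞 K))⁰ :=
    mem_nonZeroDivisors_of_ne_zero (Finset.prod_ne_zero_iff.2 fun Q _ => hne Q _)
  have hval : ∀ (P : Ideal (𝓞 K)) (s : Finset (totRamPrimes σ)),
      idealVal P (∏ Q ∈ s, Q.1 ^ (r.toAdd Q).val) =
        ∑ Q ∈ s, (r.toAdd Q).val * idealVal P Q.1 := by
    intro P s
    classical
    induction s using Finset.induction_on with
    | empty => simpa using idealVal_one P
    | insert Q s hQ ih =>
      rw [Finset.prod_insert hQ, Finset.sum_insert hQ, idealVal_mul _ (hne Q _)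
        (Finset.prod_ne_zero_iff.2 fun Q _ => hne Q _), ih, idealVal_pow]
  refine ⟨(r, ClassGroup.mk0 ⟨_, h0⟩), ⟨⟨_, h0⟩, rfl, ?_, fun P => ?_⟩, rfl⟩
  · change σ • (∏ Q : totRamPrimes σ, Q.1 ^ (r.toAdd Q).val) = _
    rw [Finset.smul_prod']
    refine Finset.prod_congr rfl fun Q _ => ?_
    rw [smul_pow', Q.2.2.2.smul_eq h3 hσ]
  · change ((idealVal P.1 (∏ Q : totRamPrimes σ, Q.1 ^ (r.toAdd Q).val) : ℕ) : ZMod 3) = _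
    rw [hval, Finset.sum_eq_single P]
    · rw [idealVal_self P.2.1 P.2.2.1, mul_one, ZMod.natCast_val, ZMod.cast_id]
    · intro Q _ hQ
      rw [idealVal_eq_zero_of_ne Q.2.1 Q.2.2.1 (fun h => hQ (Subtype.ext h.symm)), mul_zero]
    · simp

lemma map_snd_invariantIdealRel [IsPrincipalIdealRing (𝓞 F)] :
    (invariantIdealRel h3 hσ).map (MonoidHom.snd _ _) = strongAmbClasses h3 σ := by
  ext c
  rw [mem_strongAmbClasses_iff h3 hσ]
  constructor
  · rintro ⟨⟨r, c⟩, ⟨I, hI, hσI, -⟩, rfl⟩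
    exact ⟨I, hI, hσI⟩
  · rintro ⟨I, hI, hσI⟩
    exact ⟨(Multiplicative.ofAdd fun P => (idealVal P.1 (I : Ideal (𝓞 K)) : ZMod 3), c),
      ⟨I, hI, hσI, fun P => rfl⟩, rfl⟩

lemma goursatSnd_invariantIdealRel [IsPrincipalIdealRing (𝓞 F)] :
    (invariantIdealRel h3 hσ).goursatSnd = ⊥ := by
  rw [eq_bot_iff]
  intro c hc
  rw [Subgroup.mem_goursatSnd] at hc
  obtain ⟨I, hI, hσI, hr⟩ := hc
  rw [Subgroup.mem_bot, ← show _ = c from hI]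
  exact mk0_eq_one_of_three_dvd h3 hσ I hσI fun P hP => three_dvd_of_cast_eq_zero (hr ⟨P, hP⟩)

include hσ in
lemma map_snd_invariantPrincipalRel :
    (invariantPrincipalRel h3 (σ := σ)).map (MonoidHom.snd _ _) = (unitsNorm σ).ker := by
  ext u
  rw [MonoidHom.mem_ker]
  constructor
  · rintro ⟨⟨r, u⟩, ⟨e, he, hσe, -⟩, rfl⟩
    apply Units.ext
    have h := congrArg (cubicNorm σ) hσe
    rw [cubicNorm_smul h3, cubicNorm_mul] at h
    change _ = cubicNorm σ (u : 𝓞 K) * _ at h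
    change ((unitsNorm σ u : (𝓞 K)ˣ) : 𝓞 K) = _
    rw [coe_unitsNorm]
    exact mul_right_cancel₀ (cubicNorm_ne_zero σ he) (by rw [← h, Units.val_one, one_mul])
  · intro hu
    have hu' : cubicNorm σ (u : 𝓞 K) = cubicNorm σ 1 := by
      rw [← coe_unitsNorm, hu, cubicNorm_one, Units.val_one]
    obtain ⟨e, he, hee⟩ := exists_mul_smul_eq_mul_of_cubicNorm_eq h3 hσ u.ne_zero one_ne_zero hu'
    rw [one_mul] at hee
    exact ⟨(Multiplicative.ofAdd fun P => (idealVal P.1 (Ideal.span {e}) : ZMod 3), u),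
      ⟨e, he, hee, fun P => rfl⟩, rfl⟩

include h3 hσ in
lemma exists_eq_algebraMap_mul_unit [IsPrincipalIdealRing (𝓞 F)] {e : 𝓞 K} (he : e ≠ 0)
    (hσe : σ • Ideal.span {e} = Ideal.span {e})
    (h : ∀ P ∈ totRamPrimes σ, 3 ∣ idealVal P (Ideal.span {e})) :
    ∃ (a : 𝓞 F) (w : (𝓞 K)ˣ), a ≠ 0 ∧ e = algebraMap (𝓞 F) (𝓞 K) a * w := by
  obtain ⟨a, ha, haI⟩ := exists_eq_span_algebraMap h3 hσ _ (span_singleton_ne_zero he) hσe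
    (fun P h1 h2 h3 => h P ⟨h1, h2, h3⟩)
  rw [Ideal.span_singleton_eq_span_singleton] at haI
  obtain ⟨w, hw⟩ := haI.symm
  exact ⟨a, w, ha, hw.symm⟩

lemma span_smul_eq {e : 𝓞 K} {u : (𝓞 K)ˣ} (h : σ • e = u * e) :
    σ • Ideal.span {e} = Ideal.span {e} := by
  rw [smul_span_singleton, Ideal.span_singleton_eq_span_singleton]
  exact ⟨u⁻¹, by rw [h, mul_comm (u : 𝓞 K), mul_assoc, Units.mul_inv, mul_one]⟩

lemma idealVal_span_mul_unit (P : Ideal (𝓞 K)) (a : 𝓞 K) (w : (𝓞 K)ˣ) :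
    idealVal P (Ideal.span {a * w}) = idealVal P (Ideal.span {a}) := by
  congr 1
  rw [Ideal.span_singleton_eq_span_singleton]
  exact (Associated.refl a).mul_right _ |>.trans (associated_mul_unit_left a w w.isUnit)

include hσ in
lemma goursatSnd_invariantPrincipalRel [IsPrincipalIdealRing (𝓞 F)] :
    (invariantPrincipalRel h3 (σ := σ)).goursatSnd = (unitsDiff σ).range := by
  ext u
  rw [Subgroup.mem_goursatSnd]
  constructor
  · rintro ⟨e, he, hσe, hr⟩
    obtain ⟨a, w, ha, rfl⟩ := exists_eq_algebraMap_mul_unit h3 hσ he (span_smul_eq hσe)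
      fun P hP => three_dvd_of_cast_eq_zero (hr ⟨P, hP⟩)
    refine ⟨w, ?_⟩
    rw [unitsDiff_apply, div_eq_iff_eq_mul]
    apply Units.ext
    rw [smul_mul', smul_algebraMap_ringOfIntegers] at hσe
    apply mul_left_cancel₀ (left_ne_zero_of_mul he)
    rw [coe_unitsAct, hσe, Units.val_mul]
    ring
  · rintro ⟨w, rfl⟩
    refine ⟨w, w.ne_zero, ?_, fun P => ?_⟩
    · rw [unitsDiff_apply, ← Units.val_mul, div_mul_cancel, coe_unitsAct]
    · rw [← one_mul (w : 𝓞 K), idealVal_span_mul_unit, Ideal.span_singleton_one,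
        ← Ideal.one_eq_top, idealVal_one]
      simp

include hσ in
lemma goursatFst_invariantPrincipalRel :
    (invariantPrincipalRel h3 (σ := σ)).goursatFst = ⊥ := by
  rw [eq_bot_iff]
  intro r hr
  rw [Subgroup.mem_goursatFst] at hr
  obtain ⟨e, he, hσe, hr⟩ := hr
  rw [Units.val_one, one_mul] at hσe
  obtain ⟨a, rfl⟩ := exists_algebraMap_eq_of_smul_eq h3 hσ hσe
  have ha : a ≠ 0 := by rintro rfl; exact he (map_zero _)
  rw [Subgroup.mem_bot]
  apply Multiplicative.toAdd.injective
  funext P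
  rw [← show _ = r.toAdd P from hr P]
  exact (ZMod.natCast_eq_zero_iff _ _).2
    (three_dvd_idealVal_span_algebraMap h3 hσ ha P.2.1 P.2.2.1 P.2.2.2)

lemma map_fst_invariantPrincipalRel [IsPrincipalIdealRing (𝓞 F)] :
    (invariantPrincipalRel h3 (σ := σ)).map (MonoidHom.fst _ _) =
      (invariantIdealRel h3 hσ).goursatFst := by
  ext r
  rw [Subgroup.mem_goursatFst]
  constructor
  · rintro ⟨⟨r, u⟩, ⟨e, he, hσe, hr⟩, rfl⟩
    have he0 : Ideal.span {e} ∈ (Ideal (𝓞 K))⁰ :=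
      mem_nonZeroDivisors_of_ne_zero (span_singleton_ne_zero he)
    exact ⟨⟨_, he0⟩, (ClassGroup.mk0_eq_one_iff he0).2 ⟨e, rfl⟩, span_smul_eq hσe, hr⟩
  · rintro ⟨I, hI, hσI, hr⟩
    obtain ⟨e, he⟩ := (ClassGroup.mk0_eq_one_iff I.2).1 hI
    have he' : (I : Ideal (𝓞 K)) = Ideal.span {e} := he
    have he0 : e ≠ 0 := by
      rintro rfl
      exact nonZeroDivisors.ne_zero I.2 (by simpa using he')
    rw [he', smul_span_singleton, Ideal.span_singleton_eq_span_singleton] at hσI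
    obtain ⟨u, hu⟩ := hσI.symm
    refine ⟨(r, u), ⟨e, he0, by rw [← hu, mul_comm], fun P => ?_⟩, rfl⟩
    rw [← he']; exact hr P

include hσ in
lemma three_pow_card_eq [IsPrincipalIdealRing (𝓞 F)] [Finite (totRamPrimes σ)] :
    3 ^ Nat.card (totRamPrimes σ) = Nat.card (strongAmbClasses h3 σ) *
      (unitsDiff σ).range.relIndex (unitsNorm σ).ker := by
  have h1 := Subgroup.relIndex_goursatFst_eq (invariantIdealRel h3 hσ)
  have h2 := Subgroup.relIndex_goursatFst_eq (invariantPrincipalRel h3 (σ := σ))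
  rw [map_fst_invariantIdealRel h3 hσ, map_snd_invariantIdealRel, goursatSnd_invariantIdealRel,
    Subgroup.relIndex_top_right, Subgroup.relIndex_bot_left] at h1
  rw [map_fst_invariantPrincipalRel h3 hσ, map_snd_invariantPrincipalRel h3 hσ,
    goursatSnd_invariantPrincipalRel h3 hσ, goursatFst_invariantPrincipalRel h3 hσ,
    Subgroup.relIndex_bot_left] at h2
  rw [← h1, ← h2, mul_comm, Subgroup.card_mul_index]
  have := Fintype.ofFinite (totRamPrimes σ)
  rw [Nat.card_congr Multiplicative.toAdd, Nat.card_fun, Nat.card_zmod]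

end StrongAmbiguousClasses

lemma card_quotient_range_nsmul {M : Type*} [AddCommGroup M] [Module.Free ℤ M] [Module.Finite ℤ M]
    {n : ℕ} (hn : n ≠ 0) :
    (nsmulAddMonoidHom (α := M) n).range.index = n ^ Module.finrank ℤ M := by
  let f : M →ₗ[ℤ] M := (n : ℤ) • LinearMap.id
  have hf : Function.Injective f := by
    intro x y h
    exact smul_right_injective M (Int.natCast_ne_zero.2 hn) (by simpa [f] using h)
  have h := Submodule.natAbs_det_equiv (LinearMap.range f) (LinearEquiv.ofInjective f hf)
  have h2 : (LinearMap.range f).subtype ∘ₗ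
      AddMonoidHom.toIntLinearMap ((LinearEquiv.ofInjective f hf : M →+ LinearMap.range f)) = f := by
    ext x; rfl
  have h3 : (nsmulAddMonoidHom (α := M) n).range = (LinearMap.range f).toAddSubgroup := by
    ext x; simp [f]
  rw [h2, LinearMap.det_smul, LinearMap.det_id, mul_one, Int.natAbs_pow, Int.natAbs_natCast] at h
  rw [h3, h]; rfl

lemma index_range_nsmul_of_basis {M : Type*} [AddCommGroup M] {r n : ℕ}
    (b : Module.Basis (Fin r) ℤ M) (hn : n ≠ 0) :
    (nsmulAddMonoidHom (α := M) n).range.index = n ^ r := by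
  have : Module.Free ℤ M := .of_basis b
  have : Module.Finite ℤ M := .of_basis b
  rw [card_quotient_range_nsmul hn, Module.finrank_eq_card_basis b, Fintype.card_fin]

lemma index_range_powMonoidHom_of_basis {G : Type*} [CommGroup G] {r n : ℕ}
    (b : Module.Basis (Fin r) ℤ (Additive G)) (hn : n ≠ 0) :
    (powMonoidHom n : G →* G).range.index = n ^ r := by
  rw [← index_range_nsmul_of_basis b hn]
  rfl

lemma MonoidHom.index_range_comp_of_injective {Q : Type*} [CommGroup Q] (f g : Q →* Q)
    (hf : Function.Injective f) : (f.comp g).range.index = g.range.index * f.range.index := by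
  have h : (f.comp g).range = g.range.map f := MonoidHom.range_comp f g
  have h2 : f.range = (⊤ : Subgroup Q).map f := (MonoidHom.range_eq_map f)
  rw [h, ← Subgroup.relIndex_mul_index (K := f.range) (by rw [h2]; exact Subgroup.map_mono le_top)]
  conv_lhs => rw [h2, Subgroup.relIndex_map_map_of_injective _ _ hf, Subgroup.relIndex_top_right, ← h2]

lemma index_range_of_finite_quotient {E : Type*} [CommGroup E] (T : Subgroup E) [Finite T]
    (s D : E →* E) (hD : ∀ u, D u = s u / u) (hs : ∀ u, s (s (s u)) = u)
    (hN : ∀ u, u * s u * s (s u) ∈ T) (hT : ∀ u, u ^ 3 ∈ T → u ∈ T) (hsT : ∀ u ∈ T, s u ∈ T)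
    {r : ℕ} (b : Module.Basis (Fin r) ℤ (Additive (E ⧸ T))) (hr : r = 2) :
    D.range.index = 3 * Nat.card D.ker := by
  have h9 : (powMonoidHom 3 : E ⧸ T →* E ⧸ T).range.index = 9 := by
    rw [index_range_powMonoidHom_of_basis b (by decide), hr]
    rfl
  have hDT : T ≤ T.comap D := fun u hu => by
    rw [Subgroup.mem_comap, hD]; exact T.div_mem (hsT u hu) hu
  have hDD (u : E) : (D (D u)) * (s u) ^ 3 ∈ T := by
    have : D (D u) * (s u) ^ 3 = u * s u * s (s u) := by
      rw [hD (D u), hD u, map_div]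
      rw [div_div_eq_mul_div, div_mul_eq_mul_div, div_mul_eq_mul_div, div_eq_iff_eq_mul,
        div_mul_eq_mul_div, div_eq_iff_eq_mul]
      simp only [pow_succ, pow_zero, one_mul]
      ac_nf
    rw [this]; exact hN u
  have hDinj (u : E) (h : D u ∈ T) : u ∈ T := by
    have h1 : (s u) ^ 3 ∈ T := (Subgroup.mul_mem_cancel_left T (hDT h)).1 (hDD u)
    have h2 := hsT _ (hsT _ (hT _ h1))
    rwa [hs] at h2
  let Db : E ⧸ T →* E ⧸ T := QuotientGroup.map T T D hDT
  have hinj : Function.Injective Db := by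
    rw [injective_iff_map_eq_one]
    intro x hx
    induction x using QuotientGroup.induction_on with
    | H z =>
    rw [QuotientGroup.map_mk, QuotientGroup.eq_one_iff] at hx
    rw [QuotientGroup.eq_one_iff]
    exact hDinj z hx
  have hDb : (Db.comp Db).range = (powMonoidHom 3 : E ⧸ T →* E ⧸ T).range := by
    have key (u : E) : Db (Db (u : E ⧸ T)) = (((s u : E) : E ⧸ T) ^ 3)⁻¹ := by
      rw [eq_inv_iff_mul_eq_one, QuotientGroup.map_mk, QuotientGroup.map_mk, ← QuotientGroup.mk_pow,
        ← QuotientGroup.mk_mul, QuotientGroup.eq_one_iff]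
      exact hDD u
    ext x
    constructor
    · rintro ⟨y, rfl⟩
      induction y using QuotientGroup.induction_on with
      | H z =>
      exact ⟨((s z : E) : E ⧸ T)⁻¹, by rw [MonoidHom.comp_apply, key, powMonoidHom_apply, inv_pow]⟩
    · rintro ⟨y, rfl⟩
      induction y using QuotientGroup.induction_on with
      | H z =>
      exact ⟨((s (s z⁻¹) : E) : E ⧸ T), by
        rw [MonoidHom.comp_apply, key, hs, powMonoidHom_apply, QuotientGroup.mk_inv, inv_pow,
          inv_inv]⟩
  have h3 : Db.range.index = 3 := by
    have := MonoidHom.index_range_comp_of_injective Db Db hinj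
    rw [hDb, h9] at this
    nlinarith
  have h4 : (D.range ⊔ T).index = 3 := by
    have hm : Db.range = D.range.map (QuotientGroup.mk' T) := by
      ext x
      constructor
      · rintro ⟨y, rfl⟩
        induction y using QuotientGroup.induction_on with
        | H z => exact ⟨D z, ⟨z, rfl⟩, rfl⟩
      · rintro ⟨_, ⟨z, rfl⟩, rfl⟩
        exact ⟨(z : E ⧸ T), rfl⟩
    have := Subgroup.index_comap_of_surjective Db.range (QuotientGroup.mk'_surjective T)
    rw [h3, hm, Subgroup.comap_map_eq, QuotientGroup.ker_mk'] at this
    exact this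
  rw [← Subgroup.relIndex_mul_index (le_sup_left : D.range ≤ D.range ⊔ T), h4, mul_comm]
  congr 1
  rw [sup_comm, Subgroup.relIndex_sup_right]
  have hk : D.ker ≤ T := fun u hu => hDinj u (by rw [MonoidHom.mem_ker] at hu; rw [hu]; exact T.one_mem)
  have h5 : D.range.subgroupOf T = ((D.comp T.subtype).codRestrict T (fun u => hDT u.2)).range := by
    ext x
    rw [Subgroup.mem_subgroupOf]
    constructor
    · rintro ⟨y, hy⟩
      exact ⟨⟨y, hDinj y (hy ▸ x.2)⟩, Subtype.ext hy⟩
    · rintro ⟨y, rfl⟩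
      exact ⟨y, rfl⟩
  set f := ((D.comp T.subtype).codRestrict T (fun u => hDT u.2)) with hf
  have h6 : f.ker = D.ker.subgroupOf T := by
    ext x
    rw [Subgroup.mem_subgroupOf, MonoidHom.mem_ker, MonoidHom.mem_ker, Subtype.ext_iff]; rfl
  have h7 : Nat.card f.ker = Nat.card D.ker := by
    rw [h6]; exact Nat.card_congr (Subgroup.subgroupOfEquivOfLe hk).toEquiv
  rw [Subgroup.relIndex, h5, ← h7]
  have h8 := f.range.index_mul_card
  have h9 := f.ker.index_mul_card
  rw [Subgroup.index_ker] at h9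
  have hp : 0 < Nat.card f.range := Nat.card_pos
  apply Nat.eq_of_mul_eq_mul_right hp
  rw [h8, ← h9, mul_comm]

lemma card_units_three {F : Type*} [Field F] [NumberField F] [IsCyclotomicExtension {3} ℚ F] :
    Nat.card (𝓞 F)ˣ = 6 := by
  have hr : Units.rank F = 0 := by
    dsimp only [Units.rank]
    rw [InfinitePlace.card_eq_nrRealPlaces_add_nrComplexPlaces,
      IsCyclotomicExtension.Rat.nrRealPlaces_eq_zero (n := 3) F (by decide),
      zero_add, IsCyclotomicExtension.Rat.nrComplexPlaces_eq_totient_div_two (n := 3)]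
    rfl
  have ht : Units.torsion F = ⊤ := by
    rw [eq_top_iff]
    rintro u -
    obtain ⟨⟨x, e⟩, hxu, -⟩ := Units.exist_unique_eq_mul_prod _ u
    have : IsEmpty (Fin (Units.rank F)) := by rw [hr]; infer_instance
    rw [Finset.univ_eq_empty, Finset.prod_empty, mul_one] at hxu
    rw [hxu]; exact x.2
  have := IsCyclotomicExtension.Rat.torsionOrder_eq (n := 3) (K := F)
  rw [Units.torsionOrder, ht, Nat.card_congr Subgroup.topEquiv.toEquiv] at this
  rw [this, if_neg (by decide)]

lemma units_rank_of_finrank_eq_six {K : Type*} [Field K] [NumberField K]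
    (h6 : Module.finrank ℚ K = 6) {ζ : K} (hζ : IsPrimitiveRoot ζ 3) : Units.rank K = 2 := by
  have h1 := NumberField.InfinitePlace.IsPrimitiveRoot.nrRealPlaces_eq_zero_of_two_lt (by decide) hζ
  have h2 := InfinitePlace.card_add_two_mul_card_eq_rank K
  rw [h1, h6] at h2
  rw [Units.rank, InfinitePlace.card_eq_nrRealPlaces_add_nrComplexPlaces, h1]
  omega

section UnitIndex

open scoped Pointwise

variable {F K : Type} [Field F] [NumberField F] [Field K] [NumberField K] [Algebra F K]
  [IsGalois F K]

lemma card_ker_unitsDiff [IsCyclotomicExtension {3} ℚ F] (h3 : Module.finrank F K = 3)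
    {σ : Gal(K/F)} (hσ : σ ≠ 1) : Nat.card (unitsDiff σ).ker = 6 := by
  let f : (𝓞 F)ˣ →* (𝓞 K)ˣ := Units.map (algebraMap (𝓞 F) (𝓞 K) : 𝓞 F →* 𝓞 K)
  have hf : Function.Injective f :=
    Units.map_injective (FaithfulSMul.algebraMap_injective (𝓞 F) (𝓞 K))
  have hr : f.range = (unitsDiff σ).ker := by
    ext u
    rw [mem_ker_unitsDiff]
    constructor
    · rintro ⟨x, rfl⟩
      exact smul_algebraMap_ringOfIntegers σ _
    · intro hu
      obtain ⟨a, ha⟩ := exists_algebraMap_eq_of_smul_eq h3 hσ hu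
      have hu' : σ • ((u⁻¹ : (𝓞 K)ˣ) : 𝓞 K) = ((u⁻¹ : (𝓞 K)ˣ) : 𝓞 K) := by
        have : u⁻¹ ∈ (unitsDiff σ).ker := inv_mem ((mem_ker_unitsDiff σ u).2 hu)
        exact (mem_ker_unitsDiff σ _).1 this
      obtain ⟨b, hb⟩ := exists_algebraMap_eq_of_smul_eq h3 hσ hu'
      have hab : a * b = 1 := by
        apply FaithfulSMul.algebraMap_injective (𝓞 F) (𝓞 K)
        rw [map_mul, ha, hb, Units.mul_inv, map_one]
      exact ⟨⟨a, b, hab, by rw [mul_comm, hab]⟩, Units.ext ha⟩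
  rw [← hr, ← card_units_three (F := F)]
  exact (Nat.card_congr (MonoidHom.ofInjective hf).toEquiv).symm

lemma card_range_unitsNorm_mul_relIndex [IsCyclotomicExtension {3} ℚ F]
    (h3 : Module.finrank F K = 3) {σ : Gal(K/F)} (hσ : σ ≠ 1) :
    Nat.card (unitsNorm σ).range * (unitsDiff σ).range.relIndex (unitsNorm σ).ker = 18 := by
  have hker := card_ker_unitsDiff h3 hσ
  have h6 : Module.finrank ℚ K = 6 := by
    rw [← Module.finrank_mul_finrank ℚ F K, h3, IsCyclotomicExtension.finrank (n := 3) F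
      (Polynomial.cyclotomic.irreducible_rat (by decide))]
    rfl
  have hζ : IsPrimitiveRoot (algebraMap F K (IsCyclotomicExtension.zeta 3 ℚ F)) 3 :=
    (IsCyclotomicExtension.zeta_spec 3 ℚ F).map_of_injective (algebraMap F K).injective
  have hle : (unitsDiff σ).ker ≤ Units.torsion K := by
    intro u hu
    have : Finite (unitsDiff σ).ker := Nat.finite_of_card_ne_zero (by rw [hker]; decide)
    have h := isOfFinOrder_of_finite (⟨u, hu⟩ : (unitsDiff σ).ker)
    exact (Submonoid.isOfFinOrder_coe).2 h
  have hfin : Finite (Units.torsion K) := inferInstance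
  have hs3 (u : (𝓞 K)ˣ) : unitsAct σ (unitsAct σ (unitsAct σ u)) = u :=
    Units.ext (smul_smul_smul_eq h3 σ (u : 𝓞 K))
  have hNker (u : (𝓞 K)ˣ) : unitsNorm σ u ∈ (unitsDiff σ).ker := by
    rw [mem_ker_unitsDiff, coe_unitsNorm, smul_cubicNorm h3]
  have key := index_range_of_finite_quotient (Units.torsion K) (unitsAct σ) (unitsDiff σ)
    (unitsDiff_apply σ) hs3 (fun u => hle (hNker u))
    (fun u hu => by
      rw [Units.torsion, CommGroup.mem_torsion] at hu ⊢
      exact hu.of_pow (by decide))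
    (fun u hu => (unitsAct σ).isOfFinOrder hu)
    (Units.basisModTorsion K) (units_rank_of_finrank_eq_six h6 hζ)
  have hDN : (unitsDiff σ).range ≤ (unitsNorm σ).ker := by
    rintro _ ⟨u, rfl⟩
    rw [MonoidHom.mem_ker, unitsDiff_apply, map_div, div_eq_one]
    ext
    rw [coe_unitsNorm, coe_unitsAct, cubicNorm_smul h3, coe_unitsNorm]
  rw [← Subgroup.index_ker, mul_comm, Subgroup.relIndex_mul_index hDN, key, hker]

end UnitIndex

section AmbiguousClasses

open scoped Pointwise

variable {F K : Type} [Field F] [NumberField F] [Field K] [NumberField K] [Algebra F K]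
  [IsGalois F K]

lemma exists_smul_ne_ringOfIntegers {σ : Gal(K/F)} (hσ : σ ≠ 1) : ∃ x : 𝓞 K, σ • x ≠ x := by
  by_contra! h
  apply hσ
  ext y
  obtain ⟨a, b, hb, rfl⟩ := IsFractionRing.div_surjective (A := 𝓞 K) y
  have ha' := congrArg (algebraMap (𝓞 K) K) (h a)
  have hb' := congrArg (algebraMap (𝓞 K) K) (h b)
  change σ (algebraMap (𝓞 K) K a) = _ at ha'
  change σ (algebraMap (𝓞 K) K b) = _ at hb'
  rw [AlgEquiv.one_apply, map_div₀, ha', hb']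

lemma finite_totRamPrimes {σ : Gal(K/F)} (hσ : σ ≠ 1) : Finite (totRamPrimes σ) := by
  obtain ⟨x, hx⟩ := exists_smul_ne_ringOfIntegers hσ
  have h0 : Ideal.span {σ • x - x} ≠ ⊥ := by simpa [sub_eq_zero] using hx
  refine Set.Finite.subset (open Classical in
    (UniqueFactorizationMonoid.normalizedFactors (Ideal.span {σ • x - x})).toFinset.finite_toSet) ?_
  rintro P ⟨hP, hP0, hr⟩
  rw [Finset.mem_coe, Multiset.mem_toFinset, ← Multiset.count_ne_zero]
  have := (idealVal_ne_zero_iff hP hP0 h0).2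
    (Ideal.dvd_iff_le.2 ((Ideal.span_singleton_le_iff_mem _).2 (hr x)))
  exact this

lemma Subgroup.card_mul_relIndex_of_le {G : Type*} [Group G] {H K : Subgroup G} (h : H ≤ K) :
    Nat.card H * H.relIndex K = Nat.card K := by
  rw [← Subgroup.relIndex_bot_left, Subgroup.relIndex_mul_relIndex _ _ _ bot_le h,
    Subgroup.relIndex_bot_left]

section
variable (h3 : Module.finrank F K = 3) {σ : Gal(K/F)} (hσ : σ ≠ 1)
include hσ

lemma card_ambClasses_mul_eq [IsCyclotomicExtension {3} ℚ F] [IsPrincipalIdealRing (𝓞 F)] :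
    Nat.card (ambClasses h3 σ) * 18 = Nat.card (normUnits h3 σ) * 3 ^ Nat.card (totRamPrimes σ) := by
  have := finite_totRamPrimes hσ
  have h1 := three_pow_card_eq h3 hσ
  have h2 := card_range_unitsNorm_mul_relIndex h3 hσ
  have h4 := relIndex_strongAmbClasses h3 (σ := σ)
  have hS : strongAmbClasses h3 σ ≤ ambClasses h3 σ := by
    intro c hc
    obtain ⟨I, rfl, hI⟩ := (mem_strongAmbClasses_iff h3 hσ c).1 hc
    rw [mem_ambClasses_iff]
    congr 1
    exact Subtype.ext hI
  have hR : (unitsNorm σ).range ≤ normUnits h3 σ := by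
    rintro _ ⟨u, rfl⟩
    rw [mem_normUnits_iff]
    refine ⟨by rw [coe_unitsNorm, smul_cubicNorm h3], 1, u, one_ne_zero, u.ne_zero, ?_⟩
    rw [coe_unitsNorm, cubicNorm_one, mul_one]
  have h5 := Subgroup.card_mul_relIndex_of_le hS
  have h6 := Subgroup.card_mul_relIndex_of_le hR
  rw [← h5, ← h6, h1, ← h2, h4]
  ring

lemma pow_three_eq_one_of_mem_ambClasses [IsPrincipalIdealRing (𝓞 F)] {c : ClassGroup (𝓞 K)}
    (hc : c ∈ ambClasses h3 σ) : c ^ 3 = 1 := by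
  obtain ⟨I, rfl⟩ := ClassGroup.mk0_surjective c
  have h1 := (mem_ambClasses_iff h3 I).1 hc
  set J : (Ideal (𝓞 K))⁰ := ⟨σ • (I : Ideal (𝓞 K)), mem_nonZeroDivisors_smul σ I⟩ with hJ
  have hJ' : ClassGroup.mk0 J ∈ ambClasses h3 σ := h1 ▸ hc
  have h2 := (mem_ambClasses_iff h3 J).1 hJ'
  set L : (Ideal (𝓞 K))⁰ := ⟨σ • (J : Ideal (𝓞 K)), mem_nonZeroDivisors_smul σ J⟩ with hL
  have h4 : ClassGroup.mk0 (I * J * L) = ClassGroup.mk0 I ^ 3 := by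
    rw [map_mul, map_mul, h2, h1, pow_three, mul_assoc]
  have hI0 : (I : Ideal (𝓞 K)) ≠ 0 := nonZeroDivisors.ne_zero I.2
  have hJ0 : (J : Ideal (𝓞 K)) ≠ 0 := nonZeroDivisors.ne_zero J.2
  have hL0 : (L : Ideal (𝓞 K)) ≠ 0 := nonZeroDivisors.ne_zero L.2
  rw [← h4]
  apply mk0_eq_one_of_three_dvd h3 hσ
  · change σ • ((I : Ideal (𝓞 K)) * (σ • (I : Ideal (𝓞 K))) * σ • σ • (I : Ideal (𝓞 K))) =
      (I : Ideal (𝓞 K)) * (σ • (I : Ideal (𝓞 K))) * σ • σ • (I : Ideal (𝓞 K))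
    simp only [smul_mul', smul_smul_smul_eq h3]
    ring
  · rintro P ⟨hP, hP0, hr⟩
    have hval (M : Ideal (𝓞 K)) (hM : M ≠ 0) : idealVal P (σ • M) = idealVal P M := by
      conv_lhs => rw [← hr.smul_eq h3 hσ σ]
      exact idealVal_smul σ hP hP0 hM
    have h5 : idealVal P (J : Ideal (𝓞 K)) = idealVal P (I : Ideal (𝓞 K)) := hval _ hI0
    have h6 : idealVal P (L : Ideal (𝓞 K)) = idealVal P (J : Ideal (𝓞 K)) := hval _ hJ0
    rw [Submonoid.coe_mul, Submonoid.coe_mul, idealVal_mul P (mul_ne_zero hI0 hJ0) hL0,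
      idealVal_mul P hI0 hJ0, h6, h5]
    exact ⟨idealVal P (I : Ideal (𝓞 K)), by ring⟩

lemma mem_normUnits_iff_norm {u : (𝓞 K)ˣ} {v : F} (huv : algebraMap F K v = (u : 𝓞 K)) :
    u ∈ normUnits h3 σ ↔ ∃ x : K, Algebra.norm F x = v := by
  have hcoe (a : 𝓞 K) : ((cubicNorm σ a : 𝓞 K) : K) = algebraMap F K (Algebra.norm F (a : K)) := by
    rw [algebraMap_norm_eq h3 hσ]; rfl
  rw [mem_normUnits_iff]
  constructor
  · rintro ⟨-, a, b, ha, hb, hab⟩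
    refine ⟨(b : K) / (a : K), ?_⟩
    have h := congrArg (algebraMap (𝓞 K) K) hab
    rw [map_mul] at h
    change ((cubicNorm σ b : 𝓞 K) : K) = ((u : 𝓞 K) : K) * ((cubicNorm σ a : 𝓞 K) : K) at h
    rw [hcoe, hcoe, ← huv, ← map_mul] at h
    have h' := (algebraMap F K).injective h
    have ha0 : Algebra.norm F (a : K) ≠ 0 := by
      rw [Algebra.norm_ne_zero_iff]
      exact RingOfIntegers.coe_ne_zero_iff.2 ha
    apply mul_right_cancel₀ ha0
    rw [← map_mul, div_mul_cancel₀ _ (RingOfIntegers.coe_ne_zero_iff.2 ha), h']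
  · rintro ⟨x, hx⟩
    refine ⟨?_, ?_⟩
    · apply RingOfIntegers.coe_injective
      change σ ((u : 𝓞 K) : K) = ((u : 𝓞 K) : K)
      rw [← huv, AlgEquiv.commutes]
    · obtain ⟨b, a, ha, rfl⟩ := IsFractionRing.div_surjective (A := 𝓞 K) x
      have ha0 : a ≠ 0 := nonZeroDivisors.ne_zero ha
      have haN : Algebra.norm F (a : K) ≠ 0 := by
        rw [Algebra.norm_ne_zero_iff]
        exact RingOfIntegers.coe_ne_zero_iff.2 ha0
      have hu0 : ((u : 𝓞 K) : K) ≠ 0 := RingOfIntegers.coe_ne_zero_iff.2 u.ne_zero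
      have hv0 : v ≠ 0 := by rintro rfl; rw [map_zero] at huv; exact hu0 huv.symm
      have hb0 : b ≠ 0 := by
        rintro rfl
        rw [map_zero, zero_div, Algebra.norm_zero] at hx
        exact hv0 hx.symm
      refine ⟨a, b, ha0, hb0, ?_⟩
      have hx' : Algebra.norm F (b : K) = v * Algebra.norm F (a : K) := by
        rw [← hx, ← map_mul]
        congr 1
        exact (div_mul_cancel₀ _ (RingOfIntegers.coe_ne_zero_iff.2 ha0)).symm
      apply RingOfIntegers.coe_injective
      rw [map_mul]
      change ((cubicNorm σ b : 𝓞 K) : K) = ((u : 𝓞 K) : K) * ((cubicNorm σ a : 𝓞 K) : K)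
      rw [hcoe, hcoe, ← huv, ← map_mul, ← hx']

open Classical in
lemma card_normUnits [IsCyclotomicExtension {3} ℚ F] {ζ : F} (hζ : IsPrimitiveRoot ζ 3) :
    Nat.card (normUnits h3 σ) = if ∃ x : K, Algebra.norm F x = ζ then 6 else 2 := by
  have hker := card_ker_unitsDiff h3 hσ
  have hle : normUnits h3 σ ≤ (unitsDiff σ).ker := by
    intro u hu
    rw [mem_ker_unitsDiff]
    exact ((mem_normUnits_iff h3 u).1 hu).1
  have hfin : Finite (unitsDiff σ).ker := Nat.finite_of_card_ne_zero (by rw [hker]; decide)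
  have hfin' : Finite (normUnits h3 σ) := Finite.of_injective _ (Subgroup.inclusion_injective hle)
  have hdvd : Nat.card (normUnits h3 σ) ∣ 6 := hker ▸ Subgroup.card_dvd_of_le hle
  have h2 : 2 ∣ Nat.card (normUnits h3 σ) := by
    have hm : (-1 : (𝓞 K)ˣ) ∈ normUnits h3 σ := by
      rw [mem_normUnits_iff]
      refine ⟨by simp, 1, -1, one_ne_zero, by simp, ?_⟩
      simp [cubicNorm]
    have := Subgroup.orderOf_dvd_natCard _ hm
    have h1 : orderOf (-1 : (𝓞 K)ˣ) = 2 := by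
      rw [← orderOf_units, Units.val_neg, Units.val_one, orderOf_neg_one]
      rw [ringChar.eq_zero, if_neg (by decide)]
    rwa [h1] at this
  have hIntegral : IsIntegral ℤ (algebraMap F K ζ) :=
    (hζ.map_of_injective (algebraMap F K).injective).isIntegral (by decide)
  have hζK := (hζ.map_of_injective (algebraMap F K).injective).toInteger_isPrimitiveRoot
  let z : (𝓞 K)ˣ := hζK.isUnit (by decide) |>.unit
  have hz : algebraMap F K ζ = (z : 𝓞 K) := rfl
  have hzord : orderOf z = 3 := by
    rw [← orderOf_units]; exact hζK.eq_orderOf.symm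
  have hzk : z ∈ (unitsDiff σ).ker := by
    rw [mem_ker_unitsDiff]
    apply RingOfIntegers.coe_injective
    change σ ((z : 𝓞 K) : K) = ((z : 𝓞 K) : K)
    rw [← hz, AlgEquiv.commutes]
  rw [← mem_normUnits_iff_norm h3 hσ hz]
  have hcases : Nat.card (normUnits h3 σ) = 2 ∨ Nat.card (normUnits h3 σ) = 6 := by
    have := Nat.le_of_dvd (by decide) hdvd
    interval_cases h : Nat.card (normUnits h3 σ) <;> simp_all
  split_ifs with hmem
  · have := Subgroup.orderOf_dvd_natCard _ hmem
    rw [hzord] at this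
    omega
  · rcases hcases with h | h
    · exact h
    · exfalso
      apply hmem
      have heq : normUnits h3 σ = (unitsDiff σ).ker :=
        Subgroup.eq_of_le_of_card_ge hle (by rw [h, hker])
      rw [heq]; exact hzk

open Classical in
/-- Chevalley's formula for the number of ambiguous classes of a cyclic cubic extension of the
third cyclotomic field. -/
theorem card_ambClasses_mul [IsCyclotomicExtension {3} ℚ F] [IsPrincipalIdealRing (𝓞 F)] {ζ : F}
    (hζ : IsPrimitiveRoot ζ 3) :
    Nat.card (ambClasses h3 σ) * (if ∃ x : K, Algebra.norm F x = ζ then 3 else 9) =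
      3 ^ Nat.card (totRamPrimes σ) := by
  have h1 := card_ambClasses_mul_eq h3 hσ
  rw [card_normUnits h3 hσ hζ] at h1
  split_ifs at h1 ⊢ <;> omega

end

end AmbiguousClasses

section Eisenstein

open scoped Pointwise

variable {F K : Type} [Field F] [NumberField F] [Field K] [NumberField K] [Algebra F K]
  [IsGalois F K]

lemma finrank_cyclotomic_three (F : Type) [Field F] [NumberField F]
    [IsCyclotomicExtension {3} ℚ F] : Module.finrank ℚ F = 2 := by
  rw [IsCyclotomicExtension.finrank (n := 3) F (Polynomial.cyclotomic.irreducible_rat (by norm_num))]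
  decide

lemma prime_natCast_of_mod_three [IsCyclotomicExtension {3} ℚ F] {p : ℕ} (hp : p.Prime)
    (hp3 : p % 3 = 2) : Prime (p : 𝓞 F) := by
  have : Fact p.Prime := ⟨hp⟩
  have hp0 : (p : 𝓞 F) ≠ 0 := by exact_mod_cast hp.ne_zero
  have hm : (Ideal.span {(p : ℤ)}).IsMaximal :=
    Int.ideal_span_isMaximal_of_prime p
  obtain ⟨P, hP, hPl⟩ := Ideal.exists_maximal_ideal_liesOver_of_isIntegral (S := 𝓞 F)
    (Ideal.span {(p : ℤ)})
  have hdeg : Ideal.inertiaDeg P ℤ = 2 := by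
    rw [IsCyclotomicExtension.Rat.inertiaDeg_eq_of_not_dvd p F P (m := 3)]
    · have : ((p : ℕ) : ZMod 3) = 2 := by
        have := (ZMod.natCast_eq_natCast_iff p 2 3).2 (by rw [Nat.ModEq, hp3])
        exact_mod_cast this
      rw [this]
      exact orderOf_eq_prime (by decide) (by decide)
    · intro h
      rw [Nat.prime_dvd_prime_iff_eq hp Nat.prime_three] at h
      omega
  have hn : Ideal.absNorm P = p ^ 2 := by
    rw [← hdeg, ← Ideal.inertiaDeg'_eq_inertiaDeg (Ideal.span {(p : ℤ)}) P]
    exact Ideal.absNorm_eq_pow_inertiaDeg' P hp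
  have hn' : Ideal.absNorm (Ideal.span {(p : 𝓞 F)}) = p ^ 2 := by
    rw [Ideal.absNorm_span_singleton, ← finrank_cyclotomic_three F, ← RingOfIntegers.rank F]
    have : (p : 𝓞 F) = algebraMap ℤ (𝓞 F) p := by simp
    rw [this, Algebra.norm_algebraMap, Int.natAbs_pow, Int.natAbs_natCast]
  have hle : Ideal.span {(p : 𝓞 F)} ≤ P := by
    rw [Ideal.span_singleton_le_iff_mem]
    have : (p : ℤ) ∈ Ideal.span {(p : ℤ)} := Ideal.mem_span_singleton_self _
    rw [hPl.over, Ideal.mem_comap] at this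
    simpa using this
  have heq : Ideal.span {(p : 𝓞 F)} = P := by
    obtain ⟨J, hJ⟩ := Ideal.dvd_iff_le.2 hle
    have h := congrArg Ideal.absNorm hJ
    rw [map_mul, hn, hn'] at h
    have h1 : Ideal.absNorm J = 1 := by
      have : 0 < p ^ 2 := pow_pos hp.pos 2
      exact Nat.eq_of_mul_eq_mul_left this (by omega)
    rw [Ideal.absNorm_eq_one_iff] at h1
    rw [hJ, h1, Ideal.mul_top]
  rw [← Ideal.span_singleton_prime hp0, heq]
  exact hP.isPrime

section IntegersModThree

variable {ζ : 𝓞 F}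

lemma sub_one_sq_eq (hζ : ζ ^ 2 + ζ + 1 = 0) : (ζ - 1) ^ 2 = -(3 * ζ) := by
  linear_combination hζ

lemma pow_three_eq_one_of_sq_add (hζ : ζ ^ 2 + ζ + 1 = 0) : ζ ^ 3 = 1 := by
  linear_combination (ζ - 1) * hζ

lemma three_eq_neg_sq_mul (hζ : ζ ^ 2 + ζ + 1 = 0) : (3 : 𝓞 F) = -ζ ^ 2 * (ζ - 1) ^ 2 := by
  rw [sub_one_sq_eq hζ]
  linear_combination -3 * (ζ - 1) * hζ

lemma sub_one_ne_zero_of_sq_add (hζ : ζ ^ 2 + ζ + 1 = 0) : ζ - 1 ≠ 0 := by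
  intro h
  have := three_eq_neg_sq_mul hζ
  rw [h] at this
  norm_num at this

lemma isUnit_neg_sq (hζ : ζ ^ 2 + ζ + 1 = 0) : IsUnit (-ζ ^ 2) := by
  rw [IsUnit.neg_iff]
  exact (IsUnit.of_mul_eq_one (ζ ^ 2) (by
    rw [← pow_succ']; exact pow_three_eq_one_of_sq_add hζ)).pow 2

lemma prime_sub_one [IsCyclotomicExtension {3} ℚ F] (hζ : ζ ^ 2 + ζ + 1 = 0) : Prime (ζ - 1) := by
  have h0 := sub_one_ne_zero_of_sq_add hζ
  rw [← Ideal.span_singleton_prime h0]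
  apply Ideal.isPrime_of_irreducible_absNorm
  rw [Ideal.absNorm_span_singleton]
  have h := congrArg (fun x => (Algebra.norm ℤ x).natAbs) (three_eq_neg_sq_mul hζ)
  simp only [map_mul, map_pow, Int.natAbs_mul, Int.natAbs_pow] at h
  have h3 : (Algebra.norm ℤ (3 : 𝓞 F)).natAbs = 9 := by
    have : (3 : 𝓞 F) = algebraMap ℤ (𝓞 F) 3 := by simp
    rw [this, Algebra.norm_algebraMap, RingOfIntegers.rank, finrank_cyclotomic_three]; rfl
  have hu : (Algebra.norm ℤ (-ζ ^ 2)).natAbs = 1 := by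
    exact Int.isUnit_iff_natAbs_eq.1 ((isUnit_neg_sq hζ).map (Algebra.norm ℤ))
  rw [h3, hu, one_mul] at h
  have : (Algebra.norm ℤ (ζ - 1)).natAbs = 3 := by
    apply Nat.pow_left_injective two_ne_zero
    simp only
    omega
  rw [this]
  exact Nat.prime_three

/-- A prime `p` not congruent to `1` modulo `3` lies below a single Eisenstein prime. -/
lemma exists_under_eq [IsCyclotomicExtension {3} ℚ F] (hζ : ζ ^ 2 + ζ + 1 = 0)
    {p : ℕ} (hp : p.Prime) (hp1 : p % 3 ≠ 1) :
    ∃ π : 𝓞 F, Prime π ∧ (p : 𝓞 F) ∣ π ^ 2 ∧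
      ∃ u : 𝓞 F, IsUnit u ∧ (p : 𝓞 F) = u * π ^ (if p = 3 then 2 else 1) := by
  by_cases h3 : p = 3
  · subst h3
    refine ⟨ζ - 1, prime_sub_one hζ, ⟨-ζ, ?_⟩, -ζ ^ 2, isUnit_neg_sq hζ, ?_⟩
    · rw [sub_one_sq_eq hζ]; push_cast; ring
    · rw [if_pos rfl]; exact_mod_cast three_eq_neg_sq_mul hζ
  · have : p % 3 = 2 := by
      have : p % 3 ≠ 0 := by
        intro h
        exact h3 ((Nat.prime_dvd_prime_iff_eq Nat.prime_three hp).1 (Nat.dvd_of_mod_eq_zero h)).symm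
      omega
    exact ⟨p, prime_natCast_of_mod_three hp this, dvd_pow_self _ two_ne_zero, 1, isUnit_one, by
      rw [if_neg h3]; ring⟩

lemma under_eq_span {P : Ideal (𝓞 K)} (hP : P.IsPrime) {π : 𝓞 F} (hπ : Prime π)
    (h : algebraMap (𝓞 F) (𝓞 K) π ∈ P) : P.under (𝓞 F) = Ideal.span {π} := by
  have hm : (Ideal.span {π}).IsPrime := (Ideal.span_singleton_prime hπ.ne_zero).2 hπ
  have hm' : (Ideal.span {π}).IsMaximal := hm.isMaximal (by simpa using hπ.ne_zero)
  refine (hm'.eq_of_le (Ideal.IsPrime.ne_top (inferInstance : (P.under (𝓞 F)).IsPrime)) ?_).symm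
  rw [Ideal.span_singleton_le_iff_mem]
  exact h

lemma algebraMap_mem_of_natCast_mem {P : Ideal (𝓞 K)} (hP : P.IsPrime) {π : 𝓞 F} {p : ℕ}
    (h : (p : 𝓞 F) ∣ π ^ 2) (hp : (p : 𝓞 K) ∈ P) : algebraMap (𝓞 F) (𝓞 K) π ∈ P := by
  obtain ⟨c, hc⟩ := h
  apply hP.mem_of_pow_mem 2
  rw [← map_pow, hc, map_mul, map_natCast]
  exact P.mul_mem_right _ hp

lemma eq_of_natCast_mem [IsCyclotomicExtension {3} ℚ F] (h3 : Module.finrank F K = 3)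
    {σ : Gal(K/F)} (hσ : σ ≠ 1) (hζ : ζ ^ 2 + ζ + 1 = 0)
    {p : ℕ} (hp : p.Prime) (hp1 : p % 3 ≠ 1) {P Q : Ideal (𝓞 K)} (hP : P ∈ totRamPrimes σ)
    (hQ : Q ∈ totRamPrimes σ) (hpP : (p : 𝓞 K) ∈ P) (hpQ : (p : 𝓞 K) ∈ Q) : P = Q := by
  obtain ⟨π, hπ, hπp, -⟩ := exists_under_eq hζ hp hp1
  have h1 := under_eq_span hP.1 hπ (algebraMap_mem_of_natCast_mem hP.1 hπp hpP)
  obtain ⟨τ, hτ⟩ := exists_smul_eq_of_dvd_map hP.1 hP.2.1 hQ.1 (by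
    rw [h1, Ideal.map_span, Set.image_singleton, Ideal.dvd_iff_le, Ideal.span_singleton_le_iff_mem]
    exact algebraMap_mem_of_natCast_mem hQ.1 hπp hpQ)
  rw [← hτ, hP.2.2.smul_eq h3 hσ]

lemma idealVal_span_prime [IsCyclotomicExtension {3} ℚ F] (hζ : ζ ^ 2 + ζ + 1 = 0)
    {p : ℕ} (hp : p.Prime) (hp1 : p % 3 ≠ 1) {P : Ideal (𝓞 K)} (hP : P.IsPrime)
    (hpP : (p : 𝓞 K) ∈ P) : idealVal P (Ideal.span {(p : 𝓞 K)}) =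
      idealVal P ((P.under (𝓞 F)).map (algebraMap (𝓞 F) (𝓞 K))) * (if p = 3 then 2 else 1) := by
  obtain ⟨π, hπ, hπp, u, hu, he⟩ := exists_under_eq hζ hp hp1
  have h1 := under_eq_span hP hπ (algebraMap_mem_of_natCast_mem hP hπp hpP)
  have h2 : Ideal.span {(p : 𝓞 K)} =
      (Ideal.span {π} ^ (if p = 3 then 2 else 1)).map (algebraMap (𝓞 F) (𝓞 K)) := by
    rw [Ideal.span_singleton_pow, ← Ideal.span_singleton_mul_left_unit hu, ← he, Ideal.map_span,
      Set.image_singleton, map_natCast]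
  rw [h2, Ideal.map_pow, idealVal_pow, h1, mul_comm]

lemma natCast_mem_iff_dvd {P : Ideal (𝓞 K)} (hP : P.IsPrime) {p : ℕ} (hp : p.Prime)
    (hpP : (p : 𝓞 K) ∈ P) (n : ℕ) : (n : 𝓞 K) ∈ P ↔ p ∣ n := by
  constructor
  · intro h
    by_contra hn
    have hc := (Nat.Prime.coprime_iff_not_dvd hp).2 hn
    rw [← Nat.isCoprime_iff_coprime] at hc
    obtain ⟨a, b, hab⟩ := hc
    apply hP.ne_top
    rw [Ideal.eq_top_iff_one]
    have := congrArg (Int.cast : ℤ → 𝓞 K) hab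
    push_cast at this
    rw [← this]
    exact P.add_mem (P.mul_mem_left _ hpP) (P.mul_mem_left _ h)
  · rintro ⟨c, rfl⟩
    rw [Nat.cast_mul]
    exact P.mul_mem_right _ hpP

lemma idealVal_span_natCast [IsCyclotomicExtension {3} ℚ F] (hζ : ζ ^ 2 + ζ + 1 = 0)
    {p : ℕ} (hp : p.Prime) (hp1 : p % 3 ≠ 1) {P : Ideal (𝓞 K)} (hP : P.IsPrime) (hP0 : P ≠ ⊥)
    (hpP : (p : 𝓞 K) ∈ P) {k m : ℕ} (hm : ¬ p ∣ m) :
    idealVal P (Ideal.span {((p ^ k * m : ℕ) : 𝓞 K)}) =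
      k * (idealVal P ((P.under (𝓞 F)).map (algebraMap (𝓞 F) (𝓞 K))) *
        (if p = 3 then 2 else 1)) := by
  have hm0 : (m : 𝓞 K) ≠ 0 := by
    rintro h
    exact hm (by rw [Nat.cast_eq_zero.1 h]; exact dvd_zero p)
  have hp0 : (p : 𝓞 K) ≠ 0 := by exact_mod_cast hp.ne_zero
  have hm1 : idealVal P (Ideal.span {(m : 𝓞 K)}) = 0 := by
    by_contra h
    rw [← ne_eq, idealVal_ne_zero_iff hP hP0 (by simpa using hm0), Ideal.dvd_iff_le,
      Ideal.span_singleton_le_iff_mem, natCast_mem_iff_dvd hP hp hpP] at h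
    exact hm h
  rw [Nat.cast_mul, Nat.cast_pow, ← Ideal.span_singleton_mul_span_singleton,
    idealVal_mul P (by simp [hp0]) (by simpa using hm0), hm1, ← Ideal.span_singleton_pow,
    idealVal_pow, idealVal_span_prime hζ hp hp1 hP hpP, add_zero]

lemma exists_prime_mem (K : Type) [Field K] [NumberField K] {p : ℕ} (hp : p.Prime) :
    ∃ P : Ideal (𝓞 K), P.IsPrime ∧ P ≠ ⊥ ∧ (p : 𝓞 K) ∈ P := by
  have : Fact p.Prime := ⟨hp⟩
  have hm : (Ideal.span {(p : ℤ)}).IsMaximal := Int.ideal_span_isMaximal_of_prime p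
  obtain ⟨P, hP, hPl⟩ := Ideal.exists_maximal_ideal_liesOver_of_isIntegral (S := 𝓞 K)
    (Ideal.span {(p : ℤ)})
  have hmem : (p : 𝓞 K) ∈ P := by
    have : (p : ℤ) ∈ Ideal.span {(p : ℤ)} := Ideal.mem_span_singleton_self _
    rw [hPl.over, Ideal.mem_comap] at this
    simpa using this
  refine ⟨P, hP.isPrime, ?_, hmem⟩
  rintro rfl
  exact hp.ne_zero (by exact_mod_cast (Ideal.mem_bot.1 hmem))

end IntegersModThree

end Eisenstein

section RamifiedPrimes

open scoped Pointwise

variable {F K : Type} [Field F] [NumberField F] [Field K] [NumberField K] [Algebra F K]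
  [IsGalois F K]

variable {ζ : 𝓞 F} {θ : 𝓞 K}

lemma sub_one_mul_mem {σ : Gal(K/F)} (hσθ : σ • θ = algebraMap (𝓞 F) (𝓞 K) ζ * θ)
    {P : Ideal (𝓞 K)} (hP : P ∈ totRamPrimes σ) :
    algebraMap (𝓞 F) (𝓞 K) (ζ - 1) ∈ P ∨ θ ∈ P := by
  apply hP.1.mem_or_mem
  have := hP.2.2 θ
  rw [hσθ] at this
  convert this using 1
  rw [map_sub, map_one]; ring

lemma three_mem_of_sub_one_mem (hζ : ζ ^ 2 + ζ + 1 = 0) {P : Ideal (𝓞 K)}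
    (h : algebraMap (𝓞 F) (𝓞 K) (ζ - 1) ∈ P) : ((3 : ℕ) : 𝓞 K) ∈ P := by
  have h3 := congrArg (algebraMap (𝓞 F) (𝓞 K)) (three_eq_neg_sq_mul hζ)
  rw [map_mul, map_pow, map_ofNat] at h3
  push_cast
  rw [h3]
  exact P.mul_mem_left _ (P.pow_mem_of_mem h 2 two_pos)

lemma sub_one_mem_of_three_mem (hζ : ζ ^ 2 + ζ + 1 = 0) {P : Ideal (𝓞 K)} (hP : P.IsPrime)
    (h : ((3 : ℕ) : 𝓞 K) ∈ P) : algebraMap (𝓞 F) (𝓞 K) (ζ - 1) ∈ P := by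
  have h3 := congrArg (algebraMap (𝓞 F) (𝓞 K)) (sub_one_sq_eq hζ)
  apply hP.mem_of_pow_mem 2
  rw [← map_pow, h3, map_neg, map_mul, map_ofNat]
  push_cast at h
  exact P.neg_mem (P.mul_mem_right _ h)

lemma exists_prime_mem_of_natCast_mem {P : Ideal (𝓞 K)} (hP : P.IsPrime) {d : ℕ} (hd : d ≠ 0)
    (h : (d : 𝓞 K) ∈ P) : ∃ p ∈ d.primeFactors, (p : 𝓞 K) ∈ P := by
  induction d using induction_on_primes with
  | zero => exact absurd rfl hd
  | one => exact absurd ((Ideal.eq_top_iff_one _).2 (by simpa using h)) hP.ne_top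
  | prime_mul p a hp ih =>
    have ha : a ≠ 0 := right_ne_zero_of_mul hd
    rw [Nat.cast_mul] at h
    rcases hP.mem_or_mem h with h | h
    · exact ⟨p, by simp [hp, hp.ne_zero, ha], h⟩
    · obtain ⟨q, hq, hq'⟩ := ih ha h
      refine ⟨q, ?_, hq'⟩
      rw [Nat.primeFactors_mul hp.ne_zero ha]
      exact Finset.mem_union_right _ hq

/-- If `d` is `±1` modulo `9`, then `(∛d ∓ 1) / (ζ - 1)` is integral. -/
lemma exists_sub_one_mul_eq (hζ : ζ ^ 2 + ζ + 1 = 0) {s m : ℤ} (hs : s ^ 2 = 1)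
    (hθ : θ ^ 3 = ((s + 9 * m : ℤ) : 𝓞 K)) :
    ∃ η : 𝓞 K, algebraMap (𝓞 F) (𝓞 K) (ζ - 1) * η = θ - s := by
  have hl0 : algebraMap (𝓞 K) K (algebraMap (𝓞 F) (𝓞 K) (ζ - 1)) ≠ 0 := by
    rw [map_ne_zero_iff _ (FaithfulSMul.algebraMap_injective _ _),
      map_ne_zero_iff _ (FaithfulSMul.algebraMap_injective _ _)]
    exact sub_one_ne_zero_of_sq_add hζ
  have hz : algebraMap (𝓞 K) K (algebraMap (𝓞 F) (𝓞 K) ζ) ^ 2 +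
      algebraMap (𝓞 K) K (algebraMap (𝓞 F) (𝓞 K) ζ) + 1 = 0 := by
    have := congrArg (fun x => algebraMap (𝓞 K) K (algebraMap (𝓞 F) (𝓞 K) x)) hζ
    simpa using this
  have hθ' := congrArg (algebraMap (𝓞 K) K) hθ
  rw [map_pow, map_intCast] at hθ'
  push_cast at hθ'
  have hs' : (s : K) ^ 2 = 1 := by exact_mod_cast hs
  rw [map_sub, map_sub, map_one, map_one] at hl0
  set z := algebraMap (𝓞 K) K (algebraMap (𝓞 F) (𝓞 K) ζ) with hzd
  set t := algebraMap (𝓞 K) K θ with ht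
  set η : K := (t - s) / (z - 1) with hη
  have hηt : t = s + (z - 1) * η := by rw [hη]; field_simp; ring
  have key : η ^ 3 - s * z ^ 2 * (z - 1) * η ^ 2 - z ^ 2 * η - z * (z - 1) * m = 0 := by
    have hl3 : (z - 1) ^ 3 ≠ 0 := pow_ne_zero _ hl0
    apply (mul_eq_zero.1 _).resolve_left hl3
    rw [hηt] at hθ'
    have h3 : (3 : K) = -z ^ 2 * (z - 1) ^ 2 := by linear_combination (z ^ 2 - 3 * z + 3) * hz
    have h9 : (9 : K) = z * (z - 1) ^ 4 := by
      linear_combination (-z ^ 3 + 5 * z ^ 2 - 10 * z + 9) * hz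
    have hs3 : (s : K) ^ 3 = s := by linear_combination (s : K) * hs'
    linear_combination hθ' - hs3 - 3 * (z - 1) * η * hs' - (s * (z - 1) ^ 2 * η ^ 2 + (z-1) * η) * h3
      + (m : K) * h9
  have hIntegral : IsIntegral (𝓞 K) η := by
    let zz : 𝓞 K := algebraMap (𝓞 F) (𝓞 K) ζ
    refine ⟨Polynomial.X ^ 3 + (Polynomial.C (- s * zz ^ 2 * (zz - 1)) * Polynomial.X ^ 2
      + Polynomial.C (-zz ^ 2) * Polynomial.X + Polynomial.C (- zz * (zz - 1) * m)), ?_, ?_⟩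
    · apply Polynomial.monic_X_pow_add
      exact lt_of_le_of_lt Polynomial.degree_quadratic_le (by norm_num)
    · simp only [Polynomial.eval₂_add, Polynomial.eval₂_mul, Polynomial.eval₂_pow,
        Polynomial.eval₂_X, Polynomial.eval₂_C]
      simp only [map_mul, map_neg, map_pow, map_sub, map_one, map_intCast]
      change η ^ 3 + (-(s : K) * z ^ 2 * (z - 1) * η ^ 2 + -z ^ 2 * η + -z * (z - 1) * m) = 0
      linear_combination key
  obtain ⟨y, hy⟩ := (IsIntegrallyClosed.isIntegral_iff (R := 𝓞 K)).1 hIntegral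
  refine ⟨y, ?_⟩
  apply FaithfulSMul.algebraMap_injective (𝓞 K) K
  rw [map_mul, hy, map_sub, map_one, map_sub, map_one, map_sub, map_intCast, ← ht, hηt]
  ring

lemma mem_of_isTotRam {σ : Gal(K/F)} (hζ : ζ ^ 2 + ζ + 1 = 0)
    (hσθ : σ • θ = algebraMap (𝓞 F) (𝓞 K) ζ * θ) {s m : ℤ} (hs : s ^ 2 = 1)
    (hθ : θ ^ 3 = ((s + 9 * m : ℤ) : 𝓞 K)) {P : Ideal (𝓞 K)} (hr : IsTotRam σ P) : θ ∈ P := by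
  obtain ⟨η, hη⟩ := exists_sub_one_mul_eq hζ hs hθ
  have h1 := hr η
  have h2 : σ • η - η = θ := by
    have hl0 : algebraMap (𝓞 F) (𝓞 K) (ζ - 1) ≠ 0 := by
      rw [map_ne_zero_iff _ (FaithfulSMul.algebraMap_injective _ _)]
      exact sub_one_ne_zero_of_sq_add hζ
    apply mul_left_cancel₀ hl0
    have h3 := congrArg (σ • ·) hη
    simp only [smul_mul', smul_algebraMap_ringOfIntegers, smul_sub, hσθ] at h3
    have h4 : σ • (s : 𝓞 K) = s := by
      rw [← map_intCast (algebraMap (𝓞 F) (𝓞 K)), smul_algebraMap_ringOfIntegers]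
    rw [h4] at h3
    rw [mul_sub, h3, hη, map_sub, map_one]
    ring
  rwa [h2] at h1

lemma exists_mem_of_mem_totRamPrimes {σ : Gal(K/F)} (hζ : ζ ^ 2 + ζ + 1 = 0)
    (hσθ : σ • θ = algebraMap (𝓞 F) (𝓞 K) ζ * θ) {d : ℕ} (hd : d ≠ 0) (hθ : θ ^ 3 = (d : 𝓞 K))
    {P : Ideal (𝓞 K)} (hP : P ∈ totRamPrimes σ) :
    ∃ p, (p ∈ d.primeFactors ∨ p = 3 ∧ ¬ (d % 9 = 1 ∨ d % 9 = 8)) ∧ (p : 𝓞 K) ∈ P := by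
  have key : θ ∈ P → ∃ p, (p ∈ d.primeFactors ∨ p = 3 ∧ ¬ (d % 9 = 1 ∨ d % 9 = 8)) ∧
      (p : 𝓞 K) ∈ P := by
    intro h
    have := P.pow_mem_of_mem h 3 (by norm_num)
    rw [hθ] at this
    obtain ⟨p, hp, hp'⟩ := exists_prime_mem_of_natCast_mem hP.1 hd this
    exact ⟨p, Or.inl hp, hp'⟩
  by_cases h9 : d % 9 = 1 ∨ d % 9 = 8
  · apply key
    rcases h9 with h9 | h9
    · refine mem_of_isTotRam hζ hσθ (s := 1) (m := d / 9) (by norm_num) ?_ hP.2.2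
      rw [hθ, ← Int.cast_natCast]
      congr 1; omega
    · refine mem_of_isTotRam hζ hσθ (s := -1) (m := (d + 1) / 9) (by norm_num) ?_ hP.2.2
      rw [hθ, ← Int.cast_natCast]
      congr 1; omega
  · rcases sub_one_mul_mem hσθ hP with h | h
    · exact ⟨3, Or.inr ⟨rfl, h9⟩, three_mem_of_sub_one_mem hζ h⟩
    · exact key h

lemma isTotRam_of_dvd [IsCyclotomicExtension {3} ℚ F] (h3 : Module.finrank F K = 3)
    {σ : Gal(K/F)} (hσ : σ ≠ 1) (hζ : ζ ^ 2 + ζ + 1 = 0) {p : ℕ} (hp : p.Prime) (hp1 : p % 3 ≠ 1)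
    {k m : ℕ} (hk : k = 1 ∨ k = 2) (hm : ¬ p ∣ m)
    (hθ : θ ^ 3 = ((p ^ k * m : ℕ) : 𝓞 K)) {P : Ideal (𝓞 K)} (hP : P.IsPrime) (hP0 : P ≠ ⊥)
    (hpP : (p : 𝓞 K) ∈ P) : IsTotRam σ P := by
  rcases isTotRam_iff_idealVal h3 hσ hP hP0 with ⟨h, -⟩ | ⟨-, h⟩
  · exact h
  · exfalso
    have h1 := idealVal_span_natCast hζ hp hp1 hP hP0 hpP (k := k) hm
    rw [h, ← hθ, ← Ideal.span_singleton_pow, idealVal_pow] at h1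
    split_ifs at h1 <;> rcases hk with rfl | rfl <;> omega

lemma isTotRam_of_three_mem [IsCyclotomicExtension {3} ℚ F] (h3 : Module.finrank F K = 3)
    {σ : Gal(K/F)} (hσ : σ ≠ 1) (hζ : ζ ^ 2 + ζ + 1 = 0) {s : ℤ} {n m : ℕ} (hs : s ^ 2 = 1)
    (hm : ¬ 3 ∣ m) (hn : n = 3 * m)
    (hθ : θ ^ 3 = s + n) {P : Ideal (𝓞 K)} (hP : P.IsPrime)
    (hP0 : P ≠ ⊥) (hpP : ((3 : ℕ) : 𝓞 K) ∈ P) : IsTotRam σ P := by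
  rcases isTotRam_iff_idealVal h3 hσ hP hP0 with ⟨h, -⟩ | ⟨-, h⟩
  · exact h
  · exfalso
    have h1 := idealVal_span_natCast hζ Nat.prime_three (by norm_num) hP hP0 hpP (k := 1) hm
    rw [h, if_pos rfl, pow_one, ← hn] at h1
    have hn0 : Ideal.span {(n : 𝓞 K)} ≠ 0 := by
      have : n ≠ 0 := by rintro rfl; omega
      simpa using this
    have hd : Ideal.span {(n : 𝓞 K)} = Ideal.span {θ ^ 3 - s} := by
      rw [hθ, add_sub_cancel_left]
    have hs3 : (s : 𝓞 K) ^ 3 = s := by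
      have : s ^ 3 = s := by linear_combination s * hs
      exact_mod_cast this
    set z := algebraMap (𝓞 F) (𝓞 K) ζ with hz
    have hz2 : z ^ 2 + z + 1 = 0 := by
      have := congrArg (algebraMap (𝓞 F) (𝓞 K)) hζ
      simpa using this
    have hf : θ ^ 3 - s = (θ - s) * (θ - z * s) * (θ - z ^ 2 * s) := by
      linear_combination ((z ^ 2 * s * θ - z * s ^ 2) * 0 + (s * θ ^ 2 - s ^ 2 * θ * z + (z - 1) * s ^ 3) ) * hz2 + hs3
    have hl : z - 1 ∈ P := by
      have := sub_one_mem_of_three_mem hζ hP hpP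
      rwa [map_sub, map_one] at this
    have hnP : θ ^ 3 - s ∈ P := by
      have : Ideal.span {(n : 𝓞 K)} ≤ P := by
        rw [Ideal.span_singleton_le_iff_mem, natCast_mem_iff_dvd hP Nat.prime_three hpP]
        exact ⟨m, hn⟩
      rwa [hd, Ideal.span_singleton_le_iff_mem] at this
    have h01 : (θ - s) ∈ P → θ - z * s ∈ P := fun h => by
      have := P.sub_mem h (P.mul_mem_right (s : 𝓞 K) hl)
      convert this using 1; ring
    have h12 : (θ - z * s) ∈ P → θ - z ^ 2 * s ∈ P := fun h => by
      have := P.sub_mem h (P.mul_mem_right (z * s : 𝓞 K) hl)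
      convert this using 1; ring
    have h20 : (θ - z ^ 2 * s) ∈ P → θ - s ∈ P := fun h => by
      have := P.add_mem h (P.mul_mem_right ((z + 1) * s : 𝓞 K) hl)
      convert this using 1; ring
    have h0 : θ - s ∈ P := by
      rw [hf] at hnP
      rcases hP.mem_or_mem hnP with h | h
      · rcases hP.mem_or_mem h with h | h
        · exact h
        · exact h20 (h12 h)
      · exact h20 h
    have hpow : P ^ 3 ∣ Ideal.span {(n : 𝓞 K)} := by
      rw [hd, hf, Ideal.dvd_iff_le, Ideal.span_singleton_le_iff_mem, pow_three']
      exact Ideal.mul_mem_mul (Ideal.mul_mem_mul h0 (h01 h0)) (h12 (h01 h0))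
    obtain ⟨J, hJ⟩ := hpow
    have hJ0 : J ≠ 0 := by
      rintro rfl
      exact hn0 (by rw [hJ, mul_zero])
    rw [hJ, idealVal_mul P (pow_ne_zero 3 hP0) hJ0, idealVal_pow, idealVal_self hP hP0] at h1
    omega

/-- The rational primes that ramify in `F(∛d) / F`. -/
def ramifiedPrimes (d : ℕ) : Finset ℕ :=
  if d % 9 = 1 ∨ d % 9 = 8 then d.primeFactors else insert 3 d.primeFactors

lemma mem_ramifiedPrimes {d p : ℕ} :
    p ∈ ramifiedPrimes d ↔ p ∈ d.primeFactors ∨ p = 3 ∧ ¬ (d % 9 = 1 ∨ d % 9 = 8) := by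
  unfold ramifiedPrimes
  split_ifs with h
  · simp [h]
  · simp [h, or_comm]

lemma exists_mem_totRamPrimes [IsCyclotomicExtension {3} ℚ F] (h3 : Module.finrank F K = 3)
    {σ : Gal(K/F)} (hσ : σ ≠ 1) (hζ : ζ ^ 2 + ζ + 1 = 0) {d : ℕ} (hd : d ≠ 0)
    (hcf : ∀ p : ℕ, p.Prime → ¬ p ^ 3 ∣ d) (hns : ∀ p : ℕ, p.Prime → p ∣ d → p % 3 ≠ 1)
    (hθ : θ ^ 3 = (d : 𝓞 K)) {p : ℕ} (hp : p ∈ ramifiedPrimes d) :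
    ∃ P ∈ totRamPrimes σ, (p : 𝓞 K) ∈ P := by
  have key : p ∈ d.primeFactors → ∃ P ∈ totRamPrimes σ, (p : 𝓞 K) ∈ P := by
    intro hp
    have hpp := Nat.prime_of_mem_primeFactors hp
    have hpd := Nat.dvd_of_mem_primeFactors hp
    obtain ⟨P, hP, hP0, hpP⟩ := exists_prime_mem K hpp
    obtain ⟨k, m, hm, rfl⟩ := Nat.exists_eq_pow_mul_and_not_dvd hd p hpp.ne_one
    have hk : k = 1 ∨ k = 2 := by
      have h1 : k ≠ 0 := by
        rintro rfl
        exact hm (by simpa using hpd)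
      have h2 : k < 3 := by
        by_contra! h
        exact hcf p hpp (Dvd.dvd.mul_right (pow_dvd_pow p h) m)
      omega
    exact ⟨P, ⟨hP, hP0, isTotRam_of_dvd h3 hσ hζ hpp (hns p hpp hpd) hk hm hθ hP hP0 hpP⟩, hpP⟩
  rcases mem_ramifiedPrimes.1 hp with h | ⟨rfl, h9⟩
  · exact key h
  · by_cases h3d : 3 ∣ d
    · exact key (by simp [h3d, hd, Nat.prime_three])
    · obtain ⟨P, hP, hP0, hpP⟩ := exists_prime_mem K Nat.prime_three
      refine ⟨P, ⟨hP, hP0, ?_⟩, hpP⟩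
      have : d % 3 = 1 ∨ d % 3 = 2 := by omega
      rcases this with h | h
      · refine isTotRam_of_three_mem h3 hσ hζ (s := 1) (n := d - 1) (m := d / 3) (by norm_num)
          (by omega) (by omega) (θ := θ) ?_ hP hP0 hpP
        rw [hθ, Nat.cast_sub (by omega)]; push_cast; ring
      · refine isTotRam_of_three_mem h3 hσ hζ (s := -1) (n := d + 1) (m := (d + 1) / 3) (by norm_num)
          (by omega) (by omega) (θ := θ) ?_ hP hP0 hpP
        rw [hθ]; push_cast; ring

theorem card_totRamPrimes [IsCyclotomicExtension {3} ℚ F] (h3 : Module.finrank F K = 3)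
    {σ : Gal(K/F)} (hσ : σ ≠ 1) (hζ : ζ ^ 2 + ζ + 1 = 0)
    (hσθ : σ • θ = algebraMap (𝓞 F) (𝓞 K) ζ * θ) {d : ℕ} (hd : d ≠ 0)
    (hcf : ∀ p : ℕ, p.Prime → ¬ p ^ 3 ∣ d) (hns : ∀ p : ℕ, p.Prime → p ∣ d → p % 3 ≠ 1)
    (hθ : θ ^ 3 = (d : 𝓞 K)) :
    Nat.card (totRamPrimes σ) = (ramifiedPrimes d).card := by
  have hex : ∀ p : ramifiedPrimes d, ∃ P : totRamPrimes σ, ((p : ℕ) : 𝓞 K) ∈ (P : Ideal (𝓞 K)) := by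
    intro p
    obtain ⟨P, hP, hpP⟩ := exists_mem_totRamPrimes h3 hσ hζ hd hcf hns hθ p.2
    exact ⟨⟨P, hP⟩, hpP⟩
  have hpr : ∀ p ∈ ramifiedPrimes d, p.Prime ∧ p % 3 ≠ 1 := by
    intro p hp
    rcases mem_ramifiedPrimes.1 hp with h | ⟨rfl, -⟩
    · have := Nat.prime_of_mem_primeFactors h
      exact ⟨this, hns p this (Nat.dvd_of_mem_primeFactors h)⟩
    · exact ⟨Nat.prime_three, by norm_num⟩
  choose f hf using hex
  have hbij : Function.Bijective f := by
    constructor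
    · intro p q hpq
      have h1 := hf p
      rw [hpq] at h1
      have h2 := (natCast_mem_iff_dvd (f q).2.1 (hpr p p.2).1 h1 q).1 (hf q)
      exact Subtype.ext ((Nat.prime_dvd_prime_iff_eq (hpr p p.2).1 (hpr q q.2).1).1 h2)
    · rintro ⟨P, hP⟩
      obtain ⟨p, hp, hpP⟩ := exists_mem_of_mem_totRamPrimes hζ hσθ hd hθ hP
      have hp' := mem_ramifiedPrimes.2 hp
      refine ⟨⟨p, hp'⟩, Subtype.ext ?_⟩
      exact eq_of_natCast_mem h3 hσ hζ (hpr p hp').1 (hpr p hp').2 (f ⟨p, hp'⟩).2 hP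
        (hf ⟨p, hp'⟩) hpP
  rw [← Nat.card_congr (Equiv.ofBijective f hbij), Nat.card_eq_fintype_card, Fintype.card_coe]

end RamifiedPrimes

section Inertia

open scoped Pointwise

variable {F K : Type} [Field F] [NumberField F] [Field K] [NumberField K] [Algebra F K]
  [IsGalois F K]

variable {ζ : 𝓞 F}

lemma isTotRam_map_under (h3 : Module.finrank F K = 3) {σ : Gal(K/F)} (hσ : σ ≠ 1)
    {P : Ideal (𝓞 K)} (hP : P ∈ totRamPrimes σ) :
    (P.under (𝓞 F)).map (algebraMap (𝓞 F) (𝓞 K)) = P ^ 3 := by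
  have hu : P.under (𝓞 F) ≠ ⊥ := under_ne_bot hP.2.1
  have hm : (P.under (𝓞 F)).map (algebraMap (𝓞 F) (𝓞 K)) ≠ 0 := map_ne_zero_of_ne_zero hu
  have hval : ∀ Q : Ideal (𝓞 K), Q.IsPrime → Q ≠ ⊥ →
      idealVal Q ((P.under (𝓞 F)).map (algebraMap (𝓞 F) (𝓞 K))) = idealVal Q (P ^ 3) := by
    intro Q hQ hQ0
    rw [idealVal_pow]
    by_cases hQP : Q = P
    · subst hQP
      rw [idealVal_self hQ hQ0]
      rcases isTotRam_iff_idealVal h3 hσ hQ hQ0 with ⟨-, h⟩ | ⟨h, -⟩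
      · exact h
      · exact absurd hP.2.2 h
    · rw [idealVal_eq_zero_of_ne hP.1 hP.2.1 hQP]
      by_contra h
      obtain ⟨τ, hτ⟩ := exists_smul_eq_of_dvd_map hP.1 hP.2.1 hQ
        ((idealVal_ne_zero_iff hQ hQ0 hm).1 h)
      rw [hP.2.2.smul_eq h3 hσ] at hτ
      exact hQP hτ.symm
  exact dvd_antisymm (dvd_of_forall_idealVal_le hm (pow_ne_zero 3 hP.2.1)
    fun Q h1 h2 => (hval Q h1 h2).le) (dvd_of_forall_idealVal_le (pow_ne_zero 3 hP.2.1) hm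
    fun Q h1 h2 => (hval Q h1 h2).ge)

lemma idealVal_cubicNorm (h3 : Module.finrank F K = 3) {σ : Gal(K/F)} (hσ : σ ≠ 1)
    {P : Ideal (𝓞 K)} (hP : P ∈ totRamPrimes σ) {a : 𝓞 K} (ha : a ≠ 0) :
    idealVal P (Ideal.span {cubicNorm σ a}) = 3 * idealVal P (Ideal.span {a}) := by
  have h1 : ∀ b : 𝓞 K, b ≠ 0 → idealVal P (Ideal.span {σ • b}) = idealVal P (Ideal.span {b}) := by
    intro b hb
    have := idealVal_smul σ hP.1 hP.2.1 (span_singleton_ne_zero hb)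
    rwa [hP.2.2.smul_eq h3 hσ, smul_span_singleton] at this
  have ha1 : σ • a ≠ 0 := by rwa [Ne, smul_eq_zero_iff_eq]
  have ha2 : σ • σ • a ≠ 0 := by rwa [Ne, smul_eq_zero_iff_eq]
  rw [cubicNorm, ← Ideal.span_singleton_mul_span_singleton,
    ← Ideal.span_singleton_mul_span_singleton,
    idealVal_mul P (mul_ne_zero (span_singleton_ne_zero ha) (span_singleton_ne_zero ha1))
      (span_singleton_ne_zero ha2),
    idealVal_mul P (span_singleton_ne_zero ha) (span_singleton_ne_zero ha1), h1 _ ha1, h1 _ ha]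
  ring

lemma cubicNorm_sub_pow_mem {σ : Gal(K/F)} {P : Ideal (𝓞 K)} (hr : IsTotRam σ P) (a : 𝓞 K) :
    cubicNorm σ a - a ^ 3 ∈ P := by
  have h1 := hr a
  have h2 := hr (σ • a)
  have : cubicNorm σ a - a ^ 3 = (a * σ • a) * (σ • σ • a - σ • a) +
      (a * σ • a + a * a) * (σ • a - a) := by
    rw [cubicNorm]; ring
  rw [this]
  exact P.add_mem (P.mul_mem_left _ h2) (P.mul_mem_left _ h1)

lemma exists_cubicNorm_eq_of_norm_eq (h3 : Module.finrank F K = 3) {σ : Gal(K/F)} (hσ : σ ≠ 1)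
    {u : 𝓞 F} {x : K} (hx : Algebra.norm F x = (u : F)) :
    ∃ a b : 𝓞 K, b ≠ 0 ∧ cubicNorm σ a = algebraMap (𝓞 F) (𝓞 K) u * cubicNorm σ b := by
  obtain ⟨a, b, hb, rfl⟩ := IsFractionRing.div_surjective (A := 𝓞 K) x
  have hb0 : b ≠ 0 := nonZeroDivisors.ne_zero hb
  refine ⟨a, b, hb0, ?_⟩
  apply RingOfIntegers.ext
  have h1 := algebraMap_norm_eq h3 hσ (algebraMap (𝓞 K) K a / algebraMap (𝓞 K) K b)
  rw [hx, map_div₀, map_div₀, div_mul_div_comm, div_mul_div_comm, eq_div_iff] at h1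
  · exact h1.symm
  · have : algebraMap (𝓞 K) K b ≠ 0 := by simpa using hb0
    simp [this]

lemma mod_nine_of_norm_eq [IsCyclotomicExtension {3} ℚ F] (h3 : Module.finrank F K = 3)
    {σ : Gal(K/F)} (hσ : σ ≠ 1) (hζ : ζ ^ 2 + ζ + 1 = 0) {p : ℕ} (hp : p.Prime) (hp2 : p % 3 = 2)
    {P : Ideal (𝓞 K)} (hP : P ∈ totRamPrimes σ) (hpP : (p : 𝓞 K) ∈ P)
    {x : K} (hx : Algebra.norm F x = (ζ : F)) : p % 9 = 8 := by
  have hpp := prime_natCast_of_mod_three (F := F) hp hp2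
  have hspan : Ideal.span {(p : 𝓞 K)} = P ^ 3 := by
    rw [← isTotRam_map_under h3 hσ hP, under_eq_span hP.1 hpp (by simpa using hpP), Ideal.map_span,
      Set.image_singleton, map_natCast]
  have hP1 : P ≠ ⊤ := hP.1.ne_top
  have hp0 : (p : 𝓞 K) ≠ 0 := by exact_mod_cast hp.ne_zero
  obtain ⟨a, b, hb, hab⟩ := exists_cubicNorm_eq_of_norm_eq h3 hσ hx
  have hζu : IsUnit ζ := IsUnit.of_mul_eq_one (ζ ^ 2) (by
    rw [← pow_succ']; exact pow_three_eq_one_of_sq_add hζ)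
  have hζu' := hζu.map (algebraMap (𝓞 F) (𝓞 K))
  have ha : a ≠ 0 := by
    rintro rfl
    have := mul_ne_zero hζu'.ne_zero (cubicNorm_ne_zero σ hb)
    rw [← hab] at this
    simp [cubicNorm] at this
  have hv : idealVal P (Ideal.span {a}) = idealVal P (Ideal.span {b}) := by
    have := idealVal_cubicNorm h3 hσ hP ha
    rw [hab, Ideal.span_singleton_mul_left_unit hζu', idealVal_cubicNorm h3 hσ hP hb] at this
    omega
  obtain ⟨t, ht, ht'⟩ := Ideal.exists_mem_pow_notMem_pow_succ P hP.2.1 hP1 1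
  rw [pow_one] at ht
  have ht0 : t ≠ 0 := by rintro rfl; exact ht' (zero_mem _)
  have htv : idealVal P (Ideal.span {t}) = 1 := by
    obtain ⟨J, hJ⟩ := Ideal.dvd_iff_le.2 ((Ideal.span_singleton_le_iff_mem _).2 ht)
    have hJ0 : J ≠ 0 := by
      rintro rfl
      exact span_singleton_ne_zero ht0 (by rw [hJ, mul_zero])
    rw [hJ, idealVal_mul P hP.2.1 hJ0, idealVal_self hP.1 hP.2.1]
    by_contra h
    have : idealVal P J ≠ 0 := by omega
    obtain ⟨J', rfl⟩ := (idealVal_ne_zero_iff hP.1 hP.2.1 hJ0).1 this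
    apply ht'
    rw [← Ideal.span_singleton_le_iff_mem, hJ, ← mul_assoc, ← pow_two]
    change P ^ 2 * J' ≤ P ^ 2
    exact Ideal.le_of_dvd (dvd_mul_right (P ^ 2) J')
  set n := idealVal P (Ideal.span {a}) with hn
  have hred : ∀ c : 𝓞 K, c ≠ 0 → idealVal P (Ideal.span {c}) = n →
      ∃ c' : 𝓞 K, c * t ^ (2 * n) = (p : 𝓞 K) ^ n * c' ∧ c' ∉ P := by
    intro c hc hcn
    have h0 : c * t ^ (2 * n) ≠ 0 := mul_ne_zero hc (pow_ne_zero _ ht0)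
    have hv : idealVal P (Ideal.span {c * t ^ (2 * n)}) = 3 * n := by
      rw [← Ideal.span_singleton_mul_span_singleton, idealVal_mul P (span_singleton_ne_zero hc)
        (span_singleton_ne_zero (pow_ne_zero _ ht0)), ← Ideal.span_singleton_pow, idealVal_pow,
        htv, hcn]
      ring
    have hd : (p : 𝓞 K) ^ n ∣ c * t ^ (2 * n) := by
      rw [← Ideal.span_singleton_le_span_singleton, ← Ideal.dvd_iff_le, ← Ideal.span_singleton_pow,
        hspan]
      apply dvd_of_forall_idealVal_le (pow_ne_zero _ (pow_ne_zero _ hP.2.1))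
        (span_singleton_ne_zero h0)
      intro Q hQ hQ0
      rw [idealVal_pow, idealVal_pow]
      by_cases hQP : Q = P
      · rw [hQP, hv, idealVal_self hP.1 hP.2.1]; omega
      · rw [idealVal_eq_zero_of_ne hP.1 hP.2.1 hQP]; omega
    obtain ⟨c', hc'⟩ := hd
    refine ⟨c', hc', fun h => ?_⟩
    have hc0 : c' ≠ 0 := by
      rintro rfl
      exact h0 (by rw [hc', mul_zero])
    have h2 := (idealVal_ne_zero_iff hP.1 hP.2.1 (span_singleton_ne_zero hc0)).2
      (Ideal.dvd_iff_le.2 ((Ideal.span_singleton_le_iff_mem _).2 h))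
    rw [hc', ← Ideal.span_singleton_mul_span_singleton, idealVal_mul P
      (span_singleton_ne_zero (pow_ne_zero _ hp0)) (span_singleton_ne_zero hc0),
      ← Ideal.span_singleton_pow, idealVal_pow, hspan, idealVal_pow, idealVal_self hP.1 hP.2.1] at hv
    omega
  obtain ⟨a', ha', haP⟩ := hred a ha rfl
  obtain ⟨b', hb', hbP⟩ := hred b hb hv.symm
  have hab' : cubicNorm σ a' = algebraMap (𝓞 F) (𝓞 K) ζ * cubicNorm σ b' := by
    apply mul_left_cancel₀ (cubicNorm_ne_zero σ (pow_ne_zero n hp0))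
    rw [← cubicNorm_mul, ← ha', cubicNorm_mul, hab, mul_left_comm, ← cubicNorm_mul, ← hb',
      cubicNorm_mul σ b, mul_assoc]
  have hPm : P.IsMaximal := hP.1.isMaximal hP.2.1
  let _ : Field (𝓞 K ⧸ P) := Ideal.Quotient.field P
  set π := Ideal.Quotient.mk P with hπ
  have hred3 : π a' ^ 3 = π (algebraMap (𝓞 F) (𝓞 K) ζ) * π b' ^ 3 := by
    have h1 := cubicNorm_sub_pow_mem hP.2.2 a'
    have h2 := cubicNorm_sub_pow_mem hP.2.2 b'
    rw [← Ideal.Quotient.eq_zero_iff_mem, map_sub, sub_eq_zero, map_pow] at h1 h2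
    rw [← h1, ← h2, hab', map_mul]
  have hb0 : π b' ≠ 0 := by rwa [Ne, Ideal.Quotient.eq_zero_iff_mem]
  have ha0 : π a' ≠ 0 := by rwa [Ne, Ideal.Quotient.eq_zero_iff_mem]
  set z := π (algebraMap (𝓞 F) (𝓞 K) ζ) with hz
  have hz2 : z ^ 2 + z + 1 = 0 := by
    have := congrArg (fun x => π (algebraMap (𝓞 F) (𝓞 K) x)) hζ
    simpa using this
  have h3p : (3 : 𝓞 K ⧸ P) ≠ 0 := by
    intro h
    have h' : ((3 : ℕ) : 𝓞 K) ∈ P := by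
      rw [← Ideal.Quotient.eq_zero_iff_mem, map_natCast]
      exact_mod_cast h
    rw [natCast_mem_iff_dvd hP.1 hp hpP, Nat.prime_dvd_prime_iff_eq hp Nat.prime_three] at h'
    omega
  have hz1 : z ≠ 1 := by
    intro h
    rw [h] at hz2
    apply h3p
    linear_combination hz2
  have hz3 : z ^ 3 = 1 := by linear_combination (z - 1) * hz2
  set y := π a' / π b' with hy
  have hy3 : y ^ 3 = z := by
    rw [hy, div_pow, hred3, mul_div_assoc, div_self (pow_ne_zero 3 hb0), mul_one]
  have hy0 : y ≠ 0 := div_ne_zero ha0 hb0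
  have hord : orderOf (Units.mk0 y hy0) = 3 ^ 2 := by
    have : Fact (Nat.Prime 3) := ⟨Nat.prime_three⟩
    apply orderOf_eq_prime_pow
    · intro h
      apply hz1
      rw [← hy3]
      simpa using congrArg Units.val h
    · ext
      rw [Units.val_pow_eq_pow_val, Units.val_mk0, Units.val_one, show 3 ^ (1 + 1) = 3 * 3 by norm_num,
        pow_mul, hy3, hz3]
  have hcard : Nat.card (𝓞 K ⧸ P) = p ^ 2 := by
    have h1 := congrArg Ideal.absNorm hspan
    rw [map_pow, Ideal.absNorm_span_singleton] at h1
    have h2 : (p : 𝓞 K) = algebraMap ℤ (𝓞 K) p := by simp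
    have h6 : Module.finrank ℚ K = 2 * 3 := by
      rw [← Module.finrank_mul_finrank ℚ F K, finrank_cyclotomic_three, h3]
    rw [h2, Algebra.norm_algebraMap, Int.natAbs_pow, Int.natAbs_natCast, RingOfIntegers.rank, h6,
      pow_mul] at h1
    exact (Nat.pow_left_injective three_ne_zero h1).symm
  have : Finite (𝓞 K ⧸ P) := Nat.finite_of_card_ne_zero (by rw [hcard]; exact pow_ne_zero 2 hp.ne_zero)
  have : Fintype (𝓞 K ⧸ P) := Fintype.ofFinite _
  have hdvd := orderOf_dvd_natCard (Units.mk0 y hy0)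
  rw [hord, Nat.card_units, hcard] at hdvd
  have hmod : (p ^ 2) % 9 = 1 := by
    have h1 : 1 ≤ p ^ 2 := Nat.one_le_pow _ _ hp.pos
    omega
  have h9 : p % 9 = 2 ∨ p % 9 = 5 ∨ p % 9 = 8 := by omega
  rw [Nat.pow_mod] at hmod
  rcases h9 with h | h | h
  · rw [h] at hmod; norm_num at hmod
  · rw [h] at hmod; norm_num at hmod
  · exact h

lemma isPrincipal_of_ambClasses_eq_bot (h3 : Module.finrank F K = 3) {σ : Gal(K/F)}
    (h : ambClasses h3 σ = ⊥) {I : Ideal (𝓞 K)} (hI : I ≠ 0) (hI3 : (I ^ 3).IsPrincipal)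
    (hD : (σ • I * I ^ 2).IsPrincipal) : I.IsPrincipal := by
  have hI' : I ∈ (Ideal (𝓞 K))⁰ := mem_nonZeroDivisors_of_ne_zero hI
  rw [← ClassGroup.mk0_eq_one_iff hI', ← Subgroup.mem_bot, ← h, mem_ambClasses_iff]
  have h1 := (ClassGroup.mk0_eq_one_iff (pow_mem hI' 3)).2 hI3
  have h2 := (ClassGroup.mk0_eq_one_iff (mul_mem (mem_nonZeroDivisors_smul σ ⟨I, hI'⟩)
    (pow_mem hI' 2))).2 hD
  set c := ClassGroup.mk0 ⟨I, hI'⟩ with hc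
  have h1' : c ^ 3 = 1 := by rw [hc, ← map_pow]; exact h1
  have h2' : ClassGroup.mk0 ⟨σ • I, mem_nonZeroDivisors_smul σ ⟨I, hI'⟩⟩ * c ^ 2 = 1 := by
    rw [hc, ← map_pow, ← map_mul]; exact h2
  have h3' : c * c ^ 2 = 1 := by rw [← pow_succ', h1']
  exact mul_right_cancel (h2'.trans h3'.symm)

lemma isPrincipal_smul {σ : Gal(K/F)} {I : Ideal (𝓞 K)} (h : I.IsPrincipal) :
    (σ • I).IsPrincipal := by
  obtain ⟨a, rfl⟩ := h.principal
  exact ⟨⟨σ • a, smul_span_singleton σ a⟩⟩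

lemma isPrincipal_mul {I J : Ideal (𝓞 K)} (hI : I.IsPrincipal) (hJ : J.IsPrincipal) :
    (I * J).IsPrincipal := by
  obtain ⟨a, rfl⟩ := hI.principal
  obtain ⟨b, rfl⟩ := hJ.principal
  exact ⟨⟨a * b, Ideal.span_singleton_mul_span_singleton a b⟩⟩

lemma isPrincipal_pow {I : Ideal (𝓞 K)} (hI : I.IsPrincipal) (n : ℕ) :
    (I ^ n).IsPrincipal := by
  obtain ⟨a, rfl⟩ := hI.principal
  exact ⟨⟨a ^ n, Ideal.span_singleton_pow a n⟩⟩

/-- If there are no nontrivial ambiguous classes, the class group has no `3`-torsion. -/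
lemma isPrincipal_of_isPrincipal_pow_three (h3 : Module.finrank F K = 3) {σ : Gal(K/F)}
    (h : ambClasses h3 σ = ⊥) {I : Ideal (𝓞 K)} (hI : I ≠ 0) (hI3 : (I ^ 3).IsPrincipal) :
    I.IsPrincipal := by
  have hs : ∀ {J : Ideal (𝓞 K)}, J ≠ 0 → σ • J ≠ 0 := fun hJ => by rwa [Ne, smul_eq_zero_iff_eq]
  have hD0 : ∀ {J : Ideal (𝓞 K)}, J ≠ 0 → σ • J * J ^ 2 ≠ 0 :=
    fun hJ => mul_ne_zero (hs hJ) (pow_ne_zero 2 hJ)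
  have hD3 : ∀ {J : Ideal (𝓞 K)}, (J ^ 3).IsPrincipal → ((σ • J * J ^ 2) ^ 3).IsPrincipal := by
    intro J hJ
    rw [mul_pow, ← smul_pow', ← pow_mul, mul_comm 2 3, pow_mul]
    exact isPrincipal_mul (isPrincipal_smul hJ) (isPrincipal_pow hJ 2)
  apply isPrincipal_of_ambClasses_eq_bot h3 h hI hI3
  apply isPrincipal_of_ambClasses_eq_bot h3 h (hD0 hI) (hD3 hI3)
  apply isPrincipal_of_ambClasses_eq_bot h3 h (hD0 (hD0 hI)) (hD3 (hD3 hI3))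
  have h1 := isPrincipal_smul (σ := σ) hI3
  have h2 := isPrincipal_smul (σ := σ) h1
  have key := isPrincipal_mul (isPrincipal_mul (isPrincipal_pow hI3 3) (isPrincipal_pow h1 4))
    (isPrincipal_pow h2 2)
  convert key using 1
  simp only [smul_mul', smul_pow', smul_smul_smul_eq h3]
  ring

end Inertia

section ResidueField

open scoped Pointwise

variable {F K : Type} [Field F] [NumberField F] [Field K] [NumberField K] [Algebra F K]
  [IsGalois F K]

lemma IsCyclic.exists_pow_three_eq {G : Type*} [Group G] [IsCyclic G] [Finite G]
    (h9 : 9 ∣ Nat.card G) {z : G} (hz : z ^ 3 = 1) : ∃ y : G, y ^ 3 = z := by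
  obtain ⟨g, hg⟩ := IsCyclic.exists_generator (α := G)
  obtain ⟨k, hk⟩ := (isOfFinOrder_of_finite g).mem_powers_iff_mem_zpowers.2 (hg z)
  simp only at hk
  rw [← hk, ← pow_mul, ← orderOf_dvd_iff_pow_eq_one, orderOf_eq_card_of_forall_mem_zpowers hg] at hz
  have : 9 ∣ k * 3 := h9.trans hz
  refine ⟨g ^ (k / 3), ?_⟩
  rw [← hk, ← pow_mul]
  congr 1
  omega

variable {ζ : 𝓞 F} {ω : 𝓞 K}

lemma exists_sub_pow_three_mem [IsCyclotomicExtension {3} ℚ F] (hζ : ζ ^ 2 + ζ + 1 = 0) {q : ℕ}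
    (hq : q.Prime) (hq8 : q % 9 = 8) : ∃ y : 𝓞 F, ζ - y ^ 3 ∈ Ideal.span {(q : 𝓞 F)} := by
  have hpp := prime_natCast_of_mod_three (F := F) hq (by omega)
  have hq0 : (q : 𝓞 F) ≠ 0 := by exact_mod_cast hq.ne_zero
  set P := Ideal.span {(q : 𝓞 F)} with hP
  have hPp : P.IsPrime := (Ideal.span_singleton_prime hq0).2 hpp
  have hPm : P.IsMaximal := hPp.isMaximal (by simpa [hP] using hq0)
  let _ : Field (𝓞 F ⧸ P) := Ideal.Quotient.field P
  have hcard : Nat.card (𝓞 F ⧸ P) = q ^ 2 := by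
    have h2 : (q : 𝓞 F) = algebraMap ℤ (𝓞 F) q := by simp
    change Ideal.absNorm P = _
    rw [hP, Ideal.absNorm_span_singleton, h2, Algebra.norm_algebraMap, Int.natAbs_pow,
      Int.natAbs_natCast, RingOfIntegers.rank, finrank_cyclotomic_three]
  have : Finite (𝓞 F ⧸ P) := Nat.finite_of_card_ne_zero (by rw [hcard]; exact pow_ne_zero 2 hq.ne_zero)
  have h9 : 9 ∣ Nat.card (𝓞 F ⧸ P)ˣ := by
    rw [Nat.card_units, hcard]
    have : (q ^ 2) % 9 = 1 := by rw [Nat.pow_mod, hq8]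
    omega
  have hz3 : Ideal.Quotient.mk P ζ ^ 3 = 1 := by
    rw [← map_pow, pow_three_eq_one_of_sq_add hζ, map_one]
  obtain ⟨y, hy⟩ := IsCyclic.exists_pow_three_eq h9 (z := Units.ofPowEqOne _ 3 hz3 three_ne_zero)
    (Units.pow_ofPowEqOne _ _)
  obtain ⟨x, hx⟩ := Ideal.Quotient.mk_surjective (y : 𝓞 F ⧸ P)
  refine ⟨x, ?_⟩
  rw [← Ideal.Quotient.eq_zero_iff_mem, map_sub, map_pow, hx, sub_eq_zero]
  have := congrArg Units.val hy
  rw [Units.val_pow_eq_pow_val] at this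
  exact this.symm

lemma norm_eq_of_pow_three {τ : Gal(K/F)}
    (hζ : ζ ^ 2 + ζ + 1 = 0) (hω : ω ^ 3 = algebraMap (𝓞 F) (𝓞 K) ζ)
    (hτω : τ • ω = algebraMap (𝓞 F) (𝓞 K) ζ * ω) : cubicNorm τ ω = algebraMap (𝓞 F) (𝓞 K) ζ := by
  have hz3 := congrArg (algebraMap (𝓞 F) (𝓞 K)) (pow_three_eq_one_of_sq_add hζ)
  rw [map_pow, map_one] at hz3
  rw [cubicNorm, hτω, smul_mul', smul_algebraMap_ringOfIntegers, hτω]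
  linear_combination (algebraMap (𝓞 F) (𝓞 K) ζ) ^ 3 * hω + algebraMap (𝓞 F) (𝓞 K) ζ * hz3

lemma sub_one_mem_of_isTotRam (hζ : ζ ^ 2 + ζ + 1 = 0) {τ : Gal(K/F)}
    (hω : ω ^ 3 = algebraMap (𝓞 F) (𝓞 K) ζ)
    (hτω : τ • ω = algebraMap (𝓞 F) (𝓞 K) ζ * ω) {P : Ideal (𝓞 K)} (hP : P.IsPrime)
    (h : τ • ω - ω ∈ P) : algebraMap (𝓞 F) (𝓞 K) (ζ - 1) ∈ P := by
  have h1 : algebraMap (𝓞 F) (𝓞 K) (ζ - 1) * ω ∈ P := by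
    rw [hτω] at h
    convert h using 1
    rw [map_sub, map_one]; ring
  refine (hP.mem_or_mem h1).resolve_right fun h2 => hP.ne_top ?_
  have hz3 := congrArg (algebraMap (𝓞 F) (𝓞 K)) (pow_three_eq_one_of_sq_add hζ)
  rw [map_pow, map_one, ← hω] at hz3
  rw [Ideal.eq_top_iff_one, ← hz3]
  exact P.pow_mem_of_mem (P.pow_mem_of_mem h2 3 (by norm_num)) 3 (by norm_num)

lemma ambClasses_eq_bot [IsCyclotomicExtension {3} ℚ F] [IsPrincipalIdealRing (𝓞 F)]
    (h3 : Module.finrank F K = 3) {τ : Gal(K/F)} (hτ : τ ≠ 1)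
    (hζ : ζ ^ 2 + ζ + 1 = 0) (hζ' : IsPrimitiveRoot (ζ : F) 3)
    (hω : ω ^ 3 = algebraMap (𝓞 F) (𝓞 K) ζ)
    (hτω : τ • ω = algebraMap (𝓞 F) (𝓞 K) ζ * ω) : ambClasses h3 τ = ⊥ := by
  have h1 := card_ambClasses_mul h3 hτ hζ'
  have hx : ∃ x : K, Algebra.norm F x = (ζ : F) := by
    refine ⟨(ω : K), ?_⟩
    apply (algebraMap F K).injective
    rw [algebraMap_norm_eq h3 hτ]
    exact congrArg (algebraMap (𝓞 K) K) (norm_eq_of_pow_three hζ hω hτω)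
  rw [if_pos hx] at h1
  have hle : Nat.card (totRamPrimes τ) ≤ 1 := by
    have : Finite (totRamPrimes τ) := finite_totRamPrimes hτ
    rw [Finite.card_le_one_iff_subsingleton]
    refine ⟨fun P Q => Subtype.ext ?_⟩
    exact eq_of_natCast_mem h3 hτ hζ Nat.prime_three (by norm_num) P.2 Q.2
      (three_mem_of_sub_one_mem hζ (sub_one_mem_of_isTotRam hζ hω hτω P.2.1 (P.2.2.2 ω)))
      (three_mem_of_sub_one_mem hζ (sub_one_mem_of_isTotRam hζ hω hτω Q.2.1 (Q.2.2.2 ω)))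
  have h2 : Nat.card (ambClasses h3 τ) = 1 := by
    interval_cases h : Nat.card (totRamPrimes τ) <;> omega
  exact Subgroup.eq_bot_of_card_eq _ h2

/-- A prime congruent to `-1` modulo `9` splits in `F(∛ζ) / F`. -/
lemma exists_mul_smul_mul_smul_eq [IsCyclotomicExtension {3} ℚ F]
    (h3 : Module.finrank F K = 3) {τ : Gal(K/F)} (hτ : τ ≠ 1)
    (hζ : ζ ^ 2 + ζ + 1 = 0) (hω : ω ^ 3 = algebraMap (𝓞 F) (𝓞 K) ζ)
    (hτω : τ • ω = algebraMap (𝓞 F) (𝓞 K) ζ * ω) {q : ℕ} (hq : q.Prime) (hq8 : q % 9 = 8) :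
    ∃ Q : Ideal (𝓞 K), Q ≠ 0 ∧ Q * τ • Q * τ • τ • Q = Ideal.span {(q : 𝓞 K)} := by
  obtain ⟨Q, hQ, hQ0, hqQ⟩ := exists_prime_mem K hq
  have hs : ∀ {J : Ideal (𝓞 K)}, J ≠ 0 → τ • J ≠ 0 := fun hJ => by rwa [Ne, smul_eq_zero_iff_eq]
  have hq0 : (q : 𝓞 K) ≠ 0 := by exact_mod_cast hq.ne_zero
  refine ⟨Q, hQ0, ?_⟩
  have hlq : algebraMap (𝓞 F) (𝓞 K) (ζ - 1) ∉ Q := by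
    intro h
    have := (natCast_mem_iff_dvd hQ hq hqQ 3).1 (three_mem_of_sub_one_mem hζ h)
    rw [Nat.prime_dvd_prime_iff_eq hq Nat.prime_three] at this
    omega
  obtain ⟨y, hy⟩ := exists_sub_pow_three_mem hζ hq hq8
  set z := algebraMap (𝓞 F) (𝓞 K) ζ with hz
  set Y := algebraMap (𝓞 F) (𝓞 K) y with hY
  have hz2 : z ^ 2 + z + 1 = 0 := by
    have := congrArg (algebraMap (𝓞 F) (𝓞 K)) hζ
    simpa using this
  have hz3 : z ^ 3 = 1 := by linear_combination (z - 1) * hz2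
  have hmem : ω ^ 3 - Y ^ 3 ∈ Q := by
    obtain ⟨c, hc⟩ := Ideal.mem_span_singleton.1 hy
    have := congrArg (algebraMap (𝓞 F) (𝓞 K)) hc
    rw [map_sub, map_pow, map_mul, map_natCast] at this
    rw [hω, this]
    exact Q.mul_mem_right _ hqQ
  have hfac : ω ^ 3 - Y ^ 3 = (ω - Y) * (ω - z * Y) * (ω - z ^ 2 * Y) := by
    linear_combination (Y * ω ^ 2 - Y ^ 2 * ω * z + (z - 1) * Y ^ 3) * hz2
  have hroot : ∃ x : 𝓞 F, ω - algebraMap (𝓞 F) (𝓞 K) x ∈ Q := by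
    rw [hfac] at hmem
    rcases hQ.mem_or_mem hmem with h | h
    · rcases hQ.mem_or_mem h with h | h
      · exact ⟨y, h⟩
      · exact ⟨ζ * y, by rwa [map_mul]⟩
    · exact ⟨ζ ^ 2 * y, by rwa [map_mul, map_pow]⟩
  obtain ⟨x, hx⟩ := hroot
  have hne : τ • Q ≠ Q := by
    intro h
    apply hlq
    have h1 : τ • (ω - algebraMap (𝓞 F) (𝓞 K) x) ∈ τ • Q := Ideal.smul_mem_pointwise_smul _ _ _ hx
    rw [h, smul_sub, smul_algebraMap_ringOfIntegers] at h1
    have h2 := Q.sub_mem h1 hx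
    rw [sub_sub_sub_cancel_right] at h2
    exact sub_one_mem_of_isTotRam hζ hω hτω hQ h2
  have hne2 : τ • τ • Q ≠ Q := by
    intro h
    have := congrArg (τ • ·) h
    simp only [smul_smul_smul_eq h3] at this
    exact hne this.symm
  have hunr : ¬ IsTotRam τ Q := fun h => hne (h.smul_eq h3 hτ τ)
  have hpp := prime_natCast_of_mod_three (F := F) hq (by omega)
  have hmap : Ideal.span {(q : 𝓞 K)} = (Q.under (𝓞 F)).map (algebraMap (𝓞 F) (𝓞 K)) := by
    rw [under_eq_span hQ hpp (by simpa using hqQ), Ideal.map_span, Set.image_singleton, map_natCast]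
  have hm : (Q.under (𝓞 F)).map (algebraMap (𝓞 F) (𝓞 K)) ≠ 0 :=
    map_ne_zero_of_ne_zero (under_ne_bot hQ0)
  have hQ1 : τ • Q ≠ 0 := hs hQ0
  have hQ2 : τ • τ • Q ≠ 0 := hs hQ1
  have hI0 : Q * τ • Q * τ • τ • Q ≠ 0 := mul_ne_zero (mul_ne_zero hQ0 hQ1) hQ2
  have hinv : ∀ ρ : Gal(K/F), ρ • (Q * τ • Q * τ • τ • Q) = Q * τ • Q * τ • τ • Q := by
    have h1 : τ • (Q * τ • Q * τ • τ • Q) = Q * τ • Q * τ • τ • Q := by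
      simp only [smul_mul', smul_smul_smul_eq h3]
      ring
    intro ρ
    rcases eq_one_or_eq_or_eq_sq h3 hτ ρ with rfl | rfl | rfl
    · rw [one_smul]
    · exact h1
    · rw [mul_smul, h1, h1]
  rw [hmap]
  have hval : ∀ R : Ideal (𝓞 K), R.IsPrime → R ≠ ⊥ → idealVal R (Q * τ • Q * τ • τ • Q) =
      idealVal R ((Q.under (𝓞 F)).map (algebraMap (𝓞 F) (𝓞 K))) := by
    intro R hR hR0
    by_cases h : ∃ ρ : Gal(K/F), ρ • Q = R
    · obtain ⟨ρ, rfl⟩ := h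
      have h1 := idealVal_smul ρ hQ hQ0 hI0
      have h2 := idealVal_smul ρ hQ hQ0 hm
      rw [smul_map_algebraMap] at h2
      rw [hinv] at h1
      rw [h1, h2, idealVal_mul Q (mul_ne_zero hQ0 hQ1) hQ2, idealVal_mul Q hQ0 hQ1,
        idealVal_self hQ hQ0, idealVal_eq_zero_of_ne (isPrime_smul_ideal τ hQ) hQ1 hne.symm,
        idealVal_eq_zero_of_ne (isPrime_smul_ideal τ (isPrime_smul_ideal τ hQ)) hQ2 hne2.symm]
      rcases isTotRam_iff_idealVal h3 hτ hQ hQ0 with ⟨h, -⟩ | ⟨-, h⟩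
      · exact absurd h hunr
      · rw [h]
    · push Not at h
      have h1 : idealVal R ((Q.under (𝓞 F)).map (algebraMap (𝓞 F) (𝓞 K))) = 0 := by
        by_contra h0
        obtain ⟨ρ, hρ⟩ := exists_smul_eq_of_dvd_map hQ hQ0 hR
          ((idealVal_ne_zero_iff hR hR0 hm).1 h0)
        exact h ρ hρ
      rw [h1, idealVal_mul R (mul_ne_zero hQ0 hQ1) hQ2, idealVal_mul R hQ0 hQ1,
        idealVal_eq_zero_of_ne hQ hQ0 (fun h' => h 1 (by rw [one_smul, h'])),
        idealVal_eq_zero_of_ne (isPrime_smul_ideal τ hQ) hQ1 (h τ).symm,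
        idealVal_eq_zero_of_ne (isPrime_smul_ideal τ (isPrime_smul_ideal τ hQ)) hQ2
          (fun h' => h (τ * τ) (by rw [mul_smul, h']))]
  exact dvd_antisymm (dvd_of_forall_idealVal_le hI0 hm fun R h1 h2 => (hval R h1 h2).le)
    (dvd_of_forall_idealVal_le hm hI0 fun R h1 h2 => (hval R h1 h2).ge)

lemma exists_coprime_isPrincipal_pow (h3 : Module.finrank F K = 3) {σ : Gal(K/F)}
    (h : ambClasses h3 σ = ⊥) {I : Ideal (𝓞 K)} (hI : I ≠ 0) :
    ∃ m : ℕ, ¬ 3 ∣ m ∧ (I ^ m).IsPrincipal := by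
  have hI' : I ∈ (Ideal (𝓞 K))⁰ := mem_nonZeroDivisors_of_ne_zero hI
  obtain ⟨a, m, hm, hc⟩ := Nat.exists_eq_pow_mul_and_not_dvd
    (Fintype.card_ne_zero (α := ClassGroup (𝓞 K))) 3 (by norm_num)
  refine ⟨m, hm, ?_⟩
  have hp : (I ^ Fintype.card (ClassGroup (𝓞 K))).IsPrincipal := by
    rw [← ClassGroup.mk0_eq_one_iff (pow_mem hI' _)]
    have := pow_card_eq_one (x := ClassGroup.mk0 ⟨I, hI'⟩)
    rwa [← map_pow] at this
  rw [hc] at hp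
  clear hc
  induction a with
  | zero => simpa using hp
  | succ a ih =>
    apply ih
    apply isPrincipal_of_isPrincipal_pow_three h3 h (pow_ne_zero _ hI)
    rw [← pow_mul]
    convert hp using 2
    ring

end ResidueField

section NormGroup

open scoped Pointwise

variable {F K : Type} [Field F] [NumberField F] [Field K] [NumberField K] [Algebra F K]
  [IsGalois F K]

variable (F K) in
/-- The group of norms of an extension of fields. -/
def normGroup : Subgroup Fˣ := (Units.map (Algebra.norm F : K →* F)).range

lemma mem_normGroup_iff {a : Fˣ} : a ∈ normGroup F K ↔ ∃ x : K, Algebra.norm F x = a := by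
  constructor
  · rintro ⟨x, hx⟩
    exact ⟨x, congrArg Units.val hx⟩
  · rintro ⟨x, hx⟩
    have hx0 : x ≠ 0 := by
      rintro rfl
      rw [Algebra.norm_zero] at hx
      exact a.ne_zero hx.symm
    exact ⟨Units.mk0 x hx0, Units.ext hx⟩

lemma Subgroup.mem_of_pow_mem_of_coprime {G : Type*} [CommGroup G] {S : Subgroup G} {a : G}
    {m n : ℕ} (hmn : m.Coprime n) (hm : a ^ m ∈ S) (hn : a ^ n ∈ S) : a ∈ S := by
  rw [← QuotientGroup.eq_one_iff] at hm hn ⊢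
  rw [QuotientGroup.mk_pow] at hm hn
  have h1 := Nat.dvd_gcd (orderOf_dvd_of_pow_eq_one hm) (orderOf_dvd_of_pow_eq_one hn)
  rwa [hmn, Nat.dvd_one, orderOf_eq_one_iff] at h1

variable {ζ : 𝓞 F} {ω : 𝓞 K}

lemma norm_coe_eq (h3 : Module.finrank F K = 3) {τ : Gal(K/F)} (hτ : τ ≠ 1) {x : 𝓞 K} {a : 𝓞 F}
    (h : cubicNorm τ x = algebraMap (𝓞 F) (𝓞 K) a) : Algebra.norm F (x : K) = a := by
  apply (algebraMap F K).injective
  rw [algebraMap_norm_eq h3 hτ]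
  exact congrArg (algebraMap (𝓞 K) K) h

lemma mk0_mem_normGroup_of_mod_nine [IsCyclotomicExtension {3} ℚ F] [IsPrincipalIdealRing (𝓞 F)]
    (h3 : Module.finrank F K = 3) {τ : Gal(K/F)} (hτ : τ ≠ 1)
    (hζ : ζ ^ 2 + ζ + 1 = 0) (hζ' : IsPrimitiveRoot (ζ : F) 3)
    (hω : ω ^ 3 = algebraMap (𝓞 F) (𝓞 K) ζ)
    (hτω : τ • ω = algebraMap (𝓞 F) (𝓞 K) ζ * ω) {q : ℕ} (hq : q.Prime) (hq8 : q % 9 = 8)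
    (hq0 : (q : F) ≠ 0) : Units.mk0 (q : F) hq0 ∈ normGroup F K := by
  obtain ⟨Q, hQ0, hQ⟩ := exists_mul_smul_mul_smul_eq h3 hτ hζ hω hτω hq hq8
  obtain ⟨m, hm, hQm⟩ := exists_coprime_isPrincipal_pow h3
    (ambClasses_eq_bot h3 hτ hζ hζ' hω hτω) hQ0
  obtain ⟨β, hβ⟩ := (Submodule.isPrincipal_iff _).1 hQm
  replace hβ : Q ^ m = Ideal.span {β} := hβ
  have hspan : Ideal.span {cubicNorm τ β} = Ideal.span {(q : 𝓞 K) ^ m} := by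
    rw [← Ideal.span_singleton_pow, ← hQ, mul_pow, mul_pow, ← smul_pow', ← smul_pow', ← smul_pow',
      hβ, smul_span_singleton, smul_span_singleton, Ideal.span_singleton_mul_span_singleton,
      Ideal.span_singleton_mul_span_singleton, cubicNorm]
  obtain ⟨u, hu⟩ := Ideal.span_singleton_eq_span_singleton.1 hspan.symm
  have hqK : (q : 𝓞 K) ^ m ≠ 0 := pow_ne_zero _ (by exact_mod_cast hq.ne_zero)
  have hτu : τ • (u : 𝓞 K) = u := by
    have := smul_cubicNorm h3 τ β
    rw [← hu, smul_mul', smul_pow', ← map_natCast (algebraMap (𝓞 F) (𝓞 K)),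
      smul_algebraMap_ringOfIntegers, map_natCast] at this
    exact mul_left_cancel₀ hqK this
  obtain ⟨v, hv⟩ := exists_algebraMap_eq_of_smul_eq h3 hτ hτu
  have hvu : IsUnit v := by
    have hτu' : τ • ((u⁻¹ : (𝓞 K)ˣ) : 𝓞 K) = ((u⁻¹ : (𝓞 K)ˣ) : 𝓞 K) := by
      have := congrArg (τ • ·) u.mul_inv
      simp only [smul_mul', hτu, smul_one] at this
      exact (Units.inv_eq_of_mul_eq_one_right this).symm
    obtain ⟨w, hw⟩ := exists_algebraMap_eq_of_smul_eq h3 hτ hτu'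
    refine IsUnit.of_mul_eq_one w ?_
    apply FaithfulSMul.algebraMap_injective (𝓞 F) (𝓞 K)
    rw [map_mul, hv, hw, Units.mul_inv, map_one]
  have hv12 : (v ^ 4) ^ 3 = 1 := by
    obtain ⟨v', rfl⟩ := hvu
    have := pow_card_eq_one' (x := v')
    rw [card_units_three] at this
    rw [← pow_mul, show 4 * 3 = 6 * 2 from rfl, pow_mul, ← Units.val_pow_eq_pow_val, this]
    simp
  have hNβ : Algebra.norm F (β : K) = ((q ^ m * v : 𝓞 F) : F) :=
    norm_coe_eq h3 hτ (by rw [← hu, map_mul, map_pow, map_natCast, hv])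
  have hNω : Algebra.norm F (ω : K) = ζ := norm_coe_eq h3 hτ (norm_eq_of_pow_three hζ hω hτω)
  obtain ⟨i, -, hi⟩ := hζ'.eq_pow_of_pow_eq_one (ξ := ((v ^ 4 : 𝓞 F) : F))
    (by rw [← map_pow, hv12, map_one])
  have h1 : Units.mk0 (q : F) hq0 ^ (4 * m) ∈ normGroup F K := by
    rw [mem_normGroup_iff]
    refine ⟨(β : K) ^ 4 * ((ω : K) ^ i) ^ 2, ?_⟩
    have h12 : ((v : F) ^ 4) ^ 3 = 1 := by exact_mod_cast congrArg (algebraMap (𝓞 F) F) hv12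
    rw [map_mul, map_pow, map_pow, map_pow, hNβ, hNω, hi]
    simp only [map_mul, map_pow, map_natCast, Units.val_pow_eq_pow_val, Units.val_mk0]
    linear_combination (q : F) ^ (4 * m) * h12
  have h2 : Units.mk0 (q : F) hq0 ^ 3 ∈ normGroup F K := by
    rw [mem_normGroup_iff]
    refine ⟨algebraMap F K q, ?_⟩
    rw [Algebra.norm_algebraMap, h3]
    simp
  refine Subgroup.mem_of_pow_mem_of_coprime ?_ h1 h2
  rw [Nat.coprime_comm, Nat.Prime.coprime_iff_not_dvd Nat.prime_three]
  omega

lemma mk0_three_mem_normGroup (h3 : Module.finrank F K = 3) {τ : Gal(K/F)} (hτ : τ ≠ 1)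
    (hζ : ζ ^ 2 + ζ + 1 = 0) (hω : ω ^ 3 = algebraMap (𝓞 F) (𝓞 K) ζ)
    (hτω : τ • ω = algebraMap (𝓞 F) (𝓞 K) ζ * ω) (h0 : ((3 : ℕ) : F) ≠ 0) :
    Units.mk0 ((3 : ℕ) : F) h0 ∈ normGroup F K := by
  have hz2 := congrArg (algebraMap (𝓞 F) (𝓞 K)) hζ
  rw [map_add, map_add, map_pow, map_one, map_zero] at hz2
  have h1 : cubicNorm τ (-ω ^ 2 * (1 - ω) ^ 2) = algebraMap (𝓞 F) (𝓞 K) 3 := by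
    rw [three_eq_neg_sq_mul hζ]
    simp only [cubicNorm, smul_mul', smul_neg, smul_sub, smul_pow', smul_one, hτω,
      smul_algebraMap_ringOfIntegers, map_mul, map_neg, map_pow, map_sub, map_one]
    set z := algebraMap (𝓞 F) (𝓞 K) ζ
    have hz3 : z ^ 3 = 1 := by linear_combination (z - 1) * hz2
    have h2 : ω * (z * ω) * (z * (z * ω)) = z := by
      linear_combination z ^ 3 * hω + z * hz3
    have h3' : (1 - ω) * (1 - z * ω) * (1 - z * (z * ω)) = 1 - z := by
      linear_combination (-ω + z * ω ^ 2) * hz2 - z ^ 3 * hω - z * hz3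
    calc _ = -(ω * (z * ω) * (z * (z * ω))) ^ 2 *
          ((1 - ω) * (1 - z * ω) * (1 - z * (z * ω))) ^ 2 := by ring
      _ = _ := by rw [h2, h3']; ring
  rw [mem_normGroup_iff]
  refine ⟨_, (norm_coe_eq h3 hτ h1).trans ?_⟩
  rw [Units.val_mk0, Nat.cast_ofNat]
  exact map_ofNat (algebraMap (𝓞 F) F) 3

/-- A positive integer all of whose prime factors are `3` or `-1` modulo `9` is a norm from
`F(∛ζ)`. -/
lemma exists_norm_eq_natCast [IsCyclotomicExtension {3} ℚ F] [IsPrincipalIdealRing (𝓞 F)]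
    (h3 : Module.finrank F K = 3) {τ : Gal(K/F)} (hτ : τ ≠ 1)
    (hζ : ζ ^ 2 + ζ + 1 = 0) (hζ' : IsPrimitiveRoot (ζ : F) 3)
    (hω : ω ^ 3 = algebraMap (𝓞 F) (𝓞 K) ζ)
    (hτω : τ • ω = algebraMap (𝓞 F) (𝓞 K) ζ * ω) {d : ℕ} (hd : d ≠ 0)
    (h : ∀ p, p.Prime → p ∣ d → p = 3 ∨ p % 9 = 8) : ∃ x : K, Algebra.norm F x = d := by
  induction d using Nat.recOnMul with
  | zero => exact absurd rfl hd
  | one => exact ⟨1, by simp⟩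
  | prime p hp =>
    have h0 : (p : F) ≠ 0 := by exact_mod_cast hd
    rcases h p hp dvd_rfl with rfl | h8
    · exact mem_normGroup_iff.1 (mk0_three_mem_normGroup h3 hτ hζ hω hτω h0)
    · exact mem_normGroup_iff.1 (mk0_mem_normGroup_of_mod_nine h3 hτ hζ hζ' hω hτω hp h8 h0)
  | mul a b iha ihb =>
    obtain ⟨x, hx⟩ := iha (left_ne_zero_of_mul hd) fun p hp hpa => h p hp (hpa.mul_right b)
    obtain ⟨y, hy⟩ := ihb (right_ne_zero_of_mul hd) fun p hp hpb => h p hp (hpb.mul_left a)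
    exact ⟨x * y, by rw [map_mul, hx, hy, Nat.cast_mul]⟩

end NormGroup

section NormCriterion

open scoped Pointwise

variable {F K : Type} [Field F] [NumberField F] [Field K] [NumberField K] [Algebra F K]
  [IsGalois F K]

lemma natDegree_minpoly_eq_three (h3 : Module.finrank F K = 3) {σ : Gal(K/F)} {θ : K}
    (h : σ θ ≠ θ) : (minpoly F θ).natDegree = 3 := by
  have hdvd : (minpoly F θ).natDegree ∣ 3 := h3 ▸ minpoly.degree_dvd (IsIntegral.of_finite F θ)
  rcases (Nat.dvd_prime Nat.prime_three).1 hdvd with h1 | h1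
  · rw [minpoly.natDegree_eq_one_iff] at h1
    obtain ⟨x, rfl⟩ := h1
    exact absurd (σ.commutes x) h
  · exact h1

lemma adjoin_eq_top_of_ne (h3 : Module.finrank F K = 3) {σ : Gal(K/F)} {θ : K}
    (h : σ θ ≠ θ) : Algebra.adjoin F {θ} = ⊤ := by
  have hIntegral := IsIntegral.of_finite F θ
  rw [← IntermediateField.adjoin_simple_toSubalgebra_of_isAlgebraic hIntegral.isAlgebraic,
    ← IntermediateField.top_toSubalgebra]
  congr 1
  apply IntermediateField.eq_of_le_of_finrank_eq le_top
  rw [IntermediateField.adjoin.finrank hIntegral, natDegree_minpoly_eq_three h3 h,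
    IntermediateField.finrank_top', h3]

/-- The symmetry of the cubic norm residue symbol: if `d` is a norm from `F(∛ζ)`, then `ζ` is
a norm from `F(∛d)`. -/
lemma exists_norm_eq_of_norm_eq {M : Type} [Field M] [NumberField M] [Algebra F M] [IsGalois F M]
    (hK : Module.finrank F K = 3) (hM : Module.finrank F M = 3) {σ : Gal(K/F)} {τ : Gal(M/F)}
    {ζ d : F} (hζ : ζ ^ 3 = 1) (hζ1 : ζ ≠ 1) (hd : d ≠ 0) {θ : K} {ω : M}
    (hθ : θ ^ 3 = algebraMap F K d) (hσ : σ θ = algebraMap F K ζ * θ)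
    (hω : ω ^ 3 = algebraMap F M ζ) (hτ : τ ω = algebraMap F M ζ * ω)
    (h : ∃ β : M, Algebra.norm F β = d) : ∃ a : K, Algebra.norm F a = ζ := by
  obtain ⟨β, hβ⟩ := h
  have hθ0 : θ ≠ 0 := by
    rintro rfl
    rw [zero_pow three_ne_zero, eq_comm, map_eq_zero] at hθ
    exact hd hθ
  have hω0 : ω ≠ 0 := by
    rintro rfl
    rw [zero_pow three_ne_zero, eq_comm, map_eq_zero] at hω
    rw [hω, zero_pow three_ne_zero] at hζ
    exact zero_ne_one hζ
  have hσθ : σ θ ≠ θ := by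
    rw [hσ]
    intro h
    rw [mul_eq_right₀ hθ0, map_eq_one_iff _ (algebraMap F K).injective] at h
    exact hζ1 h
  have hσ1 : σ ≠ 1 := by rintro rfl; exact hσθ rfl
  have hτ1 : τ ≠ 1 := by
    rintro rfl
    have h : ω = algebraMap F M ζ * ω := hτ
    rw [eq_comm, mul_eq_right₀ hω0, map_eq_one_iff _ (algebraMap F M).injective] at h
    exact hζ1 h
  have hσ3 : ∀ x, σ (σ (σ x)) = x := fun x =>
    DFunLike.congr_fun (pow_three_eq_one_of_finrank_eq_three hK σ) x
  have hτ3 : ∀ x, τ (τ (τ x)) = x := fun x =>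
    DFunLike.congr_fun (pow_three_eq_one_of_finrank_eq_three hM τ) x
  have hNβ := algebraMap_norm_eq hM hτ1 β
  rw [hβ] at hNβ
  obtain ⟨y, hy⟩ : ∃ y : Module.End F M, ∀ m, y m = β * τ m :=
    ⟨LinearMap.mulLeft F β * τ.toLinearMap, fun _ => rfl⟩
  obtain ⟨R, hR⟩ : ∃ R : Module.End F M, ∀ m, R m = ω * m := ⟨LinearMap.mulLeft F ω, fun _ => rfl⟩
  have htop := adjoin_eq_top_of_ne hK hσθ
  have hmin : minpoly F θ = Polynomial.X ^ 3 - Polynomial.C d := by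
    have hIntegral := IsIntegral.of_finite F θ
    have hmon := Polynomial.monic_X_pow_sub_C d three_ne_zero
    refine (Polynomial.eq_of_monic_of_dvd_of_natDegree_le (minpoly.monic hIntegral) hmon
      (minpoly.dvd F θ ?_) ?_).symm
    · simp [hθ]
    · rw [natDegree_minpoly_eq_three hK hσθ, Polynomial.natDegree_X_pow_sub_C]
  let pb := PowerBasis.ofAdjoinEqTop (IsIntegral.of_finite F θ) htop
  have hgen : pb.gen = θ := PowerBasis.ofAdjoinEqTop_gen _ _
  have hy3 : y ^ 3 = algebraMap F (Module.End F M) d := by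
    ext m
    rw [pow_three, Module.End.mul_apply, Module.End.mul_apply, Module.algebraMap_end_apply,
      hy, hy, hy, map_mul, map_mul, map_mul, hτ3, Algebra.smul_def, hNβ]
    ring
  have hroot : Polynomial.aeval y (minpoly F pb.gen) = 0 := by
    rw [hgen, hmin]
    simp [hy3]
  let ψ : K →ₐ[F] Module.End F M := pb.lift y hroot
  have hψθ : ψ θ = y := by
    have := pb.lift_gen y hroot
    rwa [hgen] at this
  let ev : K →ₗ[F] M := (LinearMap.applyₗ (1 : M)).comp ψ.toLinearMap
  have hev : ∀ a, ev a = ψ a 1 := fun _ => rfl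
  have hinj : Function.Injective ev := by
    rw [injective_iff_map_eq_zero]
    intro a ha
    by_contra ha0
    have h1 : ψ (a⁻¹ * a) 1 = 1 := by rw [inv_mul_cancel₀ ha0, map_one ψ, Module.End.one_apply]
    rw [map_mul, Module.End.mul_apply, ← hev a, ha, map_zero] at h1
    exact zero_ne_one h1
  obtain ⟨a, ha⟩ := (LinearMap.injective_iff_surjective_of_finrank_eq_finrank
    (hK.trans hM.symm)).1 hinj ω
  have hcomm : ∀ c m, R (ψ c m) = ψ (σ (σ c)) (R m) := by
    intro c
    have hc : c ∈ Algebra.adjoin F {θ} := htop ▸ Algebra.mem_top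
    induction hc using Algebra.adjoin_induction with
    | mem x hx =>
      intro m
      have hζM : algebraMap F M ζ ^ 3 = 1 := by rw [← map_pow, hζ, map_one]
      rw [Set.mem_singleton_iff.1 hx, hσ, map_mul, hσ, AlgEquiv.commutes, ← mul_assoc, map_mul ψ,
        map_mul ψ, AlgHom.commutes, hψθ, Module.End.mul_apply, Module.End.mul_apply,
        Module.algebraMap_end_apply, Module.algebraMap_end_apply, hR, hR,
        hy, hy, map_mul, hτ, Algebra.smul_def, Algebra.smul_def]
      linear_combination (-ω * β * τ m) * hζM
    | algebraMap r =>
      intro m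
      rw [AlgEquiv.commutes, AlgEquiv.commutes, AlgHom.commutes, Module.algebraMap_end_apply,
        Module.algebraMap_end_apply, map_smul]
    | add x y _ _ hx hy =>
      intro m
      simp only [map_add, LinearMap.add_apply, hx, hy]
    | mul x y _ _ hx hy =>
      intro m
      simp only [map_mul, Module.End.mul_apply, hx, hy]
  have hR1 : R 1 = ψ a 1 := by rw [hR, mul_one, ← ha, hev]
  have hR3 : R (R (R 1)) = ψ (algebraMap F K (Algebra.norm F a)) 1 := by
    rw [hR1, hcomm, hcomm, hR1, hcomm, hR1, algebraMap_norm_eq hK hσ1, hσ3,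
      ← Module.End.mul_apply, ← Module.End.mul_apply, ← map_mul, ← map_mul]
    congr 2
    ring
  refine ⟨a, (algebraMap F M).injective ?_⟩
  rw [AlgHom.commutes, Module.algebraMap_end_apply, Algebra.smul_def, mul_one, hR, hR, hR] at hR3
  rw [← hR3, ← hω]
  ring

end NormCriterion

section ClassCount

open scoped Pointwise

variable {F K : Type} [Field F] [NumberField F] [Field K] [NumberField K] [Algebra F K]
  [IsGalois F K]

lemma sq_add_add_one_eq_zero {R : Type*} [CommRing R] [IsDomain R] {z : R}
    (hz : IsPrimitiveRoot z 3) : z ^ 2 + z + 1 = 0 := by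
  have h1 : z - 1 ≠ 0 := sub_ne_zero.2 (hz.ne_one (by norm_num))
  apply mul_left_cancel₀ h1
  linear_combination hz.pow_eq_one

lemma pow_three_ne_of_isPrimitiveRoot [IsCyclotomicExtension {3} ℚ F] {z : F}
    (hz : IsPrimitiveRoot z 3) (b : F) : b ^ 3 ≠ z := by
  intro hb
  have h9 : b ^ 9 = 1 := by rw [show 9 = 3 * 3 from rfl, pow_mul, hb, hz.pow_eq_one]
  have hIntegral : IsIntegral ℤ b := IsIntegral.of_pow (n := 9) (by norm_num) (h9 ▸ isIntegral_one)
  let c : 𝓞 F := ⟨b, hIntegral⟩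
  have hc9 : c ^ 9 = 1 := RingOfIntegers.ext h9
  have h6 := pow_card_eq_one' (x := Units.ofPowEqOne c 9 hc9 (by norm_num))
  rw [card_units_three] at h6
  have h6' : b ^ 6 = 1 := by
    have := congrArg Units.val h6
    rw [Units.val_pow_eq_pow_val, Units.val_ofPowEqOne] at this
    exact congrArg (algebraMap (𝓞 F) F) this
  apply hz.pow_ne_one_of_pos_of_lt (l := 2) (by norm_num) (by norm_num)
  rw [← hb, ← pow_mul]
  exact h6'

open Polynomial in
/-- The Kummer extension `F(∛z)` of `F`. -/
lemma exists_kummer_extension {F : Type} [Field F] {z : F} (hz : IsPrimitiveRoot z 3)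
    (h : ∀ b : F, b ^ 3 ≠ z) : ∃ (M : Type) (_ : Field M) (_ : Algebra F M),
      FiniteDimensional F M ∧ IsGalois F M ∧ Module.finrank F M = 3 ∧
      ∃ (ω : M) (τ : Gal(M/F)), ω ^ 3 = algebraMap F M z ∧ τ ω = algebraMap F M z * ω := by
  have H : Irreducible (X ^ 3 - C z) := X_pow_sub_C_irreducible_of_prime Nat.prime_three h
  have := Fact.mk H
  have hζ : (primitiveRoots 3 F).Nonempty := ⟨z, (mem_primitiveRoots three_pos).2 hz⟩
  have := isSplittingField_AdjoinRoot_X_pow_sub_C hζ H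
  refine ⟨AdjoinRoot (X ^ 3 - C z), inferInstance, inferInstance,
    (monic_X_pow_sub_C z three_ne_zero).finite_adjoinRoot,
    isGalois_of_isSplittingField_X_pow_sub_C hζ H _,
    finrank_of_isSplittingField_X_pow_sub_C hζ H _, AdjoinRoot.root _,
    autAdjoinRootXPowSubC 3 z ⟨hz.isUnit (by norm_num) |>.unit, ?_⟩, ?_, ?_⟩
  · rw [mem_rootsOfUnity']
    exact hz.pow_eq_one
  · exact root_X_pow_sub_C_pow 3 z
  · rw [autAdjoinRootXPowSubC_root, Algebra.smul_def]
    rfl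

variable {ζ : 𝓞 F} {θ : 𝓞 K}

lemma exists_norm_eq_of_primes [IsCyclotomicExtension {3} ℚ F] [IsPrincipalIdealRing (𝓞 F)]
    (h3 : Module.finrank F K = 3) {σ : Gal(K/F)} (hζ : IsPrimitiveRoot (ζ : F) 3)
    (hσθ : σ • θ = algebraMap (𝓞 F) (𝓞 K) ζ * θ) {d : ℕ} (hd : d ≠ 0) (hθ : θ ^ 3 = (d : 𝓞 K))
    (h : ∀ p, p.Prime → p ∣ d → p = 3 ∨ p % 9 = 8) : ∃ x : K, Algebra.norm F x = (ζ : F) := by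
  obtain ⟨M, _, _, hfin, _, hM, ω, τ, hω, hτ⟩ :=
    exists_kummer_extension hζ (pow_three_ne_of_isPrimitiveRoot hζ)
  have : CharZero M := charZero_of_injective_algebraMap (algebraMap F M).injective
  have : NumberField M := { to_finiteDimensional := FiniteDimensional.trans ℚ F M }
  have hω3 : IsIntegral ℤ (ω ^ 3) := by
    rw [hω]
    exact (RingOfIntegers.isIntegral_coe ζ).algebraMap
  set ω' : 𝓞 M := ⟨ω, hω3.of_pow (by norm_num)⟩ with hω'
  have hζ0 : ζ ^ 2 + ζ + 1 = 0 := by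
    apply RingOfIntegers.ext
    simpa using sq_add_add_one_eq_zero hζ
  have hω0 : ω ≠ 0 := by
    rintro rfl
    rw [zero_pow three_ne_zero, eq_comm, map_eq_zero] at hω
    exact hζ.ne_zero (by norm_num) hω
  have hζ1 : (ζ : F) ≠ 1 := hζ.ne_one (by norm_num)
  have hτ1 : τ ≠ 1 := by
    rintro rfl
    have h : ω = algebraMap F M ζ * ω := hτ
    rw [eq_comm, mul_eq_right₀ hω0, map_eq_one_iff _ (algebraMap F M).injective] at h
    exact hζ1 h
  obtain ⟨β, hβ⟩ := exists_norm_eq_natCast (ω := ω') hM hτ1 hζ0 hζ (RingOfIntegers.ext hω)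
    (RingOfIntegers.ext hτ) hd h
  refine exists_norm_eq_of_norm_eq h3 hM (σ := σ) (τ := τ) (d := (d : F)) (θ := (θ : K)) (ω := ω)
    hζ.pow_eq_one hζ1 (by exact_mod_cast hd) ?_ ?_ hω hτ ⟨β, hβ⟩
  · rw [← map_pow, hθ, map_natCast, map_natCast]
  · exact congrArg (algebraMap (𝓞 K) K) hσθ

open Classical in
/-- The ambiguous class number formula for `F(∛d) / F`, with `F = ℚ(ζ₃)`. -/
theorem card_ambClasses_mul_of_primes [IsCyclotomicExtension {3} ℚ F]
    [IsPrincipalIdealRing (𝓞 F)] (h3 : Module.finrank F K = 3) {σ : Gal(K/F)} (hσ : σ ≠ 1)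
    (hζ : IsPrimitiveRoot (ζ : F) 3)
    (hσθ : σ • θ = algebraMap (𝓞 F) (𝓞 K) ζ * θ) {d : ℕ} (hd : d ≠ 0)
    (hcf : ∀ p : ℕ, p.Prime → ¬ p ^ 3 ∣ d) (hns : ∀ p : ℕ, p.Prime → p ∣ d → p % 3 ≠ 1)
    (hθ : θ ^ 3 = (d : 𝓞 K)) :
    Nat.card (ambClasses h3 σ) * (if ∀ p, p.Prime → p ∣ d → p = 3 ∨ p % 9 = 8 then 3 else 9) =
      3 ^ (ramifiedPrimes d).card := by
  have hζ0 : ζ ^ 2 + ζ + 1 = 0 := by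
    apply RingOfIntegers.ext
    simpa using sq_add_add_one_eq_zero hζ
  rw [← card_totRamPrimes h3 hσ hζ0 hσθ hd hcf hns hθ, ← card_ambClasses_mul h3 hσ hζ]
  congr 2
  rw [eq_iff_iff]
  refine ⟨exists_norm_eq_of_primes h3 hζ hσθ hd hθ, ?_⟩
  rintro ⟨x, hx⟩ p hp hpd
  by_cases hp3 : p = 3
  · exact Or.inl hp3
  · have hpr : p ∈ ramifiedPrimes d :=
      mem_ramifiedPrimes.2 (Or.inl (Nat.mem_primeFactors.2 ⟨hp, hpd, hd⟩))
    obtain ⟨P, hP, hpP⟩ := exists_mem_totRamPrimes h3 hσ hζ0 hd hcf hns hθ hpr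
    refine Or.inr (mod_nine_of_norm_eq h3 hσ hζ0 hp ?_ hP hpP hx)
    have h1 := hns p hp hpd
    have h0 : p % 3 ≠ 0 := fun h => hp3
      ((Nat.prime_dvd_prime_iff_eq Nat.prime_three hp).1 (Nat.dvd_of_mod_eq_zero h)).symm
    omega

end ClassCount

section PureCubic

open scoped Pointwise

variable {d : ℕ}

lemma zetaK_isPrimitiveRoot : IsPrimitiveRoot (zetaK d) 3 :=
  IsPrimitiveRoot.of_map_of_injective (f := (Kc d).val) (k := 3) zeta3_isPrimitiveRoot
    (Kc d).val.injective

lemma zetaK0_isPrimitiveRoot : IsPrimitiveRoot (zetaK0 d) 3 :=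
  IsPrimitiveRoot.of_map_of_injective (f := (k0S d).val) (k := 3) zetaK_isPrimitiveRoot
    (k0S d).val.injective

instance : IsCyclotomicExtension {3} ℚ (k0S d) :=
  zetaK_isPrimitiveRoot.intermediateField_adjoin_isCyclotomicExtension ℚ

instance : IsPrincipalIdealRing (𝓞 (k0S d)) := IsCyclotomicExtension.Rat.three_pid _

lemma cbrtK_pow_three : cbrtK d ^ 3 = (d : Kc d) := by
  apply Subtype.ext
  simpa [cbrtK] using cbrt_pow_three d

lemma adjoin_cbrtK_eq_top : IntermediateField.adjoin (k0S d) {cbrtK d} = ⊤ := by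
  rw [eq_top_iff]
  rintro ⟨x, hx⟩ -
  induction hx using IntermediateField.adjoin_induction with
  | mem x hx =>
    rcases hx with rfl | rfl
    · exact IntermediateField.mem_adjoin_simple_self _ _
    · exact IntermediateField.algebraMap_mem _ (zetaK0 d)
  | algebraMap r =>
    exact IntermediateField.algebraMap_mem _ (algebraMap ℚ (k0S d) r)
  | add x y _ _ hx hy => exact add_mem hx hy
  | inv x _ hx => exact inv_mem hx
  | mul x y _ _ hx hy => exact mul_mem hx hy

lemma rat_pow_three_ne {d : ℕ} (hd : 1 < d) (hcf : IsCubeFree d) (r : ℚ) : r ^ 3 ≠ d := by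
  intro hr
  obtain ⟨p, hp, hpd⟩ := Nat.exists_prime_and_dvd hd.ne'
  have := Fact.mk hp
  have hr0 : r ≠ 0 := by
    rintro rfl
    rw [zero_pow three_ne_zero, eq_comm, Nat.cast_eq_zero] at hr
    omega
  have h1 := congrArg (padicValRat p) hr
  rw [padicValRat.pow, padicValRat.of_nat] at h1
  have h2 : 1 ≤ padicValNat p d := one_le_padicValNat_of_dvd (by omega) hpd
  have h3 : ¬ 3 ≤ padicValNat p d := fun h =>
    hcf p hp ((padicValNat_dvd_iff_le (by omega)).2 h)
  omega

lemma k0S_pow_three_ne (hd : 1 < d) (hcf : IsCubeFree d) (b : k0S d) : b ^ 3 ≠ d := by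
  intro hb
  have hirr := X_pow_sub_C_irreducible_of_prime Nat.prime_three (rat_pow_three_ne hd hcf)
  have hmin := minpoly.eq_of_irreducible_of_monic (x := b) hirr (by simp [hb])
    (Polynomial.monic_X_pow_sub_C _ three_ne_zero)
  have hdvd := minpoly.degree_dvd (IsIntegral.of_finite ℚ b)
  rw [← hmin, Polynomial.natDegree_X_pow_sub_C, finrank_cyclotomic_three] at hdvd
  omega

lemma irreducible_X_pow_sub_C_k0S (hd : 1 < d) (hcf : IsCubeFree d) :
    Irreducible (Polynomial.X ^ 3 - Polynomial.C (d : k0S d)) :=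
  X_pow_sub_C_irreducible_of_prime Nat.prime_three (k0S_pow_three_ne hd hcf)

lemma finrank_k0S_Kc (hd : 1 < d) (hcf : IsCubeFree d) : Module.finrank (k0S d) (Kc d) = 3 := by
  have hmin := minpoly.eq_of_irreducible_of_monic (x := cbrtK d)
    (irreducible_X_pow_sub_C_k0S hd hcf) (by simp [cbrtK_pow_three])
    (Polynomial.monic_X_pow_sub_C _ three_ne_zero)
  rw [← IntermediateField.finrank_top', ← adjoin_cbrtK_eq_top,
    IntermediateField.adjoin.finrank (IsIntegral.of_finite _ _), ← hmin,
    Polynomial.natDegree_X_pow_sub_C]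

lemma isGalois_k0S_Kc (hd : 1 < d) (hcf : IsCubeFree d) : IsGalois (k0S d) (Kc d) := by
  have h3 := finrank_k0S_Kc hd hcf
  have hζ : (primitiveRoots 3 (k0S d)).Nonempty :=
    ⟨zetaK0 d, (mem_primitiveRoots three_pos).2 zetaK0_isPrimitiveRoot⟩
  have := isSplittingField_X_pow_sub_C_of_root_adjoin_eq_top (K := k0S d) (L := Kc d)
    (a := (d : k0S d)) (α := cbrtK d) (h3.symm ▸ hζ) (by rw [h3]; simp [cbrtK_pow_three]) adjoin_cbrtK_eq_top
  rw [h3] at this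
  exact isGalois_of_isSplittingField_X_pow_sub_C hζ (irreducible_X_pow_sub_C_k0S hd hcf) _

lemma eq_one_of_apply_cbrtK_eq {σ : Gal(Kc d/k0S d)} (h : σ (cbrtK d) = cbrtK d) : σ = 1 := by
  ext1 x
  have hx : x ∈ IntermediateField.adjoin (k0S d) {cbrtK d} := by
    rw [adjoin_cbrtK_eq_top]; trivial
  rw [AlgEquiv.one_apply]
  induction hx using IntermediateField.adjoin_induction with
  | mem x hx => rwa [Set.mem_singleton_iff.1 hx]
  | algebraMap r => exact σ.commutes r
  | add x y _ _ hx hy => rw [map_add, hx, hy]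
  | inv x _ hx => rw [map_inv₀, hx]
  | mul x y _ _ hx hy => rw [map_mul, hx, hy]

lemma exists_apply_cbrtK_eq (hd : 1 < d) {σ : Gal(Kc d/k0S d)} (hσ : σ ≠ 1) :
    ∃ z : k0S d, IsPrimitiveRoot z 3 ∧ σ (cbrtK d) = algebraMap (k0S d) (Kc d) z * cbrtK d := by
  have hc0 : cbrtK d ≠ 0 := by
    intro h
    have := cbrtK_pow_three (d := d)
    rw [h, zero_pow three_ne_zero, eq_comm, Nat.cast_eq_zero] at this
    omega
  have h1 : (σ (cbrtK d) / cbrtK d) ^ 3 = 1 := by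
    rw [div_pow, ← map_pow, cbrtK_pow_three, map_natCast, ← cbrtK_pow_three,
      div_self (pow_ne_zero 3 hc0)]
  obtain ⟨i, hi, h2⟩ := (zetaK_isPrimitiveRoot (d := d)).eq_pow_of_pow_eq_one h1
  rw [eq_div_iff hc0] at h2
  have hi0 : i ≠ 0 := by
    rintro rfl
    rw [pow_zero, one_mul] at h2
    exact hσ (eq_one_of_apply_cbrtK_eq h2.symm)
  refine ⟨zetaK0 d ^ i, zetaK0_isPrimitiveRoot.pow_of_coprime i ?_, ?_⟩
  · interval_cases i
    · exact absurd rfl hi0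
    · norm_num
    · norm_num
  · rw [← h2, map_pow]
    rfl

lemma mem_ambiguousSet_iff [IsGalois (k0S d) (Kc d)] (h3 : Module.finrank (k0S d) (Kc d) = 3)
    {σ : Kc d ≃ₐ[ℚ] Kc d} {τ : Gal(Kc d/k0S d)} (h : ∀ x, τ x = σ x)
    (c : ClassGroup (𝓞 (Kc d))) : c ∈ ambiguousSet d σ ↔ c ∈ ambClasses h3 τ := by
  have hmap : ∀ I : Ideal (𝓞 (Kc d)), Ideal.map (RingOfIntegers.mapRingHom σ) I = τ • I := by
    intro I
    rw [Ideal.pointwise_smul_def]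
    congr 1
    exact RingHom.ext fun x => RingOfIntegers.ext (h x).symm
  constructor
  · intro hc
    obtain ⟨I, rfl⟩ := ClassGroup.mk0_surjective c
    rw [mem_ambClasses_iff]
    exact hc I rfl _ (hmap I).symm
  · rintro hc I rfl J hJ
    rw [mem_ambClasses_iff] at hc
    rw [← hc]
    congr 1
    exact Subtype.ext (hJ.trans (hmap I))

open Classical in
theorem card_ambiguousClassGroup (hd : 1 < d) (hcf : IsCubeFree d)
    (hns : ∀ p : ℕ, p.Prime → p ∣ d → p % 3 ≠ 1)
    (σ : Kc d ≃ₐ[ℚ] Kc d) (hσfix : ∀ x : Kc d, x ∈ k0S d → σ x = x) (hσ : σ ≠ 1) :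
    Nat.card (ambiguousClassGroup d σ) *
        (if ∀ p, p.Prime → p ∣ d → p = 3 ∨ p % 9 = 8 then 3 else 9) =
      3 ^ (ramifiedPrimes d).card ∧ ∀ c ∈ ambiguousClassGroup d σ, c ^ 3 = 1 := by
  have h3 := finrank_k0S_Kc hd hcf
  have := isGalois_k0S_Kc hd hcf
  let τ : Gal(Kc d/k0S d) := { σ with commutes' := fun x => hσfix x x.2 }
  have hτσ : ∀ x, τ x = σ x := fun _ => rfl
  have hτ : τ ≠ 1 := fun h => hσ (AlgEquiv.ext fun x => DFunLike.congr_fun h x)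
  obtain ⟨z, hz, hzτ⟩ := exists_apply_cbrtK_eq hd hτ
  let ζ : 𝓞 (k0S d) := ⟨z, hz.isIntegral (by norm_num)⟩
  have hIntegral : IsIntegral ℤ (cbrtK d) := by
    refine IsIntegral.of_pow (n := 3) (by norm_num) ?_
    rw [cbrtK_pow_three]
    exact isIntegral_natCast (R := ℤ) (B := Kc d) d
  let θ : 𝓞 (Kc d) := ⟨cbrtK d, hIntegral⟩
  have hpow := fun c => pow_three_eq_one_of_mem_ambClasses (c := c) h3 hτ
  have hset : ambiguousSet d σ = ambClasses h3 τ := Set.ext (mem_ambiguousSet_iff h3 hτσ)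
  have hA : ambiguousClassGroup d σ = ambClasses h3 τ := by
    rw [ambiguousClassGroup, hset, Subgroup.closure_eq, inf_eq_right]
    exact fun c hc => ⟨1, by simpa using hpow c hc⟩
  rw [hA]
  refine ⟨card_ambClasses_mul_of_primes (ζ := ζ) (θ := θ) h3 hτ hz (RingOfIntegers.ext hzτ)
    (by omega) hcf hns ?_, hpow⟩
  apply RingOfIntegers.ext
  exact cbrtK_pow_three.trans (map_natCast (algebraMap (𝓞 (Kc d)) (Kc d)) d).symm

end PureCubic

section RankOneForms

lemma rank_eq_one_iff_card_eq_three {G : Type*} [CommGroup G] [Finite G] [Group.FG G]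
    (h : ∀ g : G, g ^ 3 = 1) : Group.rank G = 1 ↔ Nat.card G = 3 := by
  constructor
  · intro hr
    obtain ⟨S, hS, htop⟩ := Group.rank_spec G
    rw [hr, Finset.card_eq_one] at hS
    obtain ⟨g, rfl⟩ := hS
    rw [Finset.coe_singleton, ← Subgroup.zpowers_eq_closure] at htop
    have hcard : Nat.card G = orderOf g := by
      rw [← Nat.card_zpowers, htop, Subgroup.card_top]
    rcases (Nat.dvd_prime Nat.prime_three).1 (orderOf_dvd_of_pow_eq_one (h g)) with h1 | h1
    · have : Subsingleton G := (Nat.card_eq_one_iff_unique.1 (hcard.trans h1)).1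
      have h0 : Group.rank G ≤ (∅ : Finset G).card := Group.rank_le (Subsingleton.elim _ _)
      rw [hr] at h0
      simp at h0
    · exact hcard.trans h1
  · intro hc
    have : Fact (Nat.Prime 3) := ⟨Nat.prime_three⟩
    have := isCyclic_of_prime_card hc
    obtain ⟨g, hg⟩ := IsCyclic.exists_generator (α := G)
    have h1 : Group.rank G ≤ ({g} : Finset G).card := by
      apply Group.rank_le
      rw [Finset.coe_singleton, ← Subgroup.zpowers_eq_closure, Subgroup.eq_top_iff']
      exact hg
    rw [Finset.card_singleton] at h1
    have h2 : Group.rank G ≠ 0 := by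
      intro h0
      obtain ⟨S, hS, htop⟩ := Group.rank_spec G
      rw [h0, Finset.card_eq_zero] at hS
      subst hS
      rw [Finset.coe_empty, Subgroup.closure_empty] at htop
      have := congrArg (fun H : Subgroup G => Nat.card H) htop
      simp [hc] at this
    omega

variable {d : ℕ}

lemma factorization_eq_one_or_two (hcf : IsCubeFree d) {p : ℕ} (hp : p ∈ d.primeFactors) :
    d.factorization p = 1 ∨ d.factorization p = 2 := by
  have hpp := Nat.prime_of_mem_primeFactors hp
  have hd := (Nat.mem_primeFactors.1 hp).2.2
  have h1 := (hpp.dvd_iff_one_le_factorization hd).1 (Nat.dvd_of_mem_primeFactors hp)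
  have h2 : ¬ 3 ≤ d.factorization p := fun h =>
    hcf p hpp ((hpp.pow_dvd_iff_le_factorization hd).2 h)
  omega

lemma eq_prod_primeFactors (hd : d ≠ 0) : d = ∏ p ∈ d.primeFactors, p ^ d.factorization p :=
  (Nat.prod_factorization_pow_eq_self hd).symm

lemma exists_eq_mul_of_primeFactors_eq (hd : d ≠ 0) (hcf : IsCubeFree d) {p q : ℕ} (hpq : p ≠ q)
    (h : d.primeFactors = {p, q}) :
    ∃ e f, (e = 1 ∨ e = 2) ∧ (f = 1 ∨ f = 2) ∧ d = p ^ e * q ^ f := by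
  refine ⟨d.factorization p, d.factorization q, factorization_eq_one_or_two hcf (by simp [h]),
    factorization_eq_one_or_two hcf (by simp [h]), ?_⟩
  conv_lhs => rw [eq_prod_primeFactors hd, h, Finset.prod_pair hpq]

lemma exists_eq_mul_mul_of_primeFactors_eq (hd : d ≠ 0) (hcf : IsCubeFree d) {p q r : ℕ}
    (hpq : p ≠ q) (hpr : p ≠ r) (hqr : q ≠ r) (h : d.primeFactors = {p, q, r}) :
    ∃ e f g, (e = 1 ∨ e = 2) ∧ (f = 1 ∨ f = 2) ∧ (g = 1 ∨ g = 2) ∧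
      d = p ^ e * q ^ f * r ^ g := by
  refine ⟨d.factorization p, d.factorization q, d.factorization r,
    factorization_eq_one_or_two hcf (by simp [h]), factorization_eq_one_or_two hcf (by simp [h]),
    factorization_eq_one_or_two hcf (by simp [h]), ?_⟩
  conv_lhs => rw [eq_prod_primeFactors hd, h, Finset.prod_insert (by simp [hpq, hpr]),
    Finset.prod_pair hqr, ← mul_assoc]

lemma primeFactors_mul_pow {p q e f : ℕ} (hp : p.Prime) (hq : q.Prime) (he : e = 1 ∨ e = 2)
    (hf : f = 1 ∨ f = 2) : (p ^ e * q ^ f).primeFactors = {p, q} := by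
  rw [Nat.primeFactors_mul (pow_ne_zero _ hp.ne_zero) (pow_ne_zero _ hq.ne_zero),
    Nat.primeFactors_pow _ (by omega), Nat.primeFactors_pow _ (by omega), hp.primeFactors,
    hq.primeFactors]
  rfl

lemma primeFactors_mul_pow_mul_pow {p q r e f g : ℕ} (hp : p.Prime) (hq : q.Prime) (hr : r.Prime)
    (he : e = 1 ∨ e = 2) (hf : f = 1 ∨ f = 2) (hg : g = 1 ∨ g = 2) :
    (p ^ e * q ^ f * r ^ g).primeFactors = {p, q, r} := by
  rw [Nat.primeFactors_mul (mul_ne_zero (pow_ne_zero _ hp.ne_zero) (pow_ne_zero _ hq.ne_zero))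
    (pow_ne_zero _ hr.ne_zero), primeFactors_mul_pow hp hq he hf,
    Nat.primeFactors_pow _ (by omega), hr.primeFactors]
  ext x
  simp

lemma mod_nine_of_forall_prime (hd : d ≠ 0) (h : ∀ p, p.Prime → p ∣ d → p % 9 = 8) :
    d % 9 = 1 ∨ d % 9 = 8 := by
  induction d using Nat.recOnMul with
  | zero => exact absurd rfl hd
  | one => simp
  | prime p hp => exact Or.inr (h p hp dvd_rfl)
  | mul a b iha ihb =>
    have h1 := iha (left_ne_zero_of_mul hd) fun p hp hpa => h p hp (hpa.mul_right b)
    have h2 := ihb (right_ne_zero_of_mul hd) fun p hp hpb => h p hp (hpb.mul_left a)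
    rw [Nat.mul_mod]
    rcases h1 with h1 | h1 <;> rcases h2 with h2 | h2 <;> simp [h1, h2]

lemma ramifiedPrimes_of_three_dvd (hd : d ≠ 0) (h : 3 ∣ d) :
    ramifiedPrimes d = d.primeFactors := by
  rw [ramifiedPrimes]
  split_ifs
  · rfl
  · exact Finset.insert_eq_of_mem (Nat.mem_primeFactors.2 ⟨Nat.prime_three, h, hd⟩)

lemma ramifiedPrimes_of_mod_nine (h : d % 9 = 1 ∨ d % 9 = 8) :
    ramifiedPrimes d = d.primeFactors := if_pos h

lemma card_ramifiedPrimes_of_not (h3 : ¬ 3 ∣ d) (h : ¬ (d % 9 = 1 ∨ d % 9 = 8)) :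
    (ramifiedPrimes d).card = d.primeFactors.card + 1 := by
  rw [ramifiedPrimes, if_neg h, Finset.card_insert_of_notMem]
  exact fun h => h3 (Nat.dvd_of_mem_primeFactors h)

lemma mod_three_of_prime_dvd (hns : ∀ p : ℕ, p.Prime → p ∣ d → p % 3 ≠ 1) {p : ℕ} (hp : p.Prime)
    (hpd : p ∣ d) (hp3 : p ≠ 3) : p % 3 = 2 := by
  have h1 := hns p hp hpd
  have h0 : p % 3 ≠ 0 := fun h => hp3
    ((Nat.prime_dvd_prime_iff_eq Nat.prime_three hp).1 (Nat.dvd_of_mod_eq_zero h)).symm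
  omega

/-- The shapes of `d` for which the ambiguous `3`-class group of `k / k₀` has order `3`. -/
def IsRankOneForm (d : ℕ) : Prop :=
    (∃ q e f₁ : ℕ, q.Prime ∧ q % 9 = 8 ∧ (e = 1 ∨ e = 2) ∧ (f₁ = 1 ∨ f₁ = 2) ∧
        d = 3 ^ e * q ^ f₁) ∨
      (∃ q₁ q₂ f₁ f₂ : ℕ, q₁.Prime ∧ q₂.Prime ∧ q₁ ≠ q₂ ∧ q₁ % 9 = 8 ∧ q₂ % 9 = 8 ∧
        (f₁ = 1 ∨ f₁ = 2) ∧ (f₂ = 1 ∨ f₂ = 2) ∧ d = q₁ ^ f₁ * q₂ ^ f₂) ∨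
      (∃ q₁ q₂ f₁ f₂ : ℕ, q₁.Prime ∧ q₂.Prime ∧ q₁ ≠ q₂ ∧ q₁ % 3 = 2 ∧ q₂ % 3 = 2 ∧
        (q₁ % 9 ≠ 8 ∨ q₂ % 9 ≠ 8) ∧ (f₁ = 1 ∨ f₁ = 2) ∧ (f₂ = 1 ∨ f₂ = 2) ∧
        d = q₁ ^ f₁ * q₂ ^ f₂ ∧ ¬(d % 9 = 1 ∨ d % 9 = 8)) ∨
      (∃ q₁ q₂ e f₁ f₂ : ℕ, q₁.Prime ∧ q₂.Prime ∧ q₁ ≠ q₂ ∧ q₁ % 3 = 2 ∧ q₂ % 3 = 2 ∧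
        (q₁ % 9 ≠ 8 ∨ q₂ % 9 ≠ 8) ∧ (e = 1 ∨ e = 2) ∧ (f₁ = 1 ∨ f₁ = 2) ∧ (f₂ = 1 ∨ f₂ = 2) ∧
        d = 3 ^ e * q₁ ^ f₁ * q₂ ^ f₂) ∨
      (∃ q₁ q₂ q₃ f₁ f₂ f₃ : ℕ, q₁.Prime ∧ q₂.Prime ∧ q₃.Prime ∧
        q₁ ≠ q₂ ∧ q₁ ≠ q₃ ∧ q₂ ≠ q₃ ∧
        (q₁ % 9 = 2 ∨ q₁ % 9 = 5) ∧ (q₂ % 9 = 2 ∨ q₂ % 9 = 5) ∧ q₃ % 9 = 8 ∧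
        (f₁ = 1 ∨ f₁ = 2) ∧ (f₂ = 1 ∨ f₂ = 2) ∧ (f₃ = 1 ∨ f₃ = 2) ∧
        d = q₁ ^ f₁ * q₂ ^ f₂ * q₃ ^ f₃ ∧ (d % 9 = 1 ∨ d % 9 = 8)) ∨
      (∃ q₁ q₂ q₃ f₁ f₂ f₃ : ℕ, q₁.Prime ∧ q₂.Prime ∧ q₃.Prime ∧
        q₁ ≠ q₂ ∧ q₁ ≠ q₃ ∧ q₂ ≠ q₃ ∧
        (q₁ % 9 = 2 ∨ q₁ % 9 = 5) ∧ (q₂ % 9 = 2 ∨ q₂ % 9 = 5) ∧ (q₃ % 9 = 2 ∨ q₃ % 9 = 5) ∧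
        (f₁ = 1 ∨ f₁ = 2) ∧ (f₂ = 1 ∨ f₂ = 2) ∧ (f₃ = 1 ∨ f₃ = 2) ∧
        d = q₁ ^ f₁ * q₂ ^ f₂ * q₃ ^ f₃ ∧ (d % 9 = 1 ∨ d % 9 = 8))

lemma isRankOneForm_of_card_ramifiedPrimes (hd : d ≠ 0) (hcf : IsCubeFree d)
    (hns : ∀ p : ℕ, p.Prime → p ∣ d → p % 3 ≠ 1)
    (h : (∀ p, p.Prime → p ∣ d → p = 3 ∨ p % 9 = 8) ∧ (ramifiedPrimes d).card = 2 ∨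
      (¬ ∀ p, p.Prime → p ∣ d → p = 3 ∨ p % 9 = 8) ∧ (ramifiedPrimes d).card = 3) :
    IsRankOneForm d := by
  have hpr : ∀ {p}, p ∈ d.primeFactors → p.Prime := fun hp => Nat.prime_of_mem_primeFactors hp
  have hdv : ∀ {p}, p ∈ d.primeFactors → p ∣ d := fun hp => Nat.dvd_of_mem_primeFactors hp
  rcases h with ⟨h8, hc⟩ | ⟨h8, hc⟩
  · by_cases h3 : 3 ∣ d
    · rw [ramifiedPrimes_of_three_dvd hd h3] at hc
      have h3m : 3 ∈ d.primeFactors := Nat.mem_primeFactors.2 ⟨Nat.prime_three, h3, hd⟩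
      obtain ⟨q, hq⟩ := Finset.card_eq_one.1 ((Finset.card_erase_of_mem h3m).trans (by rw [hc]))
      have hqm : q ∈ d.primeFactors.erase 3 := by simp [hq]
      obtain ⟨hq3, hqm⟩ := Finset.mem_erase.1 hqm
      have hpf : d.primeFactors = {3, q} := by rw [← Finset.insert_erase h3m, hq]
      obtain ⟨e, f, he, hf, h⟩ := exists_eq_mul_of_primeFactors_eq hd hcf hq3.symm hpf
      exact Or.inl ⟨q, e, f, hpr hqm, (h8 q (hpr hqm) (hdv hqm)).resolve_left hq3, he, hf, h⟩
    · have h8' : ∀ p, p.Prime → p ∣ d → p % 9 = 8 := fun p hp hpd =>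
        (h8 p hp hpd).resolve_left (by rintro rfl; exact h3 hpd)
      rw [ramifiedPrimes_of_mod_nine (mod_nine_of_forall_prime hd h8')] at hc
      obtain ⟨p, q, hpq, hpf⟩ := Finset.card_eq_two.1 hc
      have hpm : p ∈ d.primeFactors := by simp [hpf]
      have hqm : q ∈ d.primeFactors := by simp [hpf]
      obtain ⟨e, f, he, hf, h⟩ := exists_eq_mul_of_primeFactors_eq hd hcf hpq hpf
      exact Or.inr <| Or.inl ⟨p, q, e, f, hpr hpm, hpr hqm, hpq, h8' p (hpr hpm) (hdv hpm),
        h8' q (hpr hqm) (hdv hqm), he, hf, h⟩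
  · push Not at h8
    obtain ⟨r, hr, hrd, hr3, hr8⟩ := h8
    have hrm : r ∈ d.primeFactors := Nat.mem_primeFactors.2 ⟨hr, hrd, hd⟩
    by_cases h3 : 3 ∣ d
    · rw [ramifiedPrimes_of_three_dvd hd h3] at hc
      have h3m : 3 ∈ d.primeFactors := Nat.mem_primeFactors.2 ⟨Nat.prime_three, h3, hd⟩
      obtain ⟨p, q, hpq, he⟩ := Finset.card_eq_two.1
        ((Finset.card_erase_of_mem h3m).trans (by rw [hc]))
      have hpm : p ∈ d.primeFactors.erase 3 := by simp [he]
      have hqm : q ∈ d.primeFactors.erase 3 := by simp [he]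
      have hre : r ∈ d.primeFactors.erase 3 := Finset.mem_erase.2 ⟨hr3, hrm⟩
      obtain ⟨hp3, hpm⟩ := Finset.mem_erase.1 hpm
      obtain ⟨hq3, hqm⟩ := Finset.mem_erase.1 hqm
      have hpf : d.primeFactors = {3, p, q} := by rw [← Finset.insert_erase h3m, he]
      obtain ⟨e, f, g, he', hf, hg, h⟩ :=
        exists_eq_mul_mul_of_primeFactors_eq hd hcf hp3.symm hq3.symm hpq hpf
      have h8 : p % 9 ≠ 8 ∨ q % 9 ≠ 8 := by
        rw [he, Finset.mem_insert, Finset.mem_singleton] at hre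
        rcases hre with rfl | rfl
        · exact Or.inl hr8
        · exact Or.inr hr8
      exact Or.inr <| Or.inr <| Or.inr <| Or.inl ⟨p, q, e, f, g, hpr hpm, hpr hqm, hpq,
        mod_three_of_prime_dvd hns (hpr hpm) (hdv hpm) hp3,
        mod_three_of_prime_dvd hns (hpr hqm) (hdv hqm) hq3, h8, he', hf, hg, h⟩
    · have hm3 : ∀ p, p.Prime → p ∣ d → p % 3 = 2 := fun p hp hpd =>
        mod_three_of_prime_dvd hns hp hpd (by rintro rfl; exact h3 hpd)
      by_cases h9 : d % 9 = 1 ∨ d % 9 = 8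
      · rw [ramifiedPrimes_of_mod_nine h9] at hc
        obtain ⟨a, b, c, hab, hac, hbc, hpf⟩ := Finset.card_eq_three.1 hc
        have ham : a ∈ d.primeFactors := by simp [hpf]
        have hbm : b ∈ d.primeFactors := by simp [hpf]
        have hcm : c ∈ d.primeFactors := by simp [hpf]
        obtain ⟨e, f, g, he, hf, hg, h⟩ :=
          exists_eq_mul_mul_of_primeFactors_eq hd hcf hab hac hbc hpf
        have key : ∀ p ∈ d.primeFactors, (p % 9 = 2 ∨ p % 9 = 5) ∨ p % 9 = 8 := fun p hp => by
          have := hm3 p (hpr hp) (hdv hp)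
          omega
        have hone : ∀ {p q r i j k : ℕ}, (p % 9 = 2 ∨ p % 9 = 5) → q % 9 = 8 → r % 9 = 8 →
            (i = 1 ∨ i = 2) → (j = 1 ∨ j = 2) → (k = 1 ∨ k = 2) →
            ¬ ((p ^ i * q ^ j * r ^ k) % 9 = 1 ∨ (p ^ i * q ^ j * r ^ k) % 9 = 8) := by
          intro p q r i j k hp hq hr hi hj hk
          rcases hp with hp | hp <;> rcases hi with rfl | rfl <;> rcases hj with rfl | rfl <;>
            rcases hk with rfl | rfl <;> simp [Nat.mul_mod, Nat.pow_mod, hp, hq, hr]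
        refine Or.inr <| Or.inr <| Or.inr <| Or.inr ?_
        rcases key a ham with ha | ha <;> rcases key b hbm with hb | hb <;>
          rcases key c hcm with hc' | hc'
        · exact Or.inr ⟨a, b, c, e, f, g, hpr ham, hpr hbm, hpr hcm, hab, hac, hbc, ha, hb, hc',
            he, hf, hg, h, h9⟩
        · exact Or.inl ⟨a, b, c, e, f, g, hpr ham, hpr hbm, hpr hcm, hab, hac, hbc, ha, hb, hc',
            he, hf, hg, h, h9⟩
        · exact Or.inl ⟨a, c, b, e, g, f, hpr ham, hpr hcm, hpr hbm, hac, hab, hbc.symm, ha, hc',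
            hb, he, hg, hf, h.trans (by ring), h9⟩
        · exact absurd (h ▸ h9) (hone ha hb hc' he hf hg)
        · exact Or.inl ⟨b, c, a, f, g, e, hpr hbm, hpr hcm, hpr ham, hbc, hab.symm, hac.symm, hb,
            hc', ha, hf, hg, he, h.trans (by ring), h9⟩
        · have h' : d = b ^ f * a ^ e * c ^ g := h.trans (by ring)
          exact absurd (h' ▸ h9) (hone hb ha hc' hf he hg)
        · have h' : d = c ^ g * a ^ e * b ^ f := h.trans (by ring)
          exact absurd (h' ▸ h9) (hone hc' ha hb hg he hf)
        · exfalso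
          rw [hpf, Finset.mem_insert, Finset.mem_insert, Finset.mem_singleton] at hrm
          rcases hrm with rfl | rfl | rfl <;> exact hr8 ‹_›
      · rw [card_ramifiedPrimes_of_not h3 h9] at hc
        obtain ⟨p, q, hpq, hpf⟩ := Finset.card_eq_two.1 (Nat.succ.inj hc)
        have hpm : p ∈ d.primeFactors := by simp [hpf]
        have hqm : q ∈ d.primeFactors := by simp [hpf]
        obtain ⟨e, f, he, hf, h⟩ := exists_eq_mul_of_primeFactors_eq hd hcf hpq hpf
        have h8 : p % 9 ≠ 8 ∨ q % 9 ≠ 8 := by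
          rw [hpf, Finset.mem_insert, Finset.mem_singleton] at hrm
          rcases hrm with rfl | rfl
          · exact Or.inl hr8
          · exact Or.inr hr8
        exact Or.inr <| Or.inr <| Or.inl ⟨p, q, e, f, hpr hpm, hpr hqm, hpq,
          hm3 p (hpr hpm) (hdv hpm), hm3 q (hpr hqm) (hdv hqm), h8, he, hf, h, h9⟩

lemma card_ramifiedPrimes_of_isRankOneForm (hd : d ≠ 0) (h : IsRankOneForm d) :
    (∀ p, p.Prime → p ∣ d → p = 3 ∨ p % 9 = 8) ∧ (ramifiedPrimes d).card = 2 ∨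
      (¬ ∀ p, p.Prime → p ∣ d → p = 3 ∨ p % 9 = 8) ∧ (ramifiedPrimes d).card = 3 := by
  have key : ∀ {p}, p ∈ d.primeFactors ↔ p.Prime ∧ p ∣ d := by simp [hd]
  have hnot : ∀ {p}, p ∈ d.primeFactors → p % 3 = 2 → p % 9 ≠ 8 →
      ¬ ∀ p, p.Prime → p ∣ d → p = 3 ∨ p % 9 = 8 := by
    intro p hp h2 h8 H
    rcases H p (key.1 hp).1 (key.1 hp).2 with rfl | h
    · omega
    · exact h8 h
  rcases h with ⟨q, e, f, hq, hq8, he, hf, h⟩ | ⟨p, q, e, f, hp, hq, hpq, hp8, hq8, he, hf, h⟩ |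
    ⟨p, q, e, f, hp, hq, hpq, hp2, hq2, h8, he, hf, h, h9⟩ |
    ⟨p, q, g, e, f, hp, hq, hpq, hp2, hq2, h8, hg, he, hf, h⟩ |
    ⟨p, q, r, e, f, g, hp, hq, hr, hpq, hpr, hqr, hp2, hq2, hr8, he, hf, hg, h, h9⟩ |
    ⟨p, q, r, e, f, g, hp, hq, hr, hpq, hpr, hqr, hp2, hq2, hr2, he, hf, hg, h, h9⟩
  · have hpf := primeFactors_mul_pow Nat.prime_three hq he hf
    rw [← h] at hpf
    refine Or.inl ⟨fun p hp hpd => ?_, ?_⟩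
    · have := key.2 ⟨hp, hpd⟩
      rw [hpf, Finset.mem_insert, Finset.mem_singleton] at this
      rcases this with rfl | rfl
      · exact Or.inl rfl
      · exact Or.inr hq8
    · rw [ramifiedPrimes_of_three_dvd hd (key.1 (by simp [hpf])).2, hpf,
        Finset.card_pair (by rintro rfl; omega)]
  · have hpf := primeFactors_mul_pow hp hq he hf
    rw [← h] at hpf
    have hall : ∀ p, p.Prime → p ∣ d → p % 9 = 8 := fun r hr hrd => by
      have := key.2 ⟨hr, hrd⟩
      rw [hpf, Finset.mem_insert, Finset.mem_singleton] at this
      rcases this with rfl | rfl <;> assumption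
    refine Or.inl ⟨fun r hr hrd => Or.inr (hall r hr hrd), ?_⟩
    rw [ramifiedPrimes_of_mod_nine (mod_nine_of_forall_prime hd hall), hpf, Finset.card_pair hpq]
  · have hpf := primeFactors_mul_pow hp hq he hf
    rw [← h] at hpf
    refine Or.inr ⟨?_, ?_⟩
    · rcases h8 with h8 | h8
      · exact hnot (by simp [hpf]) hp2 h8
      · exact hnot (by simp [hpf]) hq2 h8
    · have h3 : ¬ 3 ∣ d := fun h3 => by
        have := key.2 ⟨Nat.prime_three, h3⟩
        rw [hpf, Finset.mem_insert, Finset.mem_singleton] at this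
        omega
      rw [card_ramifiedPrimes_of_not h3 h9, hpf, Finset.card_pair hpq]
  · have hpf := primeFactors_mul_pow_mul_pow Nat.prime_three hp hq hg he hf
    rw [← h] at hpf
    refine Or.inr ⟨?_, ?_⟩
    · rcases h8 with h8 | h8
      · exact hnot (by simp [hpf]) hp2 h8
      · exact hnot (by simp [hpf]) hq2 h8
    · rw [ramifiedPrimes_of_three_dvd hd (key.1 (by simp [hpf])).2, hpf]
      exact Finset.card_eq_three.2 ⟨3, p, q, by omega, by omega, hpq, rfl⟩
  all_goals
    have hpf := primeFactors_mul_pow_mul_pow hp hq hr he hf hg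
    rw [← h] at hpf
    refine Or.inr ⟨hnot (p := p) (by simp [hpf]) (by omega) (by omega), ?_⟩
    rw [ramifiedPrimes_of_mod_nine h9, hpf]
    exact Finset.card_eq_three.2 ⟨p, q, r, hpq, hpr, hqr, rfl⟩

open Classical in
lemma isRankOneForm_iff_card_eq_three (hd : 1 < d) (hcf : IsCubeFree d)
    (hns : ∀ p : ℕ, p.Prime → p ∣ d → p % 3 ≠ 1) {n : ℕ}
    (hn : n * (if ∀ p, p.Prime → p ∣ d → p = 3 ∨ p % 9 = 8 then 3 else 9) =
      3 ^ (ramifiedPrimes d).card) : IsRankOneForm d ↔ n = 3 := by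
  have hd0 : d ≠ 0 := by omega
  constructor
  · intro h
    rcases card_ramifiedPrimes_of_isRankOneForm hd0 h with ⟨h8, hc⟩ | ⟨h8, hc⟩
    · rw [if_pos h8, hc] at hn
      omega
    · rw [if_neg h8, hc] at hn
      omega
  · rintro rfl
    refine isRankOneForm_of_card_ramifiedPrimes hd0 hcf hns ?_
    split_ifs at hn with h8
    · exact Or.inl ⟨h8, (Nat.pow_right_injective (by norm_num : 2 ≤ 3) hn.symm : _ = 2)⟩
    · exact Or.inr ⟨h8, (Nat.pow_right_injective (by norm_num : 2 ≤ 3) hn.symm : _ = 3)⟩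

end RankOneForms

/-- **Theorem 2.7**: for a cube-free integer `d > 1` all of whose prime divisors are
`≢ 1 (mod 3)`, with at least one prime divisor `≡ -1 (mod 3)`, the ambiguous `3`-class
group of `k/k₀` has rank `1` exactly for the listed forms of `d`; moreover in these cases
it is cyclic of order `3`. -/
theorem rank_one_conductor_nonsplit_primes
    (d : ℕ) (hd : 1 < d) (hdcf : IsCubeFree d)
    (hnosplit : ∀ p : ℕ, p.Prime → p ∣ d → p % 3 ≠ 1)
    (hq : ∃ q : ℕ, q.Prime ∧ q ∣ d ∧ q % 3 = 2)
    (σ : ↥(Kc d) ≃ₐ[ℚ] ↥(Kc d)) (hσfix : ∀ x : ↥(Kc d), x ∈ k0S d → σ x = x)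
    (hσne : σ ≠ 1) :
    (Group.rank ↥(ambiguousClassGroup d σ) = 1 ↔
      ((∃ q e f₁ : ℕ, q.Prime ∧ q % 9 = 8 ∧ (e = 1 ∨ e = 2) ∧ (f₁ = 1 ∨ f₁ = 2) ∧
        d = 3 ^ e * q ^ f₁) ∨
      (∃ q₁ q₂ f₁ f₂ : ℕ, q₁.Prime ∧ q₂.Prime ∧ q₁ ≠ q₂ ∧ q₁ % 9 = 8 ∧ q₂ % 9 = 8 ∧
        (f₁ = 1 ∨ f₁ = 2) ∧ (f₂ = 1 ∨ f₂ = 2) ∧ d = q₁ ^ f₁ * q₂ ^ f₂) ∨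
      (∃ q₁ q₂ f₁ f₂ : ℕ, q₁.Prime ∧ q₂.Prime ∧ q₁ ≠ q₂ ∧ q₁ % 3 = 2 ∧ q₂ % 3 = 2 ∧
        (q₁ % 9 ≠ 8 ∨ q₂ % 9 ≠ 8) ∧ (f₁ = 1 ∨ f₁ = 2) ∧ (f₂ = 1 ∨ f₂ = 2) ∧
        d = q₁ ^ f₁ * q₂ ^ f₂ ∧ ¬(d % 9 = 1 ∨ d % 9 = 8)) ∨
      (∃ q₁ q₂ e f₁ f₂ : ℕ, q₁.Prime ∧ q₂.Prime ∧ q₁ ≠ q₂ ∧ q₁ % 3 = 2 ∧ q₂ % 3 = 2 ∧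
        (q₁ % 9 ≠ 8 ∨ q₂ % 9 ≠ 8) ∧ (e = 1 ∨ e = 2) ∧ (f₁ = 1 ∨ f₁ = 2) ∧ (f₂ = 1 ∨ f₂ = 2) ∧
        d = 3 ^ e * q₁ ^ f₁ * q₂ ^ f₂) ∨
      (∃ q₁ q₂ q₃ f₁ f₂ f₃ : ℕ, q₁.Prime ∧ q₂.Prime ∧ q₃.Prime ∧
        q₁ ≠ q₂ ∧ q₁ ≠ q₃ ∧ q₂ ≠ q₃ ∧
        (q₁ % 9 = 2 ∨ q₁ % 9 = 5) ∧ (q₂ % 9 = 2 ∨ q₂ % 9 = 5) ∧ q₃ % 9 = 8 ∧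
        (f₁ = 1 ∨ f₁ = 2) ∧ (f₂ = 1 ∨ f₂ = 2) ∧ (f₃ = 1 ∨ f₃ = 2) ∧
        d = q₁ ^ f₁ * q₂ ^ f₂ * q₃ ^ f₃ ∧ (d % 9 = 1 ∨ d % 9 = 8)) ∨
      (∃ q₁ q₂ q₃ f₁ f₂ f₃ : ℕ, q₁.Prime ∧ q₂.Prime ∧ q₃.Prime ∧
        q₁ ≠ q₂ ∧ q₁ ≠ q₃ ∧ q₂ ≠ q₃ ∧
        (q₁ % 9 = 2 ∨ q₁ % 9 = 5) ∧ (q₂ % 9 = 2 ∨ q₂ % 9 = 5) ∧ (q₃ % 9 = 2 ∨ q₃ % 9 = 5) ∧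
        (f₁ = 1 ∨ f₁ = 2) ∧ (f₂ = 1 ∨ f₂ = 2) ∧ (f₃ = 1 ∨ f₃ = 2) ∧
        d = q₁ ^ f₁ * q₂ ^ f₂ * q₃ ^ f₃ ∧ (d % 9 = 1 ∨ d % 9 = 8)))) ∧
    (((∃ q e f₁ : ℕ, q.Prime ∧ q % 9 = 8 ∧ (e = 1 ∨ e = 2) ∧ (f₁ = 1 ∨ f₁ = 2) ∧
        d = 3 ^ e * q ^ f₁) ∨
      (∃ q₁ q₂ f₁ f₂ : ℕ, q₁.Prime ∧ q₂.Prime ∧ q₁ ≠ q₂ ∧ q₁ % 9 = 8 ∧ q₂ % 9 = 8 ∧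
        (f₁ = 1 ∨ f₁ = 2) ∧ (f₂ = 1 ∨ f₂ = 2) ∧ d = q₁ ^ f₁ * q₂ ^ f₂) ∨
      (∃ q₁ q₂ f₁ f₂ : ℕ, q₁.Prime ∧ q₂.Prime ∧ q₁ ≠ q₂ ∧ q₁ % 3 = 2 ∧ q₂ % 3 = 2 ∧
        (q₁ % 9 ≠ 8 ∨ q₂ % 9 ≠ 8) ∧ (f₁ = 1 ∨ f₁ = 2) ∧ (f₂ = 1 ∨ f₂ = 2) ∧
        d = q₁ ^ f₁ * q₂ ^ f₂ ∧ ¬(d % 9 = 1 ∨ d % 9 = 8)) ∨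
      (∃ q₁ q₂ e f₁ f₂ : ℕ, q₁.Prime ∧ q₂.Prime ∧ q₁ ≠ q₂ ∧ q₁ % 3 = 2 ∧ q₂ % 3 = 2 ∧
        (q₁ % 9 ≠ 8 ∨ q₂ % 9 ≠ 8) ∧ (e = 1 ∨ e = 2) ∧ (f₁ = 1 ∨ f₁ = 2) ∧ (f₂ = 1 ∨ f₂ = 2) ∧
        d = 3 ^ e * q₁ ^ f₁ * q₂ ^ f₂) ∨
      (∃ q₁ q₂ q₃ f₁ f₂ f₃ : ℕ, q₁.Prime ∧ q₂.Prime ∧ q₃.Prime ∧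
        q₁ ≠ q₂ ∧ q₁ ≠ q₃ ∧ q₂ ≠ q₃ ∧
        (q₁ % 9 = 2 ∨ q₁ % 9 = 5) ∧ (q₂ % 9 = 2 ∨ q₂ % 9 = 5) ∧ q₃ % 9 = 8 ∧
        (f₁ = 1 ∨ f₁ = 2) ∧ (f₂ = 1 ∨ f₂ = 2) ∧ (f₃ = 1 ∨ f₃ = 2) ∧
        d = q₁ ^ f₁ * q₂ ^ f₂ * q₃ ^ f₃ ∧ (d % 9 = 1 ∨ d % 9 = 8)) ∨
      (∃ q₁ q₂ q₃ f₁ f₂ f₃ : ℕ, q₁.Prime ∧ q₂.Prime ∧ q₃.Prime ∧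
        q₁ ≠ q₂ ∧ q₁ ≠ q₃ ∧ q₂ ≠ q₃ ∧
        (q₁ % 9 = 2 ∨ q₁ % 9 = 5) ∧ (q₂ % 9 = 2 ∨ q₂ % 9 = 5) ∧ (q₃ % 9 = 2 ∨ q₃ % 9 = 5) ∧
        (f₁ = 1 ∨ f₁ = 2) ∧ (f₂ = 1 ∨ f₂ = 2) ∧ (f₃ = 1 ∨ f₃ = 2) ∧
        d = q₁ ^ f₁ * q₂ ^ f₂ * q₃ ^ f₃ ∧ (d % 9 = 1 ∨ d % 9 = 8))) →
      Nat.card ↥(ambiguousClassGroup d σ) = 3 ∧ IsCyclic ↥(ambiguousClassGroup d σ)) := by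
  obtain ⟨hcard, hexp⟩ := card_ambiguousClassGroup hd hdcf hnosplit σ hσfix hσne
  have h3 : ∀ g : ↥(ambiguousClassGroup d σ), g ^ 3 = 1 := fun g => Subtype.ext (hexp g g.2)
  have hform := isRankOneForm_iff_card_eq_three hd hdcf hnosplit hcard
  refine ⟨(rank_eq_one_iff_card_eq_three h3).trans hform.symm, fun h => ?_⟩
  have hc := hform.1 h
  exact ⟨hc, isCyclic_of_prime_card hc⟩

end
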